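/- For every C_U > 0 and every ε ∈ (0,1) there exist κ > 0 and x₀ such that for all x ≥ x₀ and all integers M with M ≤ κ·x^{1/5} and ω(M) ≤ exp(log₂M·log₄M/log₃M), the following holds: setting y = exp((1−ε)·log x·log₃x/log₂x) and U = C_U·(φ(M)/M)·x·log y/log₂x, there is a choice of residue classes a_p (mod p), one for each prime p ≤ x with p ∤ M, such that every integer n with 1 ≤ n ≤ U satisfies n ≡ a_p (mod p) for some prime p ≤ x with p ∤ M (i.e. the primes up to x not dividing M sieve out the interval [1, U]). -/

import Mathlib

open scoped Classical

/-- `y = exp((1−ε)·log x·log₃x/log₂x)`. -/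
noncomputable def yy (ε x : ℝ) : ℝ :=
  Real.exp ((1 - ε) * Real.log x * Real.log^[3] x / Real.log^[2] x)

/-- `U = C_U·(φ(M)/M)·x·log y/log₂ x`. -/
noncomputable def UU (CU : ℝ) (M : ℕ) (ε x : ℝ) : ℝ :=
  CU * ((M.totient : ℝ) / (M : ℝ)) * x * Real.log (yy ε x) / Real.log^[2] x

section
open Finset (prod_mul_distrib prod_univ_sum mul_sum prod_nonneg sum_comm sum_congr prod_pow sum_mul_sum sum_sub_distrib sum_product prod_congr univ mul_prod_erase mem_univ prod_le_one sum_le_sum mem_filter sum_mul ext_iff sum_nonneg sum_filter sum_div prod_le_prod prod_const sum_le_sum_of_subset_of_nonneg filter_subset sum_const card_le_card_of_injOn mem_coe card_univ sum_add_distrib prod_eq_zero abs_sum_le_sum_abs prod_filter prod_pos prod_inv_distrib range prod_coe_sort single_le_sum sum_image mem_image mem_range mem_product prod_subset subset_univ card_product prod_sdiff mem_powerset inter_subset_right Icc coe_filter sum_sigma' mem_sigma disjoint_left card_le_card card_singleton mem_union empty_subset prod_ite_eq' ne_of_mem_erase card_erase_of_mem Ico card_pos mem_Ico mem_Icc sum_fiberwise_of_maps_to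 mem_inter prod_union Ioc mem_Ioc prod_map mem_Ioo exists_le_of_sum_le mem_insert card_union_le)
open Real (sqrt mul_self_sqrt sq_sqrt exp one_le_exp add_one_le_exp exp_sum exp_le_exp exp_one_lt_d9 sqrt_le_sqrt sqrt_le_left sqrt_pos log log_pos log_nonneg log_le_log one_lt_rpow rpow_one rpow_def_of_pos log_le_sub_one_of_pos rpow_add rpow_neg log_two_gt_d9 log_pow exp_pos rpow_pos_of_pos sqrt_eq_rpow tendsto_log_atTop log_rpow exp_log exp_nat_mul log_two_lt_d9 le_log_iff_exp_le exp_add)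
open Nat (div_add_mod mod_lt Coprime cast_sub le_floor floor_le factoredNumbers lt_succ_iff le_floor_iff le_of_dvd mem_primeFactors cast_nonneg prime_of_mem_primeFactors totient_pos)
open Fintype (piFinset_univ sum_prod_type sum_option sum_equiv card_pos_iff prod_option)

lemma mll {a b c : ℝ} (h : b ≤ c) (ha : 0 ≤ a) : a * b ≤ a * c := mul_le_mul_of_nonneg_left h ha
lemma mlr {a b c : ℝ} (h : b ≤ c) (ha : 0 ≤ a) : b * a ≤ c * a := mul_le_mul_of_nonneg_right h ha
lemma lml {a b c : ℝ} (h : c * a ≤ c * b) (hc : 0 < c) : a ≤ b := le_of_mul_le_mul_left h hc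


lemma bil_gen {ι : Type} [Fintype ι] {ζ : ι → Type} [∀ i, Fintype (ζ i)] {J : Type}
    (P : Finset J) (u : ι → ℝ) (hu : ∀ i, 0 ≤ u i) (G : ∀ i, ζ i → ℝ) (K : ∀ i, ζ i → J → ℝ) :
    (∑ p ∈ P, ∏ i, (u i * ∑ z, G i z * K i z p)) ^ 2 ≤ (∏ i, (u i * ∑ z, G i z ^ 2)) * ∑ p ∈ P, ∑ p' ∈ P, ∏ i, (u i * ∑ z, K i z p * K i z p') := by
  have key : ∀ F : ∀ i, ζ i → ℝ, ∏ i, (u i * ∑ z, F i z) = ∑ z : ∀ i, ζ i, (∏ i, u i) * ∏ i, F i (z i) := by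
    intro F
    rw [prod_mul_distrib, prod_univ_sum, mul_sum, piFinset_univ]
  have hU : 0 ≤ ∏ i, u i := prod_nonneg fun i _ => hu i
  set U := ∏ i, u i with hUd
  have e1 : ∑ p ∈ P, ∏ i, (u i * ∑ z, G i z * K i z p) = ∑ z : ∀ i, ζ i, (sqrt U * ∏ i, G i (z i)) * (sqrt U * ∑ p ∈ P, ∏ i, K i (z i) p) := by
    simp_rw [key]
    rw [sum_comm]
    refine sum_congr rfl fun z _ => ?_
    rw [mul_sum, mul_sum]
    refine sum_congr rfl fun p _ => ?_
    rw [prod_mul_distrib]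
    have := mul_self_sqrt hU
    linear_combination (-(∏ i, G i (z i)) * ∏ i, K i (z i) p) * this
  have e2 : ∏ i, (u i * ∑ z, G i z ^ 2) = ∑ z : ∀ i, ζ i, (sqrt U * ∏ i, G i (z i)) ^ 2 := by
    rw [key]
    refine sum_congr rfl fun z _ => ?_
    rw [mul_pow, sq_sqrt hU, prod_pow]
  have e3 : ∑ p ∈ P, ∑ p' ∈ P, ∏ i, (u i * ∑ z, K i z p * K i z p') = ∑ z : ∀ i, ζ i, (sqrt U * ∑ p ∈ P, ∏ i, K i (z i) p) ^ 2 := by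
    simp_rw [key]
    have : ∀ p ∈ P, ∑ p' ∈ P, ∑ z : ∀ i, ζ i, U * ∏ i, (K i (z i) p * K i (z i) p') = ∑ z : ∀ i, ζ i, ∑ p' ∈ P, U * ∏ i, (K i (z i) p * K i (z i) p') :=
      fun p _ => sum_comm
    rw [sum_congr rfl this, sum_comm]
    refine sum_congr rfl fun z _ => ?_
    rw [mul_pow, sq_sqrt hU, pow_two (∑ p ∈ P, _), sum_mul_sum, mul_sum]
    refine sum_congr rfl fun p _ => ?_
    rw [mul_sum]
    refine sum_congr rfl fun p' _ => ?_
    rw [prod_mul_distrib]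
  rw [e1, e2, e3]
  exact Finset.sum_mul_sq_le_sq_mul_sq _ _ _

noncomputable def ker {α : Type} [Fintype α] (b : Prop) (x r : α) : ℝ :=
  if b then (if x = r then (Fintype.card α : ℝ) else 0) - 1 else 1

lemma ker_comm {α : Type} [Fintype α] (b : Prop) (x r : α) : ker b x r = ker b r x := by
  unfold ker; simp only [eq_comm]

lemma ker_sum {α : Type} [Fintype α] [Nonempty α] (r : α) : ∑ x, ker True x r = 0 := by
  simp [ker]

lemma ker_mul_sum {α : Type} [Fintype α] [Nonempty α] (F : α → ℝ) (r : α) :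
    (Fintype.card α : ℝ)⁻¹ * ∑ x, F x * ker True x r = F r - (Fintype.card α : ℝ)⁻¹ * ∑ x, F x := by
  have h : (Fintype.card α : ℝ) ≠ 0 := by simp
  simp [ker, mul_sub, sum_sub_distrib]
  field_simp

lemma ker_conv {α : Type} [Fintype α] [Nonempty α] (b : Prop) (r r' : α) :
    (Fintype.card α : ℝ)⁻¹ * ∑ x, ker b x r * ker b x r' = ker b r r' := by
  by_cases hb : b
  · have : b = True := by simpa using hb
    subst this
    rw [ker_mul_sum, ker_sum]
    rw [ker_comm]; simp [ker_comm]
  · have h : (Fintype.card α : ℝ) ≠ 0 := by simp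
    simp [ker, hb]

noncomputable def aa {ι : Type} [Fintype ι] {α : ι → Type} [∀ i, Fintype (α i)] {J : Type}
    (A : Finset J) (rA : J → ∀ i, α i) (m : Finset ι) : ℝ :=
  ∑ r ∈ A, ∑ r' ∈ A, ∏ i, ker (i ∈ m) (rA r i) (rA r' i)

lemma bil_two {ι : Type} [Fintype ι] {α β : ι → Type} [∀ i, Fintype (α i)] [∀ i, Fintype (β i)]
    [∀ i, Nonempty (α i)] [∀ i, Nonempty (β i)] {J J' : Type}
    (A : Finset J) (rA : J → ∀ i, α i) (B : Finset J') (rB : J' → ∀ i, β i)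
    (G : ∀ i, α i → β i → ℝ) (m₁ m₂ : Finset ι)
    (hG : ∀ i r q, (Fintype.card (α i) : ℝ)⁻¹ * (Fintype.card (β i) : ℝ)⁻¹ * ∑ x, ∑ y, G i x y * (ker (i ∈ m₁) x r * ker (i ∈ m₂) y q) = G i r q) :
    (∑ r ∈ A, ∑ q ∈ B, ∏ i, G i (rA r i) (rB q i)) ^ 2 ≤ (∏ i, ((Fintype.card (α i) : ℝ)⁻¹ * (Fintype.card (β i) : ℝ)⁻¹ * ∑ x, ∑ y, G i x y ^ 2)) * (aa A rA m₁ * aa B rB m₂) := by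
  have := bil_gen (ζ := fun i => α i × β i) (A ×ˢ B)
    (fun i => (Fintype.card (α i) : ℝ)⁻¹ * (Fintype.card (β i) : ℝ)⁻¹) (fun i => by positivity)
    (fun i z => G i z.1 z.2)
    (fun i z p => ker (i ∈ m₁) z.1 (rA p.1 i) * ker (i ∈ m₂) z.2 (rB p.2 i))
  simp only [sum_prod_type, hG, sum_product] at this
  refine this.trans (le_of_eq ?_)
  congr 1
  unfold aa
  rw [sum_mul_sum]
  refine sum_congr rfl fun r _ => sum_congr rfl fun q _ => ?_
  rw [sum_mul_sum]
  refine sum_congr rfl fun r' _ => sum_congr rfl fun q' _ => ?_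
  rw [← prod_mul_distrib]
  refine prod_congr rfl fun i _ => ?_
  rw [← ker_conv (i ∈ m₁) (rA r i), ← ker_conv (i ∈ m₂) (rB q i)]
  have : ∀ x : α i, ∀ y : β i, ker (i ∈ m₁) x (rA r i) * ker (i ∈ m₂) y (rB q i) * (ker (i ∈ m₁) x (rA r' i) * ker (i ∈ m₂) y (rB q' i)) = (ker (i ∈ m₁) x (rA r i) * ker (i ∈ m₁) x (rA r' i)) *
        (ker (i ∈ m₂) y (rB q i) * ker (i ∈ m₂) y (rB q' i)) := by intros; ring
  simp only [this, ← sum_mul_sum]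
  ring

lemma aa_nonneg {ι : Type} [Fintype ι] {α : ι → Type} [∀ i, Fintype (α i)] [∀ i, Nonempty (α i)]
    {J : Type} (A : Finset J) (rA : J → ∀ i, α i) (m : Finset ι) : 0 ≤ aa A rA m := by
  have := bil_gen (ζ := fun i => α i) A
    (fun i => (Fintype.card (α i) : ℝ)⁻¹) (fun i => by positivity)
    (fun i z => 1) (fun i z p => ker (i ∈ m) z (rA p i))
  simp only [ker_conv] at this
  have h1 : ∏ i : ι, ((Fintype.card (α i) : ℝ)⁻¹ * ∑ z : α i, (1:ℝ) ^ 2) = 1 := by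
    refine Finset.prod_eq_one fun i _ => ?_
    have h : (Fintype.card (α i) : ℝ) ≠ 0 := by simp
    simp [h]
  rw [h1, one_mul] at this
  exact (sq_nonneg _).trans this

lemma tau_sum {ι T : Type} [Fintype ι] [Fintype T] (sel : T → Prop) (x : ι → T → ℝ) (hx : ∀ i t, 0 ≤ x i t) (s : ℝ) (hs : 0 < s) (hs1 : s ≤ 1) (h1 : ∀ i, ∑ t ∈ univ.filter sel, x i t ≤ s / 2)
    (h2 : ∑ i, ∑ t ∈ univ.filter (fun t => ¬ sel t), x i t ≤ s)
    (a : Finset ι → ℝ) (ha : ∀ m, 0 ≤ a m) :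
    ∑ τ ∈ (univ : Finset (ι → Option T)).filter (fun τ => τ ≠ fun _ => none),
      (∏ i, (τ i).elim 1 (x i)) * a (univ.filter fun i => (τ i).elim False sel) ≤
    3 * s * ∑ m, (1/2 : ℝ) ^ m.card * a m := by
  have hx' : ∀ i (o : Option T), 0 ≤ o.elim 1 (fun t => x i t / s) := by
    intro i o; cases o with
    | none => simp
    | some t => simp; exact div_nonneg (hx i t) hs.le
  have step1 : ∀ τ : ι → Option T, τ ≠ (fun _ => none) →
      ∏ i, (τ i).elim 1 (x i) ≤ s * ∏ i, (τ i).elim 1 (fun t => x i t / s) := by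
    intro τ hτ
    have e : ∀ i, (τ i).elim 1 (x i) =
        (τ i).elim 1 (fun _ => s) * (τ i).elim 1 (fun t => x i t / s) := by
      intro i; cases τ i with
      | none => simp
      | some t => simp; field_simp
    rw [prod_congr rfl (fun i _ => e i), prod_mul_distrib]
    refine mlr ?_ (prod_nonneg fun i _ => hx' i _)
    obtain ⟨i, hi⟩ : ∃ i, τ i ≠ none := by
      by_contra h; push Not at h; exact hτ (funext h)
    rw [← mul_prod_erase _ _ (mem_univ i)]
    have hsi : (τ i).elim 1 (fun _ => s) = s := by
      cases h : τ i with
      | none => exact absurd h hi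
      | some t => simp
    rw [hsi]
    refine mul_le_of_le_one_right hs.le ?_
    refine prod_le_one (fun j _ => ?_) (fun j _ => ?_)
    · cases τ j <;> simp [hs.le]
    · cases τ j <;> simp [hs1]
  have step2 : ∑ τ : ι → Option T, (∏ i, (τ i).elim 1 (fun t => x i t / s)) *
      a (univ.filter fun i => (τ i).elim False sel) ≤
      3 * ∑ m, (1/2 : ℝ) ^ m.card * a m := by
    rw [← Finset.sum_fiberwise (s := univ)
      (g := fun τ : ι → Option T => univ.filter fun i => (τ i).elim False sel), mul_sum]
    refine sum_le_sum fun m _ => ?_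
    have : ∀ τ ∈ univ.filter (fun τ : ι → Option T =>
        (univ.filter fun i => (τ i).elim False sel) = m),
        (∏ i, (τ i).elim 1 (fun t => x i t / s)) *
          a (univ.filter fun i => (τ i).elim False sel) =
        (∏ i, (τ i).elim 1 (fun t => x i t / s)) * a m := by
      intro τ hτ; rw [(mem_filter.1 hτ).2]
    rw [sum_congr rfl this, ← sum_mul, ← mul_assoc]
    refine mlr ?_ (ha m)
    have hpi : univ.filter (fun τ : ι → Option T =>
        (univ.filter fun i => (τ i).elim False sel) = m) =
        Fintype.piFinset (fun i => univ.filter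
          (fun o : Option T => o.elim False sel ↔ i ∈ m)) := by
      ext τ; simp [ext_iff, Fintype.mem_piFinset]
    rw [hpi, ← prod_univ_sum (fun i => univ.filter
          (fun o : Option T => o.elim False sel ↔ i ∈ m))
          (fun i o => o.elim 1 (fun t => x i t / s))]
    set y : ι → ℝ := fun i => ∑ t ∈ univ.filter (fun t => ¬ sel t), x i t / s with hy
    have hy0 : ∀ i, 0 ≤ y i := fun i => sum_nonneg fun t _ => div_nonneg (hx i t) hs.le
    have hfac : ∀ i, ∑ o ∈ univ.filter (fun o : Option T => o.elim False sel ↔ i ∈ m),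
        o.elim 1 (fun t => x i t / s) ≤ (if i ∈ m then 1/2 else 1) * exp (y i) := by
      intro i
      rw [sum_filter, sum_option]
      by_cases him : i ∈ m
      · simp only [him, Option.elim, iff_true, if_false, if_true, zero_add]
        rw [← sum_filter, ← sum_div]
        have := h1 i
        have e1 : 1 ≤ exp (y i) := one_le_exp (hy0 i)
        have : (∑ t ∈ univ.filter sel, x i t) / s ≤ 1/2 := by
          rw [div_le_iff₀ hs]; linarith
        linarith
      · simp only [him, Option.elim, iff_false, if_false, if_true, not_false_eq_true]
        rw [← sum_filter, one_mul]
        have := add_one_le_exp (y i)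
        simp only [hy] at this ⊢
        linarith
    refine (prod_le_prod (fun i _ => sum_nonneg fun o _ => hx' i o)
      (fun i _ => hfac i)).trans ?_
    rw [prod_mul_distrib, ← exp_sum]
    have hexp : exp (∑ i, y i) ≤ 3 := by
      have : ∑ i, y i ≤ 1 := by
        simp only [hy, ← sum_div]
        rw [div_le_one hs]; exact h2
      calc _ ≤ exp 1 := exp_le_exp.2 this
        _ ≤ 3 := by have := exp_one_lt_d9; linarith
    rw [Finset.prod_ite_mem, Finset.univ_inter, prod_const]
    nlinarith [pow_nonneg (show (0:ℝ) ≤ 1/2 by norm_num) m.card]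
  calc _ ≤ ∑ τ ∈ (univ : Finset (ι → Option T)).filter (fun τ => τ ≠ fun _ => none),
      (s * ∏ i, (τ i).elim 1 (fun t => x i t / s)) *
        a (univ.filter fun i => (τ i).elim False sel) := by
        refine sum_le_sum fun τ hτ => ?_
        exact mlr (step1 τ (mem_filter.1 hτ).2) (ha _)
    _ ≤ ∑ τ : ι → Option T, (s * ∏ i, (τ i).elim 1 (fun t => x i t / s)) *
        a (univ.filter fun i => (τ i).elim False sel) := by
        refine sum_le_sum_of_subset_of_nonneg (filter_subset _ _) fun τ _ _ => ?_
        exact mul_nonneg (mul_nonneg hs.le (prod_nonneg fun i _ => hx' i _)) (ha _)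
    _ ≤ _ := by
        simp_rw [mul_assoc s]
        rw [← mul_sum]
        nlinarith

lemma zero_out_sum {ι Γ : Type} [Fintype ι] [Fintype Γ] (γ0 : Γ) (S : Finset ι) (h : (ι → Γ) → ℝ) (hh : ∀ π, 0 ≤ h π) :
    ∑ π : ι → Γ, h (fun i => if i ∈ S then γ0 else π i) ≤ (Fintype.card Γ : ℝ) ^ S.card * ∑ π, h π := by
  rw [← Finset.sum_fiberwise (s := univ)
    (g := fun π : ι → Γ => (fun i => if i ∈ S then γ0 else π i)), mul_sum]
  refine sum_le_sum fun π' _ => ?_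
  have : ∀ π ∈ univ.filter (fun π : ι → Γ => (fun i => if i ∈ S then γ0 else π i) = π'),
      h (fun i => if i ∈ S then γ0 else π i) = h π' := by
    intro π hπ; rw [(mem_filter.1 hπ).2]
  rw [sum_congr rfl this, sum_const, nsmul_eq_mul]
  refine mlr ?_ (hh _)
  have hc : (univ.filter (fun π : ι → Γ =>
      (fun i => if i ∈ S then γ0 else π i) = π')).card ≤
      (univ : Finset (S → Γ)).card := by
    refine card_le_card_of_injOn (fun π i => π i) (fun _ _ => mem_coe.2 (mem_univ _)) ?_
    intro π hπ ρ hρ he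
    have hπ := (mem_filter.1 hπ).2
    have hρ := (mem_filter.1 hρ).2
    funext i
    by_cases hi : i ∈ S
    · exact congrFun he ⟨i, hi⟩
    · have h1 := congrFun hπ i
      have h2 := congrFun hρ i
      simp [hi] at h1 h2
      rw [h1, h2]
  rw [card_univ, Fintype.card_fun, Fintype.card_coe] at hc
  exact_mod_cast hc

lemma rep1 {α : Type} [Fintype α] [Nonempty α] (a : Prop) (F : α → ℝ) (r : α) (h1 : a → ∑ x, F x = 0) (h2 : ¬ a → ∀ x x', F x = F x') :
    (Fintype.card α : ℝ)⁻¹ * ∑ x, F x * ker a x r = F r := by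
  by_cases ha : a
  · have : a = True := by simpa using ha
    subst this
    rw [ker_mul_sum, h1 trivial]; simp
  · have h : (Fintype.card α : ℝ) ≠ 0 := by simp
    simp only [ker, ha, if_false, mul_one]
    rw [sum_congr rfl (fun x _ => h2 ha x r)]
    simp [h]

lemma rep2 {α β : Type} [Fintype α] [Nonempty α] [Fintype β] [Nonempty β] (a b : Prop) (G : α → β → ℝ) (r : α) (q : β) (h1 : a → ∀ y, ∑ x, G x y = 0) (h2 : ¬ a → ∀ x x' y, G x y = G x' y) (h3 : b → ∀ x, ∑ y, G x y = 0) (h4 : ¬ b → ∀ x y y', G x y = G x y') :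
    (Fintype.card α : ℝ)⁻¹ * (Fintype.card β : ℝ)⁻¹ * ∑ x, ∑ y, G x y * (ker a x r * ker b y q) = G r q := by
  have e : ∀ x, (Fintype.card β : ℝ)⁻¹ * ∑ y, G x y * (ker a x r * ker b y q) = G x q * ker a x r := by
    intro x
    have := rep1 b (G x) q (fun hb => h3 hb x) (fun hb => h4 hb x)
    rw [← this, mul_assoc, sum_mul]
    congr 1
    exact sum_congr rfl fun y _ => by ring
  rw [mul_assoc, mul_sum, sum_congr rfl (fun x _ => e x)]
  exact rep1 a (fun x => G x q) r (fun ha => h1 ha q) (fun ha x x' => h2 ha x x' q)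

noncomputable def gp {α β : Type} [Fintype α] [Fintype β] (H : α → β → ℝ) (d : ℝ) (o : Option (Bool × Bool)) (x : α) (y : β) : ℝ :=
  match o with
  | none => d
  | some (false, false) =>
      (Fintype.card α : ℝ)⁻¹ * (Fintype.card β : ℝ)⁻¹ * (∑ x, ∑ y, H x y) - d
  | some (true, false) => (Fintype.card β : ℝ)⁻¹ * (∑ y, H x y) - (Fintype.card α : ℝ)⁻¹ * (Fintype.card β : ℝ)⁻¹ * (∑ x, ∑ y, H x y)
  | some (false, true) => (Fintype.card α : ℝ)⁻¹ * (∑ x, H x y) - (Fintype.card α : ℝ)⁻¹ * (Fintype.card β : ℝ)⁻¹ * (∑ x, ∑ y, H x y)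
  | some (true, true) => H x y - (Fintype.card β : ℝ)⁻¹ * (∑ y, H x y) - (Fintype.card α : ℝ)⁻¹ * (∑ x, H x y) + (Fintype.card α : ℝ)⁻¹ * (Fintype.card β : ℝ)⁻¹ * (∑ x, ∑ y, H x y)

lemma gp_sum {α β : Type} [Fintype α] [Fintype β] (H : α → β → ℝ) (d : ℝ) (x : α) (y : β) :
    ∑ o, gp H d o x y = H x y := by
  rw [sum_option, sum_prod_type]
  simp [gp]; ring

lemma gp_rep {α β : Type} [Fintype α] [Nonempty α] [Fintype β] [Nonempty β] (H : α → β → ℝ) (d : ℝ) (o : Option (Bool × Bool)) (r : α) (q : β) :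
    (Fintype.card α : ℝ)⁻¹ * (Fintype.card β : ℝ)⁻¹ * ∑ x, ∑ y, gp H d o x y *
        (ker (o.elim False (fun t => t.1 = true)) x r *
          ker (o.elim False (fun t => t.2 = true)) y q) = gp H d o r q := by
  have hα : (Fintype.card α : ℝ) ≠ 0 := by simp
  have hβ : (Fintype.card β : ℝ) ≠ 0 := by simp
  have hsc := sum_comm (s := (univ : Finset α)) (t := (univ : Finset β)) (f := H)
  apply rep2
  · intro h y
    rcases o with _ | ⟨a, b⟩
    · simp at h
    · simp at h; subst h
      cases b
      · simp [gp, sum_sub_distrib, ← mul_sum]; field_simp; simp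
      · simp [gp, sum_sub_distrib, sum_add_distrib, ← mul_sum]; field_simp; simp
  · intro h x x' y
    rcases o with _ | ⟨a, b⟩
    · simp [gp]
    · simp at h; subst h
      cases b <;> simp [gp]
  · intro h x
    rcases o with _ | ⟨a, b⟩
    · simp at h
    · simp at h; subst h
      cases a
      · simp [gp, sum_sub_distrib, ← mul_sum]; rw [← hsc]; field_simp; simp
      · simp [gp, sum_sub_distrib, sum_add_distrib, ← mul_sum]
        rw [← hsc]; field_simp; simp
  · intro h x y y'
    rcases o with _ | ⟨a, b⟩
    · simp [gp]
    · simp at h; subst h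
      cases a <;> simp [gp]

noncomputable def av2 {α β : Type} [Fintype α] [Fintype β] (H : α → β → ℝ) : ℝ := (Fintype.card α : ℝ)⁻¹ * (Fintype.card β : ℝ)⁻¹ * ∑ x, ∑ y, H x y

lemma av2_le {α β : Type} [Fintype α] [Nonempty α] [Fintype β] [Nonempty β] (H : α → β → ℝ) (c : ℝ) (h : ∀ x y, H x y ≤ c) : av2 H ≤ c := by
  have hα : (Fintype.card α : ℝ) ≠ 0 := by simp
  have hβ : (Fintype.card β : ℝ) ≠ 0 := by simp
  have : ∑ x, ∑ y, H x y ≤ ∑ x : α, ∑ y : β, c :=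
    sum_le_sum fun x _ => sum_le_sum fun y _ => h x y
  unfold av2
  calc _ ≤ (Fintype.card α : ℝ)⁻¹ * (Fintype.card β : ℝ)⁻¹ * ∑ x : α, ∑ y : β, c := by
        gcongr
    _ = c := by simp; field_simp

lemma av2_mono {α β : Type} [Fintype α] [Fintype β] (H H' : α → β → ℝ) (h : ∀ x y, H x y ≤ H' x y) : av2 H ≤ av2 H' := by
  unfold av2
  gcongr
  exact h _ _

noncomputable def ep (e0 e1 e2 : ℝ) (t : Bool × Bool) : ℝ :=
  match t with
  | (false, false) => e0
  | (true, false) => e1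
  | (false, true) => e1
  | (true, true) => e2

lemma gp_sq {α β : Type} [Fintype α] [Nonempty α] [Fintype β] [Nonempty β] (H : α → β → ℝ) (d e0 e1 e2 : ℝ) (h0 : |av2 H - d| ≤ e0) (h1 : ∀ x, |(Fintype.card β : ℝ)⁻¹ * (∑ y, H x y)| ≤ e1 / 2) (h1' : ∀ y, |(Fintype.card α : ℝ)⁻¹ * (∑ x, H x y)| ≤ e1 / 2)
    (h2 : 2 * av2 (fun x y => H x y ^ 2) + 8 * e1 ^ 2 ≤ e2 ^ 2)
    (o : Option (Bool × Bool)) :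
    av2 (fun x y => gp H d o x y ^ 2) ≤ (o.elim d (ep e0 e1 e2)) ^ 2 := by
  have hα : (Fintype.card α : ℝ) ≠ 0 := by simp
  have hβ : (Fintype.card β : ℝ) ≠ 0 := by simp
  have hm : |av2 H| ≤ e1 / 2 := by
    have : ∀ s : ℝ, (∀ x, s * ((Fintype.card β : ℝ)⁻¹ * (∑ y, H x y)) ≤ e1/2) → s * av2 H ≤ e1/2 := by
      intro s hs
      have := av2_le (α := α) (β := β) (fun x _ => s * ((Fintype.card β : ℝ)⁻¹ * (∑ y, H x y))) _ (fun x _ => hs x)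
      refine le_trans (le_of_eq ?_) this
      unfold av2
      simp [← mul_sum]; field_simp
    rw [abs_le]
    have a1 := this 1 (fun x => by rw [one_mul]; exact (abs_le.1 (h1 x)).2)
    have a2 := this (-1) (fun x => by linarith [(abs_le.1 (h1 x)).1])
    constructor <;> linarith
  have hee : 0 ≤ e1 := by linarith [abs_nonneg (av2 H)]
  have hm' := abs_le.1 hm
  rcases o with _ | ⟨a, b⟩
  · exact av2_le _ _ (fun x y => by simp [gp])
  · cases a <;> cases b
    · refine av2_le _ _ (fun x y => ?_)
      simp only [gp, Option.elim, ep]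
      exact sq_le_sq' (by have := (abs_le.1 h0).1; unfold av2 at this; linarith) (by have := (abs_le.1 h0).2; unfold av2 at this; linarith)
    · refine av2_le _ _ (fun x y => ?_)
      simp only [gp, Option.elim, ep]
      change (_ - av2 H) ^ 2 ≤ _
      have := abs_le.1 (h1' y)
      exact sq_le_sq' (by linarith) (by linarith)
    · refine av2_le _ _ (fun x y => ?_)
      simp only [gp, Option.elim, ep]
      change (_ - av2 H) ^ 2 ≤ _
      have := abs_le.1 (h1 x)
      exact sq_le_sq' (by linarith) (by linarith)
    · simp only [Option.elim, ep]
      refine le_trans ?_ h2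
      have : ∀ x y, gp H d (some (true, true)) x y ^ 2 ≤ 2 * H x y ^ 2 + 8 * e1 ^ 2 := by
        intro x y
        simp only [gp]
        change (_ - _ - _ + av2 H) ^ 2 ≤ _
        have t1 := abs_le.1 (h1' y)
        have t2 := abs_le.1 (h1 x)
        set u := (Fintype.card β : ℝ)⁻¹ * (∑ y, H x y)
        set v := (Fintype.card α : ℝ)⁻¹ * (∑ x, H x y)
        have hw : (-u - v + av2 H) ^ 2 ≤ (2 * e1) ^ 2 := sq_le_sq' (by linarith) (by linarith)
        nlinarith [sq_nonneg (H x y - (-u - v + av2 H))]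
      refine (av2_mono _ _ this).trans (le_of_eq ?_)
      unfold av2
      simp [sum_add_distrib, ← mul_sum]; field_simp

theorem thmG {ι : Type} [Fintype ι] {α β : ι → Type} [∀ i, Fintype (α i)] [∀ i, Fintype (β i)]
    [∀ i, Nonempty (α i)] [∀ i, Nonempty (β i)] {J J' : Type}
    (A : Finset J) (rA : J → ∀ i, α i) (B : Finset J') (rB : J' → ∀ i, β i)
    (hA : A.Nonempty) (hB : B.Nonempty)
    {Γ : Type} [Fintype Γ] (γ0 : Γ) (H : ∀ i, Γ → α i → β i → ℝ) (d : ι → Γ → ℝ)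
    (e0 e1 e2 : ι → ℝ) (he0 : ∀ i, 0 ≤ e0 i) (he1 : ∀ i, 0 ≤ e1 i) (he2 : ∀ i, 0 ≤ e2 i)
    (w : (ι → Γ) → ℝ) (hd0 : ∀ i, d i γ0 = 1) (hd : ∀ i γ, 0 ≤ d i γ)
    (hH0 : ∀ i x y, H i γ0 x y = 1)
    (h0 : ∀ i γ, γ ≠ γ0 → |av2 (H i γ) - d i γ| ≤ e0 i)
    (h1 : ∀ i γ, γ ≠ γ0 → ∀ x, |(Fintype.card (β i) : ℝ)⁻¹ * (∑ y, H i γ x y)| ≤ e1 i / 2)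
    (h1' : ∀ i γ, γ ≠ γ0 → ∀ y, |(Fintype.card (α i) : ℝ)⁻¹ * (∑ x, H i γ x y)| ≤ e1 i / 2)
    (h2 : ∀ i γ, γ ≠ γ0 → 2 * av2 (fun x y => H i γ x y ^ 2) + 8 * e1 i ^ 2 ≤ e2 i ^ 2)
    (hw : ∀ π, 0 ≤ w π)
    (hmono : ∀ π (S : Finset ι), w π ≤ w (fun i => if i ∈ S then γ0 else π i))
    (MM : Finset (Finset ι))
    (hsupp : ∀ π, w π ≠ 0 → ∀ m, (∀ i ∈ m, π i ≠ γ0) → m ∈ MM)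
    (CA CB : ℝ)
    (hCA : ∑ m ∈ MM, (1/2 : ℝ) ^ m.card * aa A rA m ≤ CA * (A.card : ℝ) ^ 2)
    (hCB : ∑ m ∈ MM, (1/2 : ℝ) ^ m.card * aa B rB m ≤ CB * (B.card : ℝ) ^ 2)
    (q : ι → ℝ) (hq : ∀ i, 0 < q i) (s : ℝ) (hs : 0 < s) (hs1 : s ≤ 1)
    (hs2 : ∀ i, (Fintype.card Γ : ℝ) * (e1 i * q i + e2 i) ≤ s / 2)
    (hs3 : ∑ i, (Fintype.card Γ : ℝ) * (e0 i + e1 i / q i) ≤ s) :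
    |∑ π, w π * ∑ r ∈ A, ∑ b ∈ B, ∏ i, H i (π i) (rA r i) (rB b i)
      - A.card * B.card * ∑ π, w π * ∏ i, d i (π i)| ≤
      (3/2) * s * (CA + CB) * (A.card * B.card * ∑ π, w π * ∏ i, d i (π i)) := by
  set G : ℝ := (Fintype.card Γ : ℝ) with hGdef
  have hG0 : 0 ≤ G := by positivity
  have hep : ∀ i t, 0 ≤ ep (e0 i) (e1 i) (e2 i) t := by
    rintro i ⟨a, b⟩; cases a <;> cases b <;> simp [ep, he0, he1, he2]
  set X : (ι → Γ) → (ι → Option (Bool × Bool)) → ℝ := fun π τ =>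
    ∑ r ∈ A, ∑ b ∈ B, ∏ i, gp (H i (π i)) (d i (π i)) (τ i) (rA r i) (rB b i) with hX
  set m1 : (ι → Option (Bool × Bool)) → Finset ι := fun τ =>
    univ.filter fun i => (τ i).elim False (fun t => t.1 = true) with hm1
  set m2 : (ι → Option (Bool × Bool)) → Finset ι := fun τ =>
    univ.filter fun i => (τ i).elim False (fun t => t.2 = true) with hm2
  set a' : Finset ι → ℝ := fun m => if m ∈ MM then aa A rA m else 0 with ha'
  set b' : Finset ι → ℝ := fun m => if m ∈ MM then aa B rB m else 0 with hb'
  have ha'0 : ∀ m, 0 ≤ a' m := by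
    intro m; simp only [ha']; split_ifs; exacts [aa_nonneg _ _ _, le_rfl]
  have hb'0 : ∀ m, 0 ≤ b' m := by
    intro m; simp only [hb']; split_ifs; exacts [aa_nonneg _ _ _, le_rfl]
  set Main := ∑ π, w π * ∏ i, d i (π i) with hMain
  set hh : (ι → Γ) → ℝ := fun π => w π * ∏ i, d i (π i) with hhh
  have hh0 : ∀ π, 0 ≤ hh π := fun π => mul_nonneg (hw π) (prod_nonneg fun i _ => hd i _)
  have hMain0 : 0 ≤ Main := sum_nonneg fun π _ => hh0 π

  have exp1 : ∀ π, ∑ r ∈ A, ∑ b ∈ B, ∏ i, H i (π i) (rA r i) (rB b i) = ∑ τ, X π τ := by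
    intro π
    simp only [hX]
    rw [sum_comm (s := univ)]
    refine sum_congr rfl fun r _ => ?_
    rw [sum_comm (s := univ)]
    refine sum_congr rfl fun b _ => ?_
    have : ∀ i, H i (π i) (rA r i) (rB b i) =
      ∑ o, gp (H i (π i)) (d i (π i)) o (rA r i) (rB b i) := fun i => (gp_sum _ _ _ _).symm
    rw [prod_congr rfl (fun i _ => this i), prod_univ_sum, piFinset_univ]
  have hXnone : ∀ π, X π (fun _ => none) = A.card * B.card * ∏ i, d i (π i) := by
    intro π
    simp only [hX, gp, sum_const, nsmul_eq_mul]
    ring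
  set NN := (univ : Finset (ι → Option (Bool × Bool))).filter (fun τ => τ ≠ fun _ => none) with hNN
  have exp2 : ∑ π, w π * ∑ r ∈ A, ∑ b ∈ B, ∏ i, H i (π i) (rA r i) (rB b i)
      - A.card * B.card * Main = ∑ τ ∈ NN, ∑ π, w π * X π τ := by
    rw [sum_comm]
    simp_rw [exp1]
    rw [hMain, mul_sum, ← sum_sub_distrib]
    refine sum_congr rfl fun π _ => ?_
    rw [← mul_sum, hNN, Finset.filter_ne', ← Finset.add_sum_erase _ _ (mem_univ (fun _ => none)), hXnone]
    ring

  have hXb : ∀ π τ, X π τ ^ 2 ≤ (∏ i, (if π i = γ0 then (τ i).elim 1 (fun _ => 0) else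
      (τ i).elim (d i (π i)) (ep (e0 i) (e1 i) (e2 i))) ^ 2) *
      (aa A rA (m1 τ) * aa B rB (m2 τ)) := by
    intro π τ
    refine (bil_two A rA B rB (fun i => gp (H i (π i)) (d i (π i)) (τ i)) (m1 τ) (m2 τ) ?_).trans ?_
    · intro i r b
      have := gp_rep (H i (π i)) (d i (π i)) (τ i) r b
      simpa [hm1, hm2] using this
    · refine mlr ?_ (mul_nonneg (aa_nonneg _ _ _) (aa_nonneg _ _ _))
      refine prod_le_prod (fun i _ => by positivity) fun i _ => ?_
      change av2 (fun x y => gp (H i (π i)) (d i (π i)) (τ i) x y ^ 2) ≤ _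
      split_ifs with hπ
      · refine av2_le _ _ fun x y => ?_
        rw [hπ]
        have hα : (Fintype.card (α i) : ℝ) ≠ 0 := by simp
        have hβ : (Fintype.card (β i) : ℝ) ≠ 0 := by simp
        rcases τ i with _ | ⟨a, b⟩
        · simp [gp, hd0]
        · cases a <;> cases b <;> simp [gp, hH0, hd0, hα, hβ] <;> field_simp <;> norm_num
      · exact gp_sq _ _ _ _ _ (h0 i _ hπ) (h1 i _ hπ) (h1' i _ hπ) (h2 i _ hπ) _
  set S : (ι → Option (Bool × Bool)) → Finset ι := fun τ => univ.filter fun i => τ i ≠ none with hS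
  have hwX : ∀ τ π, w π * |X π τ| ≤ (∏ i, (τ i).elim 1 (ep (e0 i) (e1 i) (e2 i))) *
      hh (fun i => if i ∈ S τ then γ0 else π i) * sqrt (a' (m1 τ) * b' (m2 τ)) := by
    intro τ π
    have hP0 : 0 ≤ ∏ i, (τ i).elim 1 (ep (e0 i) (e1 i) (e2 i)) := by
      refine prod_nonneg fun i _ => ?_
      cases τ i; simp; exact hep _ _
    have hR0 : 0 ≤ (∏ i, (τ i).elim 1 (ep (e0 i) (e1 i) (e2 i))) *
      hh (fun i => if i ∈ S τ then γ0 else π i) * sqrt (a' (m1 τ) * b' (m2 τ)) :=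
      mul_nonneg (mul_nonneg hP0 (hh0 _)) (Real.sqrt_nonneg _)
    by_cases hwz : w π = 0
    · rw [hwz, zero_mul]; exact hR0
    by_cases hbad : ∃ i, τ i ≠ none ∧ π i = γ0
    · obtain ⟨i, hi1, hi2⟩ := hbad
      have hz : X π τ ^ 2 ≤ 0 := by
        refine (hXb π τ).trans (le_of_eq ?_)
        rw [prod_eq_zero (mem_univ i), zero_mul]
        rw [if_pos hi2]
        cases h : τ i with
        | none => exact absurd h hi1
        | some t => simp
      have hz' : X π τ = 0 := by
        have := sq_nonneg (X π τ)
        exact pow_eq_zero_iff (two_ne_zero) |>.1 (le_antisymm hz this)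
      rw [hz', abs_zero, mul_zero]; exact hR0
    · push Not at hbad
      have hM1 : m1 τ ∈ MM := by
        refine hsupp π hwz _ fun i hi => hbad i ?_
        simp only [hm1, mem_filter] at hi
        intro h; simp [h] at hi
      have hM2 : m2 τ ∈ MM := by
        refine hsupp π hwz _ fun i hi => hbad i ?_
        simp only [hm2, mem_filter] at hi
        intro h; simp [h] at hi
      have ea : a' (m1 τ) = aa A rA (m1 τ) := by simp [ha', hM1]
      have eb : b' (m2 τ) = aa B rB (m2 τ) := by simp [hb', hM2]
      have hprod : (∏ i, (if π i = γ0 then (τ i).elim 1 (fun _ => 0) else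
        (τ i).elim (d i (π i)) (ep (e0 i) (e1 i) (e2 i)))) =
        (∏ i, (τ i).elim 1 (ep (e0 i) (e1 i) (e2 i))) *
          ∏ i, d i (if i ∈ S τ then γ0 else π i) := by
        rw [← prod_mul_distrib]
        refine prod_congr rfl fun i _ => ?_
        cases h : τ i with
        | none => by_cases h' : π i = γ0 <;> simp [hS, h, h', hd0]
        | some t =>
          have := hbad i (by rw [h]; simp)
          simp [hS, h, this, hd0]
      have hXle : |X π τ| ≤ (∏ i, (τ i).elim 1 (ep (e0 i) (e1 i) (e2 i))) *
          (∏ i, d i (if i ∈ S τ then γ0 else π i)) * sqrt (a' (m1 τ) * b' (m2 τ)) := by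
        have := hXb π τ
        rw [prod_pow, hprod, ← ea, ← eb] at this
        rw [← Real.sqrt_sq_eq_abs]
        refine (sqrt_le_sqrt this).trans (le_of_eq ?_)
        rw [Real.sqrt_mul (sq_nonneg _), Real.sqrt_sq]
        exact mul_nonneg hP0 (prod_nonneg fun i _ => hd _ _)
      refine (mll hXle (hw π)).trans ?_
      simp only [hhh]
      have hmm := hmono π (S τ)
      have hD0 : 0 ≤ ∏ i, d i (if i ∈ S τ then γ0 else π i) := prod_nonneg fun i _ => hd _ _
      have hQ0 : 0 ≤ (∏ i, (τ i).elim 1 (ep (e0 i) (e1 i) (e2 i))) *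
          (∏ i, d i (if i ∈ S τ then γ0 else π i)) * sqrt (a' (m1 τ) * b' (m2 τ)) :=
        mul_nonneg (mul_nonneg hP0 hD0) (Real.sqrt_nonneg _)
      have := mlr hmm hQ0
      linarith
  have hτ : ∀ τ, |∑ π, w π * X π τ| ≤ Main * ((∏ i, (τ i).elim 1 (fun t => G * ep (e0 i) (e1 i) (e2 i) t)) * sqrt (a' (m1 τ) * b' (m2 τ))) := by
    intro τ
    have hP0 : 0 ≤ ∏ i, (τ i).elim 1 (ep (e0 i) (e1 i) (e2 i)) := by
      refine prod_nonneg fun i _ => ?_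
      cases τ i; simp; exact hep _ _
    have z := zero_out_sum γ0 (S τ) hh hh0
    calc |∑ π, w π * X π τ| ≤ ∑ π, |w π * X π τ| := abs_sum_le_sum_abs _ _
      _ ≤ ∑ π : ι → Γ, (∏ i, (τ i).elim 1 (ep (e0 i) (e1 i) (e2 i))) *
      hh (fun i => if i ∈ S τ then γ0 else π i) * sqrt (a' (m1 τ) * b' (m2 τ)) := by
          refine sum_le_sum fun π _ => ?_
          rw [abs_mul, abs_of_nonneg (hw π)]; exact hwX τ π
      _ = (∏ i, (τ i).elim 1 (ep (e0 i) (e1 i) (e2 i))) *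
          (∑ π : ι → Γ, hh (fun i => if i ∈ S τ then γ0 else π i)) * sqrt (a' (m1 τ) * b' (m2 τ)) := by
          rw [mul_sum, sum_mul]
      _ ≤ (∏ i, (τ i).elim 1 (ep (e0 i) (e1 i) (e2 i))) * (G ^ (S τ).card * Main) * sqrt (a' (m1 τ) * b' (m2 τ)) := by
          gcongr
      _ = _ := by
          have : ∏ i, (τ i).elim 1 (fun t => G * ep (e0 i) (e1 i) (e2 i) t) = G ^ (S τ).card * ∏ i, (τ i).elim 1 (ep (e0 i) (e1 i) (e2 i)) := by
            rw [← prod_const, hS, prod_filter, ← prod_mul_distrib]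
            refine prod_congr rfl fun i _ => ?_
            cases τ i <;> simp
          rw [this]; ring

  set ac : ℝ := (A.card : ℝ)
  set bc : ℝ := (B.card : ℝ)
  have hac : 0 < ac := by simp only [ac]; exact_mod_cast hA.card_pos
  have hbc : 0 < bc := by simp only [bc]; exact_mod_cast hB.card_pos
  set qq : ι → Bool × Bool → ℝ := fun i t => match t with
    | (true, false) => q i | (false, true) => (q i)⁻¹ | _ => 1 with hqq
  have hqq0 : ∀ i t, 0 < qq i t := by
    rintro i ⟨a, b⟩; cases a <;> cases b <;> simp [hqq, hq]
  have amgm : ∀ a b Q : ℝ, 0 ≤ a → 0 ≤ b → 0 < Q → sqrt (a * b) ≤ (1/2) * (bc / ac * Q * a + ac / bc * Q⁻¹ * b) := by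
    clear_value ac bc; clear * - hac hbc
    intro a b Q ha hb hQ
    have h1 : a * b = (bc / ac * Q * a) * (ac / bc * Q⁻¹ * b) := by field_simp
    have p1 : 0 ≤ bc / ac * Q * a := by positivity
    have p2 : 0 ≤ ac / bc * Q⁻¹ * b := by positivity
    rw [h1]
    set u := bc / ac * Q * a
    set v := ac / bc * Q⁻¹ * b
    rw [sqrt_le_left (by positivity)]
    nlinarith [sq_nonneg (u - v)]
  have hfin : ∑ τ ∈ NN, (∏ i, (τ i).elim 1 (fun t => G * ep (e0 i) (e1 i) (e2 i) t)) * sqrt (a' (m1 τ) * b' (m2 τ)) ≤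
      (1/2) * (bc / ac * ∑ τ ∈ NN, (∏ i, (τ i).elim 1 (fun t => G * ep (e0 i) (e1 i) (e2 i) t * qq i t)) * a' (m1 τ)
       + ac / bc * ∑ τ ∈ NN, (∏ i, (τ i).elim 1 (fun t => G * ep (e0 i) (e1 i) (e2 i) t * (qq i t)⁻¹)) * b' (m2 τ)) := by
    rw [mul_sum, mul_sum, ← sum_add_distrib, mul_sum]
    refine sum_le_sum fun τ _ => ?_
    have hQ : 0 < ∏ i, (τ i).elim 1 (qq i) := by
      refine prod_pos fun i _ => ?_
      cases τ i; simp; exact hqq0 _ _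
    have hC : 0 ≤ ∏ i, (τ i).elim 1 (fun t => G * ep (e0 i) (e1 i) (e2 i) t) := by
      refine prod_nonneg fun i _ => ?_
      cases τ i; simp; exact mul_nonneg hG0 (hep _ _)
    have c1 : ∏ i, (τ i).elim 1 (fun t => G * ep (e0 i) (e1 i) (e2 i) t * qq i t) =
      (∏ i, (τ i).elim 1 (fun t => G * ep (e0 i) (e1 i) (e2 i) t)) * ∏ i, (τ i).elim 1 (qq i) := by
      rw [← prod_mul_distrib]
      refine prod_congr rfl fun i _ => ?_
      cases τ i <;> simp
    have c2 : ∏ i, (τ i).elim 1 (fun t => G * ep (e0 i) (e1 i) (e2 i) t * (qq i t)⁻¹) =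
      (∏ i, (τ i).elim 1 (fun t => G * ep (e0 i) (e1 i) (e2 i) t)) * (∏ i, (τ i).elim 1 (qq i))⁻¹ := by
      rw [← prod_inv_distrib, ← prod_mul_distrib]
      refine prod_congr rfl fun i _ => ?_
      cases τ i <;> simp
    rw [c1, c2]
    have := mll (amgm _ _ _ (ha'0 (m1 τ)) (hb'0 (m2 τ)) hQ) hC
    linarith
  have g1 := tau_sum (fun t : Bool × Bool => t.1 = true)
    (fun i t => G * ep (e0 i) (e1 i) (e2 i) t * qq i t)
    (fun i t => mul_nonneg (mul_nonneg hG0 (hep i t)) (hqq0 i t).le) s hs hs1 ?_ ?_ a' ha'0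
  have g2 := tau_sum (fun t : Bool × Bool => t.2 = true)
    (fun i t => G * ep (e0 i) (e1 i) (e2 i) t * (qq i t)⁻¹)
    (fun i t => mul_nonneg (mul_nonneg hG0 (hep i t)) (inv_pos.2 (hqq0 i t)).le) s hs hs1 ?_ ?_ b' hb'0
  · have sa : ∑ m, (1/2 : ℝ) ^ m.card * a' m ≤ CA * ac ^ 2 := by
      refine le_trans (le_of_eq ?_) hCA
      simp only [ha', mul_ite, mul_zero]
      rw [← sum_filter]; simp
    have sb : ∑ m, (1/2 : ℝ) ^ m.card * b' m ≤ CB * bc ^ 2 := by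
      refine le_trans (le_of_eq ?_) hCB
      simp only [hb', mul_ite, mul_zero]
      rw [← sum_filter]; simp
    have tot : ∑ τ ∈ NN, (∏ i, (τ i).elim 1 (fun t => G * ep (e0 i) (e1 i) (e2 i) t)) * sqrt (a' (m1 τ) * b' (m2 τ)) ≤ (3/2) * s * (CA + CB) * (ac * bc) := by
      refine hfin.trans ?_
      have u1 := g1.trans (mll sa (by linarith only [hs]))
      have u2 := g2.trans (mll sb (by linarith only [hs]))
      have v1 := mll u1 (div_pos hbc hac).le
      have v2 := mll u2 (div_pos hac hbc).le
      have w1 : bc / ac * (3 * s * (CA * ac ^ 2)) = 3 * s * CA * (ac * bc) := by field_simp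
      have w2 : ac / bc * (3 * s * (CB * bc ^ 2)) = 3 * s * CB * (ac * bc) := by field_simp
      rw [w1] at v1
      rw [w2] at v2
      refine (mll (add_le_add v1 v2) (by norm_num)).trans (le_of_eq (by ring))
    rw [exp2]
    calc |∑ τ ∈ NN, ∑ π, w π * X π τ| ≤ ∑ τ ∈ NN, |∑ π, w π * X π τ| := abs_sum_le_sum_abs _ _
      _ ≤ ∑ τ ∈ NN, Main * ((∏ i, (τ i).elim 1 (fun t => G * ep (e0 i) (e1 i) (e2 i) t)) *
      sqrt (a' (m1 τ) * b' (m2 τ))) := sum_le_sum fun τ _ => hτ τ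
      _ ≤ _ := by
        rw [← mul_sum]
        refine (mll tot hMain0).trans (le_of_eq (by ring))
  · intro i
    rw [sum_filter, sum_prod_type]
    simp [ep, hqq]
    linarith [hs2 i]
  · refine le_trans (le_of_eq ?_) hs3
    refine sum_congr rfl fun i _ => ?_
    rw [sum_filter, sum_prod_type]
    simp [ep, hqq]
    ring
  · intro i
    rw [sum_filter, sum_prod_type]
    simp [ep, hqq]
    linarith [hs2 i]
  · refine le_trans (le_of_eq ?_) hs3
    refine sum_congr rfl fun i _ => ?_
    rw [sum_filter, sum_prod_type]
    simp [ep, hqq]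
    ring

lemma range_zmod (D : ℕ) [NeZero D] (F : ZMod D → ℝ) (a : ℤ) :
    ∑ j ∈ range D, F ((a + j : ℤ) : ZMod D) = ∑ t, F t := by
  have h1 : ∑ j ∈ range D, F ((a + j : ℤ) : ZMod D) = ∑ t : ZMod D, F ((a : ZMod D) + t) := by
    refine Finset.sum_bij' (fun j _ => (j : ZMod D)) (fun t _ => t.val) ?_ ?_ ?_ ?_ ?_
    · intros; simp
    · intro t _; simp [ZMod.val_lt]
    · intro j hj; simp at hj ⊢; exact Nat.mod_eq_of_lt hj
    · intro t _; simp
    · intro j _; simp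
  rw [h1]
  exact sum_equiv (Equiv.addLeft (a : ZMod D)) _ _ (fun t => rfl)

lemma per_sum (D : ℕ) [NeZero D] (F : ZMod D → ℝ) (B : ℝ) (hB : ∀ t, |F t| ≤ B) (N : ℕ) (a : ℤ) :
    |∑ j ∈ range N, F ((a + j : ℤ) : ZMod D) - N * ((D : ℝ)⁻¹ * ∑ t, F t)| ≤ 2 * D * B := by
  have hD : (0:ℝ) < D := by exact_mod_cast Nat.pos_of_ne_zero (NeZero.ne D)
  set S := ∑ t, F t with hS
  have hmul : ∀ (k r : ℕ), ∑ j ∈ range (D * k + r), F ((a + j : ℤ) : ZMod D) = k * S + ∑ j ∈ range r, F ((a + j : ℤ) : ZMod D) := by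
    intro k r
    induction k with
    | zero => simp
    | succ k ih =>
      have : D * (k + 1) + r = D + (D * k + r) := by ring
      rw [this, Finset.sum_range_add, range_zmod]
      have : ∀ x ∈ range (D * k + r), F ((a + ((D + x : ℕ) : ℤ) : ℤ) : ZMod D) = F ((a + x : ℤ) : ZMod D) := by
        intro x _; congr 1; push_cast; simp
      rw [sum_congr rfl this, ih]
      push_cast; ring
  have hN := hmul (N / D) (N % D)
  rw [div_add_mod] at hN
  rw [hN]
  have hr : N % D < D := mod_lt _ (Nat.pos_of_ne_zero (NeZero.ne D))
  have hNr : (N : ℝ) = D * (N / D : ℕ) + (N % D : ℕ) := by exact_mod_cast (div_add_mod N D).symm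
  have hS' : |S| ≤ D * B := by
    calc |S| ≤ ∑ t : ZMod D, |F t| := abs_sum_le_sum_abs _ _
      _ ≤ ∑ t : ZMod D, B := sum_le_sum fun t _ => hB t
      _ = D * B := by simp [ZMod.card]
  have hB0 : 0 ≤ B := (abs_nonneg _).trans (hB 0)
  have hrest : |∑ j ∈ range (N % D), F ((a + j : ℤ) : ZMod D)| ≤ D * B := by
    calc _ ≤ ∑ j ∈ range (N % D), |F ((a + j : ℤ) : ZMod D)| := abs_sum_le_sum_abs _ _
      _ ≤ ∑ j ∈ range (N % D), B := sum_le_sum fun t _ => hB _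
      _ = (N % D : ℕ) * B := by simp
      _ ≤ D * B := by gcongr
  have e : ((N / D : ℕ) : ℝ) * S + ∑ j ∈ range (N % D), F ((a + j : ℤ) : ZMod D)
      - N * ((D : ℝ)⁻¹ * S) = ∑ j ∈ range (N % D), F ((a + j : ℤ) : ZMod D)
        - ((N % D : ℕ) : ℝ) / D * S := by
    rw [hNr]; field_simp; ring
  rw [e]
  refine (abs_sub _ _).trans ?_
  have : |((N % D : ℕ) : ℝ) / D * S| ≤ D * B := by
    rw [abs_mul, abs_of_nonneg (by positivity)]
    have : ((N % D : ℕ) : ℝ) / D ≤ 1 := by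
      rw [div_le_one hD]; exact_mod_cast hr.le
    calc _ ≤ 1 * |S| := by gcongr
      _ ≤ D * B := by linarith
  linarith

lemma eq_tensor {ι : Type} [Fintype ι] (pr : ι → ℕ) [∀ i, Fact (pr i).Prime]
    (hinj : Function.Injective pr) (d : Finset ι) (F : ∀ i, ZMod (pr i) → ℝ) (b : ι → ℝ)
    (hb : ∀ i t, |F i t| ≤ b i) (a : ℤ) (N : ℕ) :
    |∑ j ∈ range N, ∏ i ∈ d, F i ((a + j : ℤ) : ZMod (pr i)) - N * ∏ i ∈ d, ((pr i : ℝ)⁻¹ * ∑ t, F i t)| ≤ 2 * (∏ i ∈ d, (pr i : ℝ)) * ∏ i ∈ d, b i := by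
  set D : ℕ := ∏ i : d, pr i with hD
  have hpos : ∀ i, 0 < pr i := fun i => (Fact.out : (pr i).Prime).pos
  haveI : NeZero D := ⟨by rw [hD]; exact Finset.prod_ne_zero_iff.2 fun i _ => (hpos i).ne'⟩
  have hco : Pairwise (Function.onFun Coprime (fun i : d => pr i)) := by
    intro i j hij
    refine (Nat.coprime_primes Fact.out Fact.out).2 fun h => hij (Subtype.ext (hinj h))
  set E : ZMod D ≃+* ∀ i : d, ZMod (pr i) := ZMod.prodEquivPi (fun i : d => pr i) hco with hE
  have key := per_sum D (fun t => ∏ i : d, F i (E t i)) (∏ i : d, b i) (fun t => by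
    rw [Finset.abs_prod]
    exact prod_le_prod (fun i _ => abs_nonneg _) fun i _ => hb _ _) N a
  have e1 : ∑ t : ZMod D, ∏ i : d, F i (E t i) = ∏ i : d, ∑ t, F i t := by
    rw [prod_univ_sum, piFinset_univ]
    exact sum_equiv E.toEquiv _ _ (fun t => rfl)
  have hDr : (D : ℝ) = ∏ i ∈ d, (pr i : ℝ) := by
    rw [hD]; push_cast
    exact prod_coe_sort d (fun i => (pr i : ℝ))
  have e2 : (D : ℝ)⁻¹ * ∏ i : d, ∑ t, F i t = ∏ i ∈ d, ((pr i : ℝ)⁻¹ * ∑ t, F i t) := by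
    rw [hDr, prod_mul_distrib, prod_inv_distrib]
    congr 1
    exact prod_coe_sort d (fun i => ∑ t, F i t)
  rw [e1, e2, hDr, prod_coe_sort d (fun i => b i)] at key
  refine le_trans (le_of_eq ?_) key
  congr 2
  refine sum_congr rfl fun j _ => ?_
  rw [← prod_coe_sort d (fun i => F i ((a + j : ℤ) : ZMod (pr i)))]
  refine prod_congr rfl fun i _ => ?_
  congr 1
  simp

noncomputable def finv {p : ℕ} [Fact p.Prime] (Ω : Finset (ZMod p)) : ℝ := (Ω.card : ℝ) / Fintype.card {t : ZMod p // t ∉ Ω}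

noncomputable def hl {p : ℕ} [Fact p.Prime] (Ω : Finset (ZMod p)) (o : Option Bool) (r : {t : ZMod p // t ∉ Ω}) (t : ZMod p) : ℝ :=
  match o with
  | none => 1
  | some false => if t ∈ Ω then -1 else finv Ω
  | some true => if h : t ∉ Ω then ker True ⟨t, h⟩ r else 0

lemma card_al {p : ℕ} [Fact p.Prime] (Ω : Finset (ZMod p)) :
    (Fintype.card {t : ZMod p // t ∉ Ω} : ℝ) + Ω.card = p := by
  have h1 := Fintype.card_subtype_compl (fun t : ZMod p => t ∈ Ω)
  have h2 : Fintype.card {t : ZMod p // t ∈ Ω} = Ω.card := Fintype.card_coe Ω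
  have h3 : Ω.card ≤ p := by
    have := Finset.card_le_univ Ω; rwa [ZMod.card] at this
  rw [h2, ZMod.card] at h1
  rw [h1]; push_cast [cast_sub h3]; ring

lemma sum_split {p : ℕ} [Fact p.Prime] (Ω : Finset (ZMod p)) (F : ZMod p → ℝ) :
    ∑ t, F t = ∑ t ∈ Ω, F t + ∑ t : {t : ZMod p // t ∉ Ω}, F t := by
  rw [← Finset.sum_add_sum_compl Ω F]
  congr 1
  exact Finset.sum_subtype _ (fun t => by simp) F

lemma finv_nonneg {p : ℕ} [Fact p.Prime] (Ω : Finset (ZMod p)) : 0 ≤ finv Ω := by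
  unfold finv; positivity

lemma hl_orth {p : ℕ} [Fact p.Prime] (Ω : Finset (ZMod p)) [Nonempty {t : ZMod p // t ∉ Ω}]
    (o o' : Option Bool) (r r' : {t : ZMod p // t ∉ Ω}) :
    (p : ℝ)⁻¹ * ∑ t, hl Ω o r t * hl Ω o' r' t =
      if o = o' then (match o with
        | none => 1
        | some false => finv Ω
        | some true => (Fintype.card {t : ZMod p // t ∉ Ω} : ℝ) / p * ker True r r') else 0 := by
  have hc : (Fintype.card {t : ZMod p // t ∉ Ω} : ℝ) ≠ 0 := Nat.cast_ne_zero.2 Fintype.card_ne_zero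
  have hp : (p : ℝ) ≠ 0 := by exact_mod_cast (Fact.out : p.Prime).ne_zero
  have hcp := card_al Ω
  have hf : finv Ω * Fintype.card {t : ZMod p // t ∉ Ω} = Ω.card := by
    unfold finv; field_simp
  have hk : ∀ r : {t : ZMod p // t ∉ Ω}, ∑ x, ker True x r = 0 := ker_sum
  have hkc := ker_conv True r r'
  rw [sum_split Ω]
  have t1 : ∀ (o : Option Bool) (r : {t : ZMod p // t ∉ Ω}) (t : ZMod p), t ∈ Ω → hl Ω o r t =
      match o with | none => 1 | some false => -1 | some true => 0 := by
    intro o r t ht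
    rcases o with _ | b
    · rfl
    · cases b <;> simp [hl, ht]
  have t2 : ∀ (o : Option Bool) (r : {t : ZMod p // t ∉ Ω}) (t : {t : ZMod p // t ∉ Ω}),
      hl Ω o r t =
      match o with | none => 1 | some false => finv Ω | some true => ker True t r := by
    intro o r t
    rcases o with _ | b
    · rfl
    · cases b <;> simp [hl, t.2]
  rw [sum_congr rfl (fun t ht => by rw [t1 o r t ht, t1 o' r' t ht]),
    sum_congr rfl (fun (t : {t : ZMod p // t ∉ Ω}) _ => by rw [t2 o r t, t2 o' r' t])]
  set c : ℝ := (Fintype.card {t : ZMod p // t ∉ Ω} : ℝ) with hcd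
  rcases o with _ | b <;> rcases o' with _ | b'
  · simp only [mul_one, if_true, sum_const, nsmul_eq_mul, card_univ]
    rw [← hcd, add_comm, hcp]; exact inv_mul_cancel₀ hp
  · cases b'
    · simp only [one_mul, sum_const, nsmul_eq_mul, card_univ]
      rw [← hcd, if_neg (by simp)]
      have : (Ω.card : ℝ) * -1 + c * finv Ω = 0 := by linarith
      rw [this, mul_zero]
    · simp [hk]
  · cases b
    · simp only [mul_one, sum_const, nsmul_eq_mul, card_univ]
      rw [← hcd, if_neg (by simp)]
      have : (Ω.card : ℝ) * -1 + c * finv Ω = 0 := by linarith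
      rw [this, mul_zero]
    · simp [hk]
  · cases b <;> cases b'
    · have : ∑ t ∈ Ω, (-1:ℝ) * -1 + ∑ t : {t : ZMod p // t ∉ Ω}, finv Ω * finv Ω = Ω.card + c * (finv Ω * finv Ω) := by
        rw [sum_const, sum_const, nsmul_eq_mul, nsmul_eq_mul, card_univ]; ring
      simp only [this]
      simp
      have : (Ω.card : ℝ) + c * (finv Ω * finv Ω) = p * finv Ω := by
        rw [← hcp]; linear_combination (finv Ω - 1) * hf
      rw [this]; field_simp
    · simp [← mul_sum, hk]
    · simp [← sum_mul, hk]
    · simp only [mul_zero, Finset.sum_const_zero, zero_add, if_true]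
      have hkc' : ∑ x, ker True x r * ker True x r' = c * ker True r r' := by
        rw [← hkc]; field_simp
      rw [hkc']; ring

lemma hl_abs {p : ℕ} [Fact p.Prime] (Ω : Finset (ZMod p)) [Nonempty {t : ZMod p // t ∉ Ω}]
    (o : Option Bool) (r : {t : ZMod p // t ∉ Ω}) (t : ZMod p) :
    |hl Ω o r t| ≤ if o = none then 1 else (p : ℝ) := by
  have hcp := card_al Ω
  have hc1 : (1:ℝ) ≤ Fintype.card {t : ZMod p // t ∉ Ω} := by
    exact_mod_cast Fintype.card_pos
  have hp : (1:ℝ) ≤ p := by exact_mod_cast (Fact.out : p.Prime).one_le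
  have hf : finv Ω ≤ p := by
    unfold finv
    rw [div_le_iff₀ (by linarith)]
    nlinarith [show (0:ℝ) ≤ Ω.card by positivity]
  rcases o with _ | b
  · simp [hl]
  · cases b
    · simp only [hl]
      split_ifs with h h'
      · simp at h'
      · rw [abs_neg, abs_one]; exact hp
      · simp at *
      · rw [abs_of_nonneg (finv_nonneg _)]; exact hf
    · simp only [hl, ker]
      have : (Fintype.card {t : ZMod p // t ∉ Ω} : ℝ) ≤ p := by
        linarith [show (0:ℝ) ≤ Ω.card by positivity]
      split_ifs <;> first | (rw [abs_le]; constructor <;> linarith) | (simp at *)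

theorem bessel {ι : Type} [Fintype ι] (pr : ι → ℕ) [∀ i, Fact (pr i).Prime]
    (hinj : Function.Injective pr) (Ω : ∀ i, Finset (ZMod (pr i)))
    [∀ i, Nonempty {t : ZMod (pr i) // t ∉ Ω i}] (A : Finset ℤ)
    (rA : ℤ → ∀ i, {t : ZMod (pr i) // t ∉ Ω i})
    (hrA : ∀ r ∈ A, ∀ i, (rA r i).1 = (r : ZMod (pr i))) (a : ℤ) (N : ℕ)
    (hAI : ∀ r ∈ A, ∃ j < N, r = a + (j : ℤ)) (hA : A.Nonempty)
    (CC : Finset (ι → Option Bool)) (h0 : (fun _ => none) ∈ CC) (Q : ℝ)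
    (hQ : ∀ c ∈ CC, ∏ i, (if c i = none then (1:ℝ) else pr i) ≤ Q) :
    ∑ c ∈ CC, (∏ i, if c i = some false then finv (Ω i) else 1) *
      aa A rA (univ.filter fun i => c i = some true) ≤
      A.card * (N + 2 * (CC.card : ℝ) ^ 2 * Q ^ 4) := by
  set Φ : (ι → Option Bool) → ℤ → ℤ → ℝ := fun c r n =>
    ∏ i, hl (Ω i) (c i) (rA r i) (n : ZMod (pr i)) with hΦ
  set Ψ : ℤ → ℝ := fun n => ∑ x ∈ CC ×ˢ A, Φ x.1 x.2 n with hΨ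
  set co : (ι → Option Bool) → ℝ := fun c => ∏ i, if c i = some false then finv (Ω i) else 1 with hco
  set mm : (ι → Option Bool) → Finset ι := fun c => univ.filter fun i => c i = some true with hmm
  have hco0 : ∀ c, 0 ≤ co c := fun c => prod_nonneg fun i _ => by
    split_ifs; exacts [finv_nonneg _, zero_le_one]
  set Y := ∑ c ∈ CC, co c * aa A rA (mm c) with hY
  have ac : (0:ℝ) < A.card := by exact_mod_cast hA.card_pos
  have hYA : (A.card : ℝ) ^ 2 ≤ Y := by
    have := single_le_sum (f := fun c => co c * aa A rA (mm c)) (s := CC)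
      (fun c _ => mul_nonneg (hco0 c) (aa_nonneg _ _ _)) h0
    refine le_trans (le_of_eq ?_) this
    simp [hco, hmm, aa, ker]; ring
  have hsumA : ∑ n ∈ A, Ψ n = Y := by
    simp only [hΨ, sum_product]
    rw [sum_comm, hY]
    refine sum_congr rfl fun c _ => ?_
    unfold aa
    rw [mul_sum]
    refine sum_congr rfl fun n hn => ?_
    rw [mul_sum]
    refine sum_congr rfl fun r hr => ?_
    simp only [hΦ, hco]
    rw [← prod_mul_distrib]
    refine prod_congr rfl fun i _ => ?_
    rw [← hrA n hn i]
    have hmem : (rA n i).1 ∉ Ω i := (rA n i).2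
    rcases h : c i with _ | b
    · simp [hl, hmm, h, ker]
    · cases b
      · simp [hl, hmm, h, ker, hmem]
      · simp [hl, hmm, h, hmem]
  have hCS : Y ^ 2 ≤ A.card * ∑ n ∈ A, Ψ n ^ 2 := by
    rw [← hsumA]; exact sq_sum_le_card_mul_sum_sq
  have hI : ∑ n ∈ A, Ψ n ^ 2 ≤ ∑ j ∈ range N, Ψ (a + j) ^ 2 := by
    rw [← sum_image (s := range N) (g := fun j : ℕ => a + (j : ℤ)) (f := fun n => Ψ n ^ 2)
      (fun x _ y _ h => by simpa using h)]
    refine sum_le_sum_of_subset_of_nonneg (fun r hr => ?_) (fun _ _ _ => sq_nonneg _)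
    obtain ⟨j, hj, rfl⟩ := hAI r hr
    exact mem_image.2 ⟨j, mem_range.2 hj, rfl⟩
  have hQ0 : 0 ≤ Q := le_trans (prod_nonneg fun i _ => by split_ifs <;> positivity) (hQ _ h0)
  have hexp : ∑ j ∈ range N, Ψ (a + j) ^ 2 = ∑ x ∈ CC ×ˢ A, ∑ x' ∈ CC ×ˢ A,
      ∑ j ∈ range N, Φ x.1 x.2 (a + j) * Φ x'.1 x'.2 (a + j) := by
    simp only [hΨ, pow_two, sum_mul_sum]
    rw [sum_comm]
    refine sum_congr rfl fun x _ => ?_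
    rw [sum_comm]
  have hone : ∀ i, (1:ℝ) ≤ pr i := fun i => by exact_mod_cast (Fact.out : (pr i).Prime).one_le
  have hT : ∀ x ∈ CC ×ˢ A, ∀ x' ∈ CC ×ˢ A,
      ∑ j ∈ range N, Φ x.1 x.2 (a + j) * Φ x'.1 x'.2 (a + j) ≤
      (if x.1 = x'.1 then N * (co x.1 * ((∏ i ∈ mm x.1, (Fintype.card {t : ZMod (pr i) // t ∉ Ω i} : ℝ) / pr i)
        * ∏ i, ker (i ∈ mm x.1) (rA x.2 i) (rA x'.2 i))) else 0) + 2 * Q ^ 4 := by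
    intro x hx x' hx'
    obtain ⟨c, r⟩ := x
    obtain ⟨c', r'⟩ := x'
    have hc := hQ c (mem_product.1 hx).1
    have hc' := hQ c' (mem_product.1 hx').1
    simp only at hc hc' ⊢
    set d : Finset ι := univ.filter fun i => ¬ (c i = none ∧ c' i = none) with hd
    have key := eq_tensor pr hinj d (fun i t => hl (Ω i) (c i) (rA r i) t * hl (Ω i) (c' i) (rA r' i) t)
      (fun i => (if c i = none then (1:ℝ) else pr i) * (if c' i = none then (1:ℝ) else pr i))
      (fun i t => by
        rw [abs_mul]
        exact mul_le_mul (hl_abs _ _ _ _) (hl_abs _ _ _ _) (abs_nonneg _) (by split_ifs <;> positivity)) a N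
    have p1 : ∀ n : ℤ, ∏ i ∈ d, (hl (Ω i) (c i) (rA r i) (n : ZMod (pr i)) * hl (Ω i) (c' i) (rA r' i) (n : ZMod (pr i)))
        = Φ c r n * Φ c' r' n := by
      intro n
      simp only [hΦ]
      rw [← prod_mul_distrib]
      refine prod_subset (subset_univ _) fun i _ hi => ?_
      simp only [hd, mem_filter, mem_univ, true_and, not_not] at hi
      simp [hi.1, hi.2, hl]
    simp only [p1] at key
    have p2 : ∏ i ∈ d, ((pr i : ℝ)⁻¹ * ∑ t, hl (Ω i) (c i) (rA r i) t * hl (Ω i) (c' i) (rA r' i) t) =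
        if c = c' then (co c * ((∏ i ∈ mm c, (Fintype.card {t : ZMod (pr i) // t ∉ Ω i} : ℝ) / pr i)
        * ∏ i, ker (i ∈ mm c) (rA r i) (rA r' i))) else 0 := by
      simp only [hl_orth]
      split_ifs with hcc
      · subst hcc
        rw [prod_subset (subset_univ d) (fun i _ hi => by
          simp only [hd, mem_filter, mem_univ, true_and, not_not] at hi
          simp [hi.1])]
        simp only [hco, hmm]
        rw [prod_filter, ← prod_mul_distrib, ← prod_mul_distrib]
        refine prod_congr rfl fun i _ => ?_
        rcases h : c i with _ | b
        · simp [h, ker]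
        · cases b <;> simp [h, ker]
      · obtain ⟨i, hi⟩ : ∃ i, c i ≠ c' i := by
          by_contra h; push Not at h; exact hcc (funext h)
        refine prod_eq_zero (i := i) ?_ ?_
        · simp only [hd, mem_filter, mem_univ, true_and]
          rintro ⟨h1, h2⟩; exact hi (h1.trans h2.symm)
        · simp [hi]
    rw [p2] at key
    have p3 : ∏ i ∈ d, ((if c i = none then (1:ℝ) else pr i) * (if c' i = none then (1:ℝ) else pr i)) ≤ Q ^ 2 := by
      rw [prod_subset (subset_univ d) (fun i _ hi => by
          simp only [hd, mem_filter, mem_univ, true_and, not_not] at hi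
          simp [hi.1, hi.2]), prod_mul_distrib, pow_two]
      exact mul_le_mul hc hc' (prod_nonneg fun i _ => by split_ifs <;> positivity) hQ0
    have p4 : ∏ i ∈ d, (pr i : ℝ) ≤ ∏ i ∈ d, ((if c i = none then (1:ℝ) else pr i) * (if c' i = none then (1:ℝ) else pr i)) := by
      refine prod_le_prod (fun i _ => by positivity) fun i hi => ?_
      simp only [hd, mem_filter, mem_univ, true_and] at hi
      have := hone i
      split_ifs with h1 h2 h3
      · exact absurd ⟨h1, h2⟩ hi
      · simp
      · simp
      · nlinarith
    have p5 : 0 ≤ ∏ i ∈ d, (pr i : ℝ) := prod_nonneg fun i _ => by positivity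
    have p6 : 2 * (∏ i ∈ d, (pr i : ℝ)) * (∏ i ∈ d, ((if c i = none then (1:ℝ) else pr i) * (if c' i = none then (1:ℝ) else pr i))) ≤ 2 * Q ^ 4 := by
      have := mul_le_mul (p4.trans p3) p3 (p5.trans p4) (by positivity)
      nlinarith
    have := (abs_le.1 (key.trans p6)).2
    push_cast at this ⊢
    split_ifs at this ⊢ with hcc <;> linarith
  have hsum : ∑ x ∈ CC ×ˢ A, ∑ x' ∈ CC ×ˢ A,
      ∑ j ∈ range N, Φ x.1 x.2 (a + j) * Φ x'.1 x'.2 (a + j) ≤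
      N * Y + 2 * Q ^ 4 * ((CC.card : ℝ) * A.card) ^ 2 := by
    refine (sum_le_sum fun x hx => sum_le_sum fun x' hx' => hT x hx x' hx').trans ?_
    simp only [sum_add_distrib, sum_const, nsmul_eq_mul, card_product]
    have : ∑ x ∈ CC ×ˢ A, ∑ x' ∈ CC ×ˢ A, (if x.1 = x'.1 then (N:ℝ) * (co x.1 * ((∏ i ∈ mm x.1, (Fintype.card {t : ZMod (pr i) // t ∉ Ω i} : ℝ) / pr i)
        * ∏ i, ker (i ∈ mm x.1) (rA x.2 i) (rA x'.2 i))) else 0) ≤ N * Y := by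
      rw [sum_product, hY, mul_sum]
      refine sum_le_sum fun c hc => ?_
      simp only [sum_product]
      have e1 : ∀ r ∈ A, ∑ c' ∈ CC, ∑ r' ∈ A, (if c = c' then (N:ℝ) * (co c * ((∏ i ∈ mm c, (Fintype.card {t : ZMod (pr i) // t ∉ Ω i} : ℝ) / pr i)
        * ∏ i, ker (i ∈ mm c) (rA r i) (rA r' i))) else 0) = ∑ r' ∈ A, (N:ℝ) * (co c * ((∏ i ∈ mm c, (Fintype.card {t : ZMod (pr i) // t ∉ Ω i} : ℝ) / pr i)
        * ∏ i, ker (i ∈ mm c) (rA r i) (rA r' i))) := by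
        intro r _
        rw [sum_comm]
        refine sum_congr rfl fun r' _ => ?_
        rw [Finset.sum_ite_eq]; simp [hc]
      rw [sum_congr rfl e1]
      simp only [← mul_sum]
      change (N:ℝ) * (co c * (_ * aa A rA (mm c))) ≤ _
      have h1 : ∏ i ∈ mm c, (Fintype.card {t : ZMod (pr i) // t ∉ Ω i} : ℝ) / pr i ≤ 1 := by
        refine prod_le_one (fun i _ => by positivity) fun i _ => ?_
        rw [div_le_one (by linarith [hone i])]
        linarith [card_al (Ω i), show (0:ℝ) ≤ (Ω i).card by positivity]
      have h2 := aa_nonneg A rA (mm c)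
      have h3 := hco0 c
      gcongr
      exact mul_le_of_le_one_left h2 h1
    push_cast
    nlinarith [this]
  have hfin : Y ^ 2 ≤ A.card * (N + 2 * (CC.card : ℝ) ^ 2 * Q ^ 4) * Y := by
    have h1 : ∑ n ∈ A, Ψ n ^ 2 ≤ N * Y + 2 * Q ^ 4 * ((CC.card : ℝ) * A.card) ^ 2 := by
      rw [hexp] at hI; exact hI.trans hsum
    have h2 : 2 * Q ^ 4 * ((CC.card : ℝ) * A.card) ^ 2 ≤ 2 * Q ^ 4 * (CC.card : ℝ) ^ 2 * Y := by
      rw [mul_pow, ← mul_assoc]; gcongr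
    calc Y ^ 2 ≤ A.card * ∑ n ∈ A, Ψ n ^ 2 := hCS
      _ ≤ A.card * (N * Y + 2 * Q ^ 4 * (CC.card : ℝ) ^ 2 * Y) := by gcongr; linarith
      _ = _ := by ring
  have hYpos : 0 < Y := by
    have : (0:ℝ) < (A.card : ℝ) ^ 2 := by positivity
    linarith
  rw [pow_two] at hfin
  exact le_of_mul_le_mul_right hfin hYpos

lemma prod_mono_one {ι : Type*} {s t : Finset ι} (h : s ⊆ t) (f : ι → ℝ) (hf : ∀ i, 1 ≤ f i) :
    ∏ i ∈ s, f i ≤ ∏ i ∈ t, f i := by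
  rw [← prod_sdiff h]
  have h1 : 1 ≤ ∏ i ∈ t \ s, f i := by
    have := prod_le_prod (s := t \ s) (f := fun _ => (1:ℝ)) (g := f) (fun _ _ => zero_le_one) (fun i _ => hf i)
    simpa using this
  have h2 : 0 ≤ ∏ i ∈ s, f i := prod_nonneg fun i _ => by linarith [hf i]
  nlinarith

lemma prod_anti_one {ι : Type*} {s t : Finset ι} (h : s ⊆ t) (f : ι → ℝ) (hf0 : ∀ i, 0 ≤ f i) (hf : ∀ i, f i ≤ 1) :
    ∏ i ∈ t, f i ≤ ∏ i ∈ s, f i := by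
  rw [← prod_sdiff h]
  have h1 : ∏ i ∈ t \ s, f i ≤ 1 := prod_le_one (fun i _ => hf0 i) (fun i _ => hf i)
  have h2 : 0 ≤ ∏ i ∈ s, f i := prod_nonneg fun i _ => hf0 i
  nlinarith

noncomputable def setsLe {ι : Type} [Fintype ι] (pr : ι → ℕ) (t : ℝ) : Finset (Finset ι) :=
  univ.filter fun s => ∏ i ∈ s, (pr i : ℝ) ≤ t

lemma prod_pr_inj {ι : Type} [Fintype ι] (pr : ι → ℕ) [∀ i, Fact (pr i).Prime]
    (hinj : Function.Injective pr) {s t : Finset ι} (h : ∏ i ∈ s, pr i = ∏ i ∈ t, pr i) : s = t := by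
  have key : ∀ (s : Finset ι) (i : ι), i ∈ s ↔ pr i ∣ ∏ j ∈ s, pr j := by
    intro s i
    refine ⟨fun h => Finset.dvd_prod_of_mem _ h, fun h => ?_⟩
    obtain ⟨j, hj, hd⟩ := (Fact.out : (pr i).Prime).prime.exists_mem_finset_dvd h
    have := (Nat.prime_dvd_prime_iff_eq Fact.out Fact.out).1 hd
    rwa [hinj this]
  ext i
  rw [key s, key t, h]

lemma subset_weight {ι : Type} [Fintype ι] (pr : ι → ℕ) [∀ i, Fact (pr i).Prime]
    (f : ι → ℝ) (hf0 : ∀ i, 0 ≤ f i) (hf1 : ∀ i, f i ≤ 1) (R : ℝ) (m : Finset ι) :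
    ∑ s ∈ setsLe pr R, ∏ i ∈ s, f i ≤ 2 ^ m.card * ∑ s ∈ (setsLe pr R).filter (Disjoint m), ∏ i ∈ s, f i := by
  have hone : ∀ i, (1:ℝ) ≤ pr i := fun i => by exact_mod_cast (Fact.out : (pr i).Prime).one_le
  have h1 : ∑ s ∈ setsLe pr R, ∏ i ∈ s, f i ≤ ∑ s ∈ setsLe pr R, ∏ i ∈ s \ m, f i := by
    refine sum_le_sum fun s _ => ?_
    exact prod_anti_one Finset.sdiff_subset f hf0 hf1
  refine h1.trans ?_
  have h2 : (2:ℝ) ^ m.card * ∑ s ∈ (setsLe pr R).filter (Disjoint m), ∏ i ∈ s, f i = ∑ x ∈ m.powerset ×ˢ (setsLe pr R).filter (Disjoint m), ∏ i ∈ x.2, f i := by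
    rw [sum_product]; dsimp only; rw [sum_const, nsmul_eq_mul, Finset.card_powerset]; push_cast; rfl
  rw [h2, ← sum_image (s := setsLe pr R) (g := fun s => (s ∩ m, s \ m)) (f := fun x => ∏ i ∈ x.2, f i)]
  · refine sum_le_sum_of_subset_of_nonneg ?_ (fun x _ _ => prod_nonneg fun i _ => hf0 i)
    intro x hx
    obtain ⟨s, hs, rfl⟩ := mem_image.1 hx
    simp only [mem_product, mem_powerset, mem_filter, setsLe, mem_univ, true_and] at hs ⊢
    refine ⟨inter_subset_right, le_trans ?_ hs, Finset.disjoint_sdiff⟩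
    exact prod_mono_one Finset.sdiff_subset _ hone
  · intro s _ t _ h
    simp only [Prod.mk.injEq] at h
    rw [← Finset.sdiff_union_inter s m, ← Finset.sdiff_union_inter t m, h.1, h.2]

set_option maxHeartbeats 1000000 in
theorem bessel2 {ι : Type} [Fintype ι] (pr : ι → ℕ) [∀ i, Fact (pr i).Prime]
    (hinj : Function.Injective pr) (Ω : ∀ i, Finset (ZMod (pr i)))
    [∀ i, Nonempty {t : ZMod (pr i) // t ∉ Ω i}] (A : Finset ℤ)
    (rA : ℤ → ∀ i, {t : ZMod (pr i) // t ∉ Ω i})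
    (hrA : ∀ r ∈ A, ∀ i, (rA r i).1 = (r : ZMod (pr i))) (a : ℤ) (N : ℕ)
    (hAI : ∀ r ∈ A, ∃ j < N, r = a + (j : ℤ)) (hA : A.Nonempty) (hf1 : ∀ i, finv (Ω i) ≤ 1)
    (R : ℝ) (hR : 1 ≤ R) :
    (∑ m ∈ setsLe pr (R ^ 2), (1 / 2 : ℝ) ^ m.card * aa A rA m) * (∑ s ∈ setsLe pr R, ∏ i ∈ s, finv (Ω i)) ≤ A.card * (N + 2 * R ^ 18) := by
  set Tr : (ι → Option Bool) → Finset ι := fun c => univ.filter fun i => c i = some true with hTr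
  set Fa : (ι → Option Bool) → Finset ι := fun c => univ.filter fun i => c i = some false with hFa
  set CC : Finset (ι → Option Bool) := univ.filter fun c =>
    Tr c ∈ setsLe pr (R ^ 2) ∧ Fa c ∈ setsLe pr R with hCC
  have hext : ∀ c c', Tr c = Tr c' → Fa c = Fa c' → c = c' := by
    intro c c' h1 h2
    funext i
    have e1 := ext_iff.1 h1 i
    have e2 := ext_iff.1 h2 i
    simp only [hTr, hFa, mem_filter, mem_univ, true_and] at e1 e2
    rcases h : c i with _ | b <;> rcases h' : c' i with _ | b' <;> simp_all
    all_goals (cases b' <;> simp_all)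
  have hprod : ∀ c : ι → Option Bool, ∏ i, (if c i = none then (1:ℝ) else pr i) = (∏ i ∈ Tr c, (pr i:ℝ)) * ∏ i ∈ Fa c, (pr i:ℝ) := by
    intro c
    simp only [hTr, hFa]
    rw [prod_filter, prod_filter, ← prod_mul_distrib]
    refine prod_congr rfl fun i _ => ?_
    rcases h : c i with _ | b
    · simp
    · cases b <;> simp
  have hpos : ∀ s : Finset ι, 0 < ∏ i ∈ s, (pr i : ℝ) := fun s =>
    prod_pos fun i _ => by exact_mod_cast (Fact.out : (pr i).Prime).pos
  have h0 : (fun _ => none) ∈ CC := by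
    have : Tr (fun _ => none) = ∅ := by simp [hTr]
    have h' : Fa (fun _ => none) = ∅ := by simp [hFa]
    simp only [hCC, mem_filter, mem_univ, true_and, setsLe, this, h', Finset.prod_empty]
    exact ⟨one_le_pow₀ hR, hR⟩
  have hQ : ∀ c ∈ CC, ∏ i, (if c i = none then (1:ℝ) else pr i) ≤ R ^ 3 := by
    intro c hc
    simp only [hCC, mem_filter, mem_univ, true_and, setsLe] at hc
    rw [hprod]
    calc _ ≤ R ^ 2 * R := mul_le_mul hc.1 hc.2 (hpos _).le (by positivity)
      _ = _ := by ring
  have hcard : (CC.card : ℝ) ≤ R ^ 3 := by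
    have : CC.card ≤ (Icc 1 ⌊R ^ 2⌋₊ ×ˢ Icc 1 ⌊R⌋₊).card := by
      refine card_le_card_of_injOn (fun c => (∏ i ∈ Tr c, pr i, ∏ i ∈ Fa c, pr i)) ?_ ?_
      · intro c hc
        simp only [hCC, coe_filter, mem_univ, true_and, setsLe, Set.mem_setOf_eq, mem_filter] at hc
        have hp1 := hpos (Tr c)
        have hp2 := hpos (Fa c)
        simp only [Finset.coe_product, Set.mem_prod, Finset.coe_Icc, Set.mem_Icc]
        have c1 := hc.1
        have c2 := hc.2
        refine ⟨⟨?_, le_floor (by push_cast; exact c1)⟩, ⟨?_, le_floor (by push_cast; exact c2)⟩⟩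
        · exact prod_pos fun i _ => (Fact.out : (pr i).Prime).pos
        · exact prod_pos fun i _ => (Fact.out : (pr i).Prime).pos
      · intro c _ c' _ h
        simp only [Prod.mk.injEq] at h
        exact hext c c' (prod_pr_inj pr hinj h.1) (prod_pr_inj pr hinj h.2)
    rw [card_product, Nat.card_Icc, Nat.card_Icc] at this
    simp only [Nat.add_sub_cancel] at this
    calc (CC.card : ℝ) ≤ (⌊R ^ 2⌋₊ * ⌊R⌋₊ : ℕ) := by exact_mod_cast this
      _ = (⌊R ^ 2⌋₊ : ℝ) * ⌊R⌋₊ := by push_cast; rfl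
      _ ≤ R ^ 2 * R := mul_le_mul (floor_le (by positivity)) (floor_le (by positivity)) (by positivity) (by positivity)
      _ = _ := by ring
  have key := bessel pr hinj Ω A rA hrA a N hAI hA CC h0 (R ^ 3) hQ
  have hfin : (A.card : ℝ) * (N + 2 * (CC.card : ℝ) ^ 2 * (R ^ 3) ^ 4) ≤ A.card * (N + 2 * R ^ 18) := by
    have : (CC.card : ℝ) ^ 2 * (R ^ 3) ^ 4 ≤ (R ^ 3) ^ 2 * (R ^ 3) ^ 4 := by gcongr
    have e : (R ^ 3) ^ 2 * (R ^ 3) ^ 4 = R ^ 18 := by ring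
    refine mll ?_ (by positivity)
    linarith
  refine le_trans ?_ (key.trans hfin)
  rw [sum_mul]
  have h3 : ∀ m ∈ setsLe pr (R ^ 2), (1 / 2 : ℝ) ^ m.card * aa A rA m * (∑ s ∈ setsLe pr R, ∏ i ∈ s, finv (Ω i)) ≤ ∑ s ∈ (setsLe pr R).filter (Disjoint m), (∏ i ∈ s, finv (Ω i)) * aa A rA m := by
    intro m _
    have h4 := subset_weight pr (fun i => finv (Ω i)) (fun i => finv_nonneg _) hf1 R m
    rw [← sum_mul]
    have h5 := mll h4 (mul_nonneg (by positivity : (0:ℝ) ≤ (1/2)^m.card) (aa_nonneg A rA m))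
    refine h5.trans (le_of_eq ?_)
    have : (1/2:ℝ)^m.card * 2^m.card = 1 := by rw [← mul_pow]; norm_num
    linear_combination (aa A rA m * ∑ s ∈ (setsLe pr R).filter (Disjoint m), ∏ i ∈ s, finv (Ω i)) * this
  refine (sum_le_sum h3).trans (le_of_eq ?_)
  rw [sum_sigma']
  refine (Finset.sum_bij (fun c _ => (⟨Tr c, Fa c⟩ : Σ _ : Finset ι, Finset ι)) ?_ ?_ ?_ ?_).symm
  · intro c hc
    simp only [hCC, mem_filter, mem_univ, true_and] at hc
    simp only [mem_sigma, mem_filter]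
    refine ⟨hc.1, hc.2, ?_⟩
    rw [disjoint_left]
    intro i h1 h2
    simp only [hTr, hFa, mem_filter, mem_univ, true_and] at h1 h2
    rw [h1] at h2; simp at h2
  · intro c _ c' _ h
    simp only [Sigma.mk.injEq, heq_eq_eq] at h
    exact hext c c' h.1 h.2
  · rintro ⟨m, s⟩ h
    simp only [mem_sigma, mem_filter] at h
    have hd := disjoint_left.1 h.2.2
    set c : ι → Option Bool := fun i => if i ∈ m then some true else if i ∈ s then some false else none with hc
    have e1 : Tr c = m := by
      ext i; simp only [hTr, hc, mem_filter, mem_univ, true_and]; by_cases h1 : i ∈ m <;> by_cases h2 : i ∈ s <;> simp [h1, h2]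
    have e2 : Fa c = s := by
      ext i; simp only [hFa, hc, mem_filter, mem_univ, true_and];
      by_cases h1 : i ∈ m
      · simp [h1, hd h1]
      · by_cases h2 : i ∈ s <;> simp [h1, h2]
    refine ⟨c, ?_, by rw [e1, e2]⟩
    simp only [hCC, mem_filter, mem_univ, true_and, e1, e2]
    exact ⟨h.1, h.2.1⟩
  · intro c _
    simp only [hFa]
    rw [prod_filter]

noncomputable def vv {p : ℕ} [Fact p.Prime] (Ω : Finset (ZMod p)) (t : ZMod p) : ℝ :=
  if t ∈ Ω then -1 else finv Ω

noncomputable def Vo {p : ℕ} [Fact p.Prime] {κ : Type} (Ω : Finset (ZMod p)) (c : κ → ZMod p) (o : Option κ) (x y : ZMod p) : ℝ :=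
  match o with
  | none => 1
  | some j => vv Ω (x + c j * y)

noncomputable def dd {p : ℕ} [Fact p.Prime] {κ : Type} (Ω : Finset (ZMod p)) (c : κ → ZMod p) (γ : Option κ × Option κ) : ℝ :=
  match γ with
  | (none, none) => 1
  | (some j, none) => if c j = 0 then finv Ω else 0
  | (none, some j) => if c j = 0 then finv Ω else 0
  | (some j, some j') => if j = j' then (if c j = 0 then finv Ω ^ 2 else finv Ω) else 0

lemma dd_nonneg {p : ℕ} [Fact p.Prime] {κ : Type} (Ω : Finset (ZMod p)) (c : κ → ZMod p) (γ : Option κ × Option κ) : 0 ≤ dd Ω c γ := by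
  have := finv_nonneg Ω
  rcases γ with ⟨_ | j, _ | j'⟩ <;> simp only [dd] <;> (try split_ifs) <;> positivity

section
variable {p : ℕ} [Fact p.Prime] (Ω : Finset (ZMod p))

lemma vv_sum (hne : Fintype.card {t : ZMod p // t ∉ Ω} ≠ 0) : ∑ t, vv Ω t = 0 := by
  have : Nonempty {t : ZMod p // t ∉ Ω} := card_pos_iff.1 (Nat.pos_of_ne_zero hne)
  have h := hl_orth Ω none (some false) (Classical.arbitrary _) (Classical.arbitrary _)
  have hp : (p : ℝ) ≠ 0 := by exact_mod_cast (Fact.out : p.Prime).ne_zero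
  simp only [hl, one_mul] at h
  rw [if_neg (by simp)] at h
  simpa [vv, hp] using h

lemma vv_sum_sq (hne : Fintype.card {t : ZMod p // t ∉ Ω} ≠ 0) : ∑ t, vv Ω t ^ 2 = p * finv Ω := by
  have : Nonempty {t : ZMod p // t ∉ Ω} := card_pos_iff.1 (Nat.pos_of_ne_zero hne)
  have h := hl_orth Ω (some false) (some false) (Classical.arbitrary _) (Classical.arbitrary _)
  have hp : (p : ℝ) ≠ 0 := by exact_mod_cast (Fact.out : p.Prime).ne_zero
  simp only [hl, if_true] at h
  rw [← h]; field_simp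
  exact sum_congr rfl fun t _ => by simp only [vv, pow_two]

variable (hΩ : Ω.card ≤ 2) (hp : 128 ≤ p)
include hΩ hp

lemma loc_card (Ω' : Finset (ZMod p)) (h' : Ω' ⊆ Ω) :
    (p : ℝ) - 2 ≤ Fintype.card {t : ZMod p // t ∉ Ω'} := by
  have h1 := card_al Ω'
  have h2 : (Ω'.card : ℝ) ≤ 2 := by exact_mod_cast (card_le_card h').trans hΩ
  linarith

lemma finv_le : finv Ω ≤ 3 / p := by
  have hp' : (128:ℝ) ≤ p := by exact_mod_cast hp
  have h1 := loc_card Ω hΩ hp Ω subset_rfl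
  have h2 : (Ω.card : ℝ) ≤ 2 := by exact_mod_cast hΩ
  unfold finv
  rw [div_le_div_iff₀ (by linarith) (by linarith)]
  nlinarith

lemma finv_le_one : finv Ω ≤ 1 := by
  have hp' : (128:ℝ) ≤ p := by exact_mod_cast hp
  refine (finv_le Ω hΩ hp).trans ?_
  rw [div_le_one (by linarith)]; linarith

lemma vv_abs_le (t : ZMod p) : |vv Ω t| ≤ finv Ω + if t ∈ Ω then 1 else 0 := by
  have := finv_nonneg Ω
  unfold vv
  split_ifs
  · simpa using this
  · rw [abs_of_nonneg this, add_zero]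

lemma vv_abs_one (t : ZMod p) : |vv Ω t| ≤ 1 := by
  have := finv_nonneg Ω
  unfold vv
  split_ifs
  · simp
  · rw [abs_of_nonneg this]; exact finv_le_one Ω hΩ hp

omit hp in
lemma ind_sum_inj {T : Type} [Fintype T] (g : T → ZMod p) (hg : Function.Injective g) :
    ∑ t, (if g t ∈ Ω then (1:ℝ) else 0) ≤ 2 := by
  rw [Finset.sum_boole]
  have : (univ.filter fun t => g t ∈ Ω).card ≤ Ω.card :=
    card_le_card_of_injOn g (fun t ht => by simpa using ht) hg.injOn
  exact_mod_cast this.trans hΩ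

lemma vv_sum_inj {T : Type} [Fintype T] (g : T → ZMod p) (hg : Function.Injective g) :
    ∑ t, |vv Ω (g t)| ≤ Fintype.card T * finv Ω + 2 := by
  refine (sum_le_sum fun t _ => vv_abs_le Ω hΩ hp (g t)).trans ?_
  rw [sum_add_distrib, sum_const, nsmul_eq_mul, card_univ]
  linarith [ind_sum_inj Ω hΩ g hg]

lemma vv_av_inj {T : Type} [Fintype T] (hT : (p:ℝ) - 2 ≤ Fintype.card T) (g : T → ZMod p) (hg : Function.Injective g) :
    (Fintype.card T : ℝ)⁻¹ * ∑ t, |vv Ω (g t)| ≤ 8 / p := by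
  have hp' : (128:ℝ) ≤ p := by exact_mod_cast hp
  have h1 := vv_sum_inj Ω hΩ hp g hg
  have h2 := finv_le Ω hΩ hp
  have h3 : (0:ℝ) < Fintype.card T := by linarith
  rw [inv_mul_le_iff₀ h3]
  refine h1.trans ?_
  have : (Fintype.card T : ℝ) * finv Ω ≤ Fintype.card T * (3 / p) := by gcongr
  have h5 : (2:ℝ) ≤ Fintype.card T * (5 / p) := by
    rw [← mul_div_assoc, le_div_iff₀ (by linarith)]; nlinarith
  calc _ ≤ (Fintype.card T : ℝ) * (3 / p) + Fintype.card T * (5 / p) := by linarith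
    _ = _ := by ring

variable {κ : Type} (c : κ → ZMod p) (hc : Function.Injective c) (Ω' : Finset (ZMod p)) (h' : Ω' ⊆ Ω)
  (hsp : ∀ j, c j = 0 → Ω' = Ω)
include h'

lemma Vo_abs (o : Option κ) (x y : ZMod p) : |Vo Ω c o x y| ≤ 1 := by
  rcases o with _ | j
  · simp [Vo]
  · exact vv_abs_one Ω hΩ hp _

lemma loc_avX (j : κ) (y : ZMod p) :
    (Fintype.card {t : ZMod p // t ∉ Ω'} : ℝ)⁻¹ * ∑ x : {t : ZMod p // t ∉ Ω'}, |Vo Ω c (some j) x y| ≤ 8 / p := by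
  have := vv_av_inj Ω hΩ hp (loc_card Ω hΩ hp Ω' h') (fun x : {t : ZMod p // t ∉ Ω'} => x.1 + c j * y)
    (fun a b h => by simpa [Subtype.ext_iff] using h)
  exact this

include hsp

lemma loc_avY (j : κ) (x : {t : ZMod p // t ∉ Ω'}) :
    (Fintype.card {t : ZMod p // t ∉ ({0} : Finset (ZMod p))} : ℝ)⁻¹ * ∑ y : {t : ZMod p // t ∉ ({0} : Finset (ZMod p))}, |Vo Ω c (some j) x y| ≤ 8 / p := by
  have hp' : (128:ℝ) ≤ p := by exact_mod_cast hp
  have hb := card_al ({0} : Finset (ZMod p))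
  rw [card_singleton] at hb; push_cast at hb
  set b : ℝ := (Fintype.card {t : ZMod p // t ∉ ({0} : Finset (ZMod p))} : ℝ) with hbd
  by_cases h : c j = 0
  · have hx : (x:ZMod p) ∉ Ω := by rw [← hsp j h]; exact x.2
    have : ∀ y : ZMod p, |Vo Ω c (some j) x y| = finv Ω := by
      intro y; simp [Vo, h, vv, hx, abs_of_nonneg (finv_nonneg Ω)]
    simp only [this, sum_const, nsmul_eq_mul, card_univ]
    rw [← hbd, ← mul_assoc, inv_mul_cancel₀ (by linarith), one_mul]
    refine (finv_le Ω hΩ hp).trans ?_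
    gcongr; norm_num
  · exact vv_av_inj Ω hΩ hp (by rw [← hbd]; linarith) (fun y : {t : ZMod p // t ∉ ({0} : Finset (ZMod p))} => x.1 + c j * y)
      (fun a b hh => by simpa [Subtype.ext_iff, h] using hh)

lemma loc_h1 (γ : Option κ × Option κ) (hγ : γ ≠ (none, none)) (x : {t : ZMod p // t ∉ Ω'}) :
    |(Fintype.card {t : ZMod p // t ∉ ({0} : Finset (ZMod p))} : ℝ)⁻¹ * ∑ y : {t : ZMod p // t ∉ ({0} : Finset (ZMod p))}, Vo Ω c γ.1 x y * Vo Ω c γ.2 x y| ≤ 8 / p := by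
  rw [abs_mul, abs_of_nonneg (by positivity)]
  obtain ⟨j, hj⟩ : ∃ j, ∀ x y, |Vo Ω c γ.1 x y * Vo Ω c γ.2 x y| ≤ |Vo Ω c (some j) x y| := by
    rcases γ with ⟨_ | j, o⟩
    · rcases o with _ | j
      · exact absurd rfl hγ
      · exact ⟨j, fun x y => by simp [Vo]⟩
    · refine ⟨j, fun x y => ?_⟩
      rw [abs_mul]
      exact mul_le_of_le_one_right (abs_nonneg _) (Vo_abs Ω hΩ hp c Ω' h' _ _ _)
  refine le_trans ?_ (loc_avY Ω hΩ hp c Ω' h' hsp j x)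
  gcongr
  refine (abs_sum_le_sum_abs _ _).trans (sum_le_sum fun y _ => hj _ _)

omit hsp in
lemma loc_h1' (γ : Option κ × Option κ) (hγ : γ ≠ (none, none)) (y : {t : ZMod p // t ∉ ({0} : Finset (ZMod p))}) :
    (Fintype.card {t : ZMod p // t ∉ Ω'} : ℝ)⁻¹ * ∑ x : {t : ZMod p // t ∉ Ω'}, |Vo Ω c γ.1 x y * Vo Ω c γ.2 x y| ≤ 8 / p := by
  obtain ⟨j, hj⟩ : ∃ j, ∀ x y, |Vo Ω c γ.1 x y * Vo Ω c γ.2 x y| ≤ |Vo Ω c (some j) x y| := by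
    rcases γ with ⟨_ | j, o⟩
    · rcases o with _ | j
      · exact absurd rfl hγ
      · exact ⟨j, fun x y => by simp [Vo]⟩
    · refine ⟨j, fun x y => ?_⟩
      rw [abs_mul]
      exact mul_le_of_le_one_right (abs_nonneg _) (Vo_abs Ω hΩ hp c Ω' h' _ _ _)
  refine le_trans ?_ (loc_avX Ω hΩ hp c Ω' h' j y)
  refine mll (sum_le_sum fun x _ => hj _ _) (by positivity)

omit hsp in
lemma loc_h2 (γ : Option κ × Option κ) (hγ : γ ≠ (none, none)) :
    av2 (fun (x : {t : ZMod p // t ∉ Ω'}) (y : {t : ZMod p // t ∉ ({0} : Finset (ZMod p))}) =>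
      (Vo Ω c γ.1 x y * Vo Ω c γ.2 x y) ^ 2) ≤ 8 / p := by
  have hp' : (128:ℝ) ≤ p := by exact_mod_cast hp
  have hb := card_al ({0} : Finset (ZMod p))
  rw [card_singleton] at hb; push_cast at hb
  unfold av2
  rw [sum_comm]
  set b : ℝ := (Fintype.card {t : ZMod p // t ∉ ({0} : Finset (ZMod p))} : ℝ) with hbd
  have h1 : ∀ y : {t : ZMod p // t ∉ ({0} : Finset (ZMod p))},
      (Fintype.card {t : ZMod p // t ∉ Ω'} : ℝ)⁻¹ *
      ∑ x : {t : ZMod p // t ∉ Ω'}, (Vo Ω c γ.1 x y * Vo Ω c γ.2 x y) ^ 2 ≤ 8 / p := by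
    intro y
    refine le_trans ?_ (loc_h1' Ω hΩ hp c Ω' h' γ hγ y)
    gcongr with x _
    have : |Vo Ω c γ.1 x y * Vo Ω c γ.2 x y| ≤ 1 := by
      rw [abs_mul]; exact mul_le_one₀ (Vo_abs Ω hΩ hp c Ω' h' _ _ _) (abs_nonneg _) (Vo_abs Ω hΩ hp c Ω' h' _ _ _)
    rw [← sq_abs, pow_two]
    exact mul_le_of_le_one_right (abs_nonneg _) this
  rw [mul_comm (_⁻¹) b⁻¹, mul_assoc, mul_sum, inv_mul_le_iff₀ (by linarith)]
  refine (sum_le_sum fun y _ => h1 y).trans ?_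
  rw [sum_const, nsmul_eq_mul, card_univ]

include hc

lemma loc_h0 (γ : Option κ × Option κ) (hγ : γ ≠ (none, none)) :
    |av2 (fun (x : {t : ZMod p // t ∉ Ω'}) (y : {t : ZMod p // t ∉ ({0} : Finset (ZMod p))}) =>
      Vo Ω c γ.1 x y * Vo Ω c γ.2 x y) - dd Ω c γ| ≤ 100 / p ^ 2 := by
  have hp' : (128:ℝ) ≤ p := by exact_mod_cast hp
  have hb := card_al ({0} : Finset (ZMod p))
  rw [card_singleton] at hb; push_cast at hb
  have ha := loc_card Ω hΩ hp Ω' h'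
  have hneΩ : Fintype.card {t : ZMod p // t ∉ Ω} ≠ 0 := by
    have := loc_card Ω hΩ hp Ω subset_rfl
    intro h; rw [h] at this; push_cast at this; linarith
  have hf := finv_le Ω hΩ hp
  have hf0 := finv_nonneg Ω
  set α := {t : ZMod p // t ∉ Ω'} with hα
  set β := {t : ZMod p // t ∉ ({0} : Finset (ZMod p))} with hβ
  set a : ℝ := (Fintype.card α : ℝ) with had
  set b : ℝ := (Fintype.card β : ℝ) with hbd
  have ha0 : 0 < a := by linarith
  have hb0 : 0 < b := by linarith
  have hb1 : b⁻¹ ≤ 2 / p := by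
    rw [inv_eq_one_div, div_le_div_iff₀ hb0 (by linarith)]; linarith
  have ha1 : a⁻¹ ≤ 2 / p := by
    rw [inv_eq_one_div, div_le_div_iff₀ ha0 (by linarith)]; linarith
  have hX : a⁻¹ * ∑ x : α, |vv Ω x| ≤ 8 / p :=
    vv_av_inj Ω hΩ hp ha (fun x : α => x.1) Subtype.val_injective
  have hsumβ : ∀ F : ZMod p → ℝ, ∑ y : β, F y = ∑ y, F y - F 0 := by
    intro F; rw [sum_split {0} F, Finset.sum_singleton]; ring
  have htr : ∀ (j : κ) (x : ZMod p), c j ≠ 0 → ∀ F : ZMod p → ℝ, ∑ y, F (x + c j * y) = ∑ t, F t := by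
    intro j x hj F
    exact sum_equiv ((Equiv.mulLeft₀ (c j) hj).trans (Equiv.addLeft x)) _ _ (fun y => by simp)
  have hspv : ∀ j, c j = 0 → ∀ x : α, vv Ω (x : ZMod p) = finv Ω := by
    intro j hj x
    have hx : (x:ZMod p) ∉ Ω := by rw [← hsp j hj]; exact x.2
    simp [vv, hx]
  have hconst : ∀ t : ℝ, a⁻¹ * b⁻¹ * ∑ _x : α, ∑ _y : β, t = t := by
    intro t
    rw [sum_const, sum_const, nsmul_eq_mul, nsmul_eq_mul, card_univ, card_univ, ← had, ← hbd]
    field_simp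

  have hsing : ∀ j, |a⁻¹ * b⁻¹ * ∑ x : α, ∑ y : β, vv Ω (x + c j * y) - (if c j = 0 then finv Ω else 0)| ≤ 100 / p ^ 2 := by
    intro j
    split_ifs with hj
    · simp only [hj, zero_mul, add_zero]
      simp only [hspv j hj]
      rw [hconst, sub_self, abs_zero]; positivity
    · have : ∀ x : α, ∑ y : β, vv Ω (x + c j * y) = - vv Ω x := by
        intro x
        rw [hsumβ (fun y => vv Ω (x + c j * y)), htr j x hj (vv Ω), vv_sum Ω hneΩ]; simp
      simp only [this, sub_zero, Finset.sum_neg_distrib]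
      rw [abs_mul, abs_mul, abs_neg, abs_of_pos (inv_pos.2 ha0), abs_of_pos (inv_pos.2 hb0)]
      have h3 : |∑ x : α, vv Ω x| ≤ ∑ x : α, |vv Ω x| := abs_sum_le_sum_abs _ _
      calc a⁻¹ * b⁻¹ * |∑ x : α, vv Ω x| ≤ a⁻¹ * b⁻¹ * ∑ x : α, |vv Ω x| := by gcongr
        _ = b⁻¹ * (a⁻¹ * ∑ x : α, |vv Ω x|) := by ring
        _ ≤ (2 / p) * (8 / p) := by gcongr
        _ = 16 / p ^ 2 := by ring
        _ ≤ _ := by gcongr; norm_num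
  rcases γ with ⟨_ | j, _ | j'⟩
  · exact absurd rfl hγ
  · simp only [av2, Vo, dd, one_mul]; exact hsing j'
  · simp only [av2, Vo, dd, mul_one]; exact hsing j
  · simp only [av2, Vo, dd]
    by_cases hjj : j = j'
    · subst hjj
      rw [if_pos rfl]
      split_ifs with hj
      · simp only [hj, zero_mul, add_zero]
        simp only [hspv j hj]
        rw [hconst, ← pow_two, sub_self, abs_zero]; positivity
      · have : ∀ x : α, ∑ y : β, vv Ω (x + c j * y) * vv Ω (x + c j * y) = p * finv Ω - vv Ω x ^ 2 := by
          intro x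
          rw [hsumβ (fun y => vv Ω (x + c j * y) * vv Ω (x + c j * y)), htr j x hj (fun t => vv Ω t * vv Ω t)]
          simp only [mul_zero, add_zero]
          rw [← vv_sum_sq Ω hneΩ]; simp only [pow_two]
        rw [sum_congr rfl (fun x _ => this x), sum_sub_distrib, sum_const, nsmul_eq_mul, card_univ]
        rw [← had, ← hbd]
        have e : a⁻¹ * b⁻¹ * (a * (p * finv Ω) - ∑ x : α, vv Ω x ^ 2) - finv Ω = b⁻¹ * (finv Ω - a⁻¹ * ∑ x : α, vv Ω x ^ 2) := by
          rw [← hb]; field_simp; ring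
        rw [e, abs_mul, abs_of_pos (inv_pos.2 hb0)]
        have h4 : 0 ≤ a⁻¹ * ∑ x : α, vv Ω x ^ 2 := by positivity
        have h5 : a⁻¹ * ∑ x : α, vv Ω x ^ 2 ≤ 8 / p := by
          refine le_trans ?_ hX
          gcongr with x _
          rw [← sq_abs, pow_two]
          exact mul_le_of_le_one_right (abs_nonneg _) (vv_abs_one Ω hΩ hp _)
        have h6 : (3:ℝ) / p ≤ 8 / p := by gcongr; norm_num
        calc _ ≤ (2 / (p:ℝ)) * (8 / p) := by
              gcongr
              rw [abs_le]; constructor <;> linarith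
          _ = 16 / p ^ 2 := by ring
          _ ≤ _ := by gcongr; norm_num
    · rw [if_neg hjj, sub_zero, abs_mul, abs_of_pos (by positivity)]
      have hcc : c j - c j' ≠ 0 := sub_ne_zero.2 fun h => hjj (hc h)
      have hind : ∀ j : κ, ∑ x : α, ∑ y : β, (if (x : ZMod p) + c j * y ∈ Ω then (1:ℝ) else 0) ≤ b * 2 := by
        intro j
        rw [sum_comm]
        refine (sum_le_sum fun (y : β) _ => ind_sum_inj Ω hΩ (fun x : α => x.1 + c j * y)
          (fun a b h => Subtype.ext (by simpa using h))).trans ?_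
        rw [sum_const, nsmul_eq_mul, card_univ]
      have hjoint : ∑ x : α, ∑ y : β, (if (x : ZMod p) + c j * y ∈ Ω then (1:ℝ) else 0) * (if (x : ZMod p) + c j' * y ∈ Ω then (1:ℝ) else 0) ≤ 4 := by
        have e : ∀ (x : α) (y : β), (if (x : ZMod p) + c j * y ∈ Ω then (1:ℝ) else 0) * (if (x : ZMod p) + c j' * y ∈ Ω then (1:ℝ) else 0) =
            if ((x : ZMod p) + c j * y, (x : ZMod p) + c j' * y) ∈ Ω ×ˢ Ω then (1:ℝ) else 0 := by
          intro x y; simp only [mem_product, ite_and]; split_ifs <;> simp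
        simp only [e]
        rw [← Fintype.sum_prod_type' (f := fun (x : α) (y : β) => if ((x : ZMod p) + c j * y, (x : ZMod p) + c j' * y) ∈ Ω ×ˢ Ω then (1:ℝ) else 0), Finset.sum_boole]
        have : (univ.filter fun z : α × β => ((z.1 : ZMod p) + c j * z.2, (z.1 : ZMod p) + c j' * z.2) ∈ Ω ×ˢ Ω).card ≤ (Ω ×ˢ Ω).card := by
          refine card_le_card_of_injOn (fun z => ((z.1 : ZMod p) + c j * z.2, (z.1 : ZMod p) + c j' * z.2)) (fun z hz => by simpa using hz) ?_
          rintro ⟨x, y⟩ _ ⟨x', y'⟩ _ h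
          simp only [Prod.mk.injEq] at h
          have hy : (c j - c j') * ((y : ZMod p) - y') = 0 := by linear_combination h.1 - h.2
          have hy' : (y : ZMod p) = y' := by
            rcases mul_eq_zero.1 hy with h1 | h1
            · exact absurd h1 hcc
            · exact sub_eq_zero.1 h1
          have hx' : (x : ZMod p) = x' := by linear_combination h.1 - c j * hy'
          exact Prod.ext (Subtype.ext hx') (Subtype.ext hy')
        rw [card_product] at this
        have h4 : Ω.card * Ω.card ≤ 4 := by nlinarith
        exact_mod_cast this.trans h4
      have hb2 : |∑ x : α, ∑ y : β, vv Ω (x + c j * y) * vv Ω (x + c j' * y)| ≤ a * b * finv Ω ^ 2 + finv Ω * (b * 2) + finv Ω * (b * 2) + 4 := by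
        refine (abs_sum_le_sum_abs _ _).trans ?_
        refine (sum_le_sum fun x _ => abs_sum_le_sum_abs _ _).trans ?_
        have hpt : ∀ (x : α) (y : β), |vv Ω (x + c j * y) * vv Ω (x + c j' * y)| ≤
            finv Ω ^ 2 + finv Ω * (if (x : ZMod p) + c j * y ∈ Ω then (1:ℝ) else 0) + finv Ω * (if (x : ZMod p) + c j' * y ∈ Ω then (1:ℝ) else 0)
              + (if (x : ZMod p) + c j * y ∈ Ω then (1:ℝ) else 0) * (if (x : ZMod p) + c j' * y ∈ Ω then (1:ℝ) else 0) := by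
          intro x y
          rw [abs_mul]
          have i1 := vv_abs_le Ω hΩ hp ((x : ZMod p) + c j * y)
          have i2 := vv_abs_le Ω hΩ hp ((x : ZMod p) + c j' * y)
          refine (mul_le_mul i1 i2 (abs_nonneg _) (le_trans (abs_nonneg _) i1)).trans (le_of_eq ?_)
          ring
        refine (sum_le_sum fun x _ => sum_le_sum fun y _ => hpt x y).trans ?_
        simp only [sum_add_distrib, ← mul_sum]
        have e0 : ∑ _x : α, ∑ _y : β, finv Ω ^ 2 = a * b * finv Ω ^ 2 := by
          have := hconst (finv Ω ^ 2)
          field_simp at this; linarith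
        rw [e0]
        have i1 := mll (hind j) hf0
        have i2 := mll (hind j') hf0
        linarith
      calc _ ≤ a⁻¹ * b⁻¹ * (a * b * finv Ω ^ 2 + finv Ω * (b * 2) + finv Ω * (b * 2) + 4) := by gcongr
        _ = finv Ω ^ 2 + 4 * finv Ω * a⁻¹ + 4 * (a⁻¹ * b⁻¹) := by field_simp; ring
        _ ≤ (3 / p) ^ 2 + 4 * (3 / p) * (2 / p) + 4 * ((2 / p) * (2 / p)) := by gcongr
        _ = 49 / p ^ 2 := by ring
        _ ≤ _ := by gcongr; norm_num
end

noncomputable def WW {ι : Type} [Fintype ι] (pr : ι → ℕ) [∀ i, Fact (pr i).Prime]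
    (Ω : ∀ i, Finset (ZMod (pr i))) {k : ℕ} (c : Fin k → ℤ) (z : (ι → Option (Fin k)) → ℝ) (r q : ℤ) : ℝ :=
  ∑ σ, z σ * ∏ i, Vo (Ω i) (fun j => (c j : ZMod (pr i))) (σ i) r q

noncomputable def MainT {ι : Type} [Fintype ι] (pr : ι → ℕ) [∀ i, Fact (pr i).Prime]
    (Ω : ∀ i, Finset (ZMod (pr i))) {k : ℕ} (c : Fin k → ℤ) (z : (ι → Option (Fin k)) → ℝ) : ℝ :=
  ∑ π : ι → Option (Fin k) × Option (Fin k), z (fun i => (π i).1) * z (fun i => (π i).2) *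
    ∏ i, dd (Ω i) (fun j => (c j : ZMod (pr i))) (π i)

lemma WW_sq {ι : Type} [Fintype ι] (pr : ι → ℕ) [∀ i, Fact (pr i).Prime]
    (Ω : ∀ i, Finset (ZMod (pr i))) {k : ℕ} (c : Fin k → ℤ) (z : (ι → Option (Fin k)) → ℝ) (r q : ℤ) :
    WW pr Ω c z r q ^ 2 = ∑ π : ι → Option (Fin k) × Option (Fin k),
      z (fun i => (π i).1) * z (fun i => (π i).2) *
      ∏ i, (Vo (Ω i) (fun j => (c j : ZMod (pr i))) (π i).1 r q * Vo (Ω i) (fun j => (c j : ZMod (pr i))) (π i).2 r q) := by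
  unfold WW
  rw [pow_two, sum_mul_sum, ← Fintype.sum_prod_type']
  refine (sum_equiv (Equiv.arrowProdEquivProdArrow ι (fun _ => Option (Fin k)) (fun _ => Option (Fin k))) _ _ fun π => ?_).symm
  simp only [prod_mul_distrib, Equiv.arrowProdEquivProdArrow]
  simp only [Equiv.coe_fn_mk]
  ring

structure GoodZ {ι : Type} [Fintype ι] (pr : ι → ℕ) {k : ℕ} (R : ℝ) (z : (ι → Option (Fin k)) → ℝ) : Prop where
  nonneg : ∀ σ, 0 ≤ z σ
  mono : ∀ σ (S : Finset ι), z σ ≤ z (fun i => if i ∈ S then none else σ i)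
  supp : ∀ σ, z σ ≠ 0 → (univ.filter fun i => σ i ≠ none) ∈ setsLe pr R

theorem sumW {ι : Type} [Fintype ι] (pr : ι → ℕ) [∀ i, Fact (pr i).Prime]
    (hinj : Function.Injective pr) (Ω Ω' : ∀ i, Finset (ZMod (pr i)))
    (hΩ : ∀ i, (Ω i).card ≤ 2) (hpr : ∀ i, 128 ≤ pr i) (hΩ' : ∀ i, Ω' i ⊆ Ω i)
    {k : ℕ} (c : Fin k → ℤ) (hc : ∀ i, Function.Injective fun j => (c j : ZMod (pr i)))
    (hsp : ∀ i j, (c j : ZMod (pr i)) = 0 → Ω' i = Ω i)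
    (A B : Finset ℤ) (hA : A.Nonempty) (hB : B.Nonempty)
    (hAΩ : ∀ r ∈ A, ∀ i, (r : ZMod (pr i)) ∉ Ω' i) (hB0 : ∀ q ∈ B, ∀ i, (q : ZMod (pr i)) ≠ 0)
    (a a' : ℤ) (N N' : ℕ) (hAI : ∀ r ∈ A, ∃ j < N, r = a + (j : ℤ)) (hBI : ∀ r ∈ B, ∃ j < N', r = a' + (j : ℤ))
    (R : ℝ) (hR : 1 ≤ R) (z : (ι → Option (Fin k)) → ℝ) (hz : GoodZ pr R z)
    (CA CB : ℝ)
    (hCA : (N + 2 * R ^ 18 : ℝ) ≤ CA * A.card * ∑ s ∈ setsLe pr R, ∏ i ∈ s, finv (Ω' i))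
    (hCB : (N' + 2 * R ^ 18 : ℝ) ≤ CB * B.card * ∑ s ∈ setsLe pr R, ∏ i ∈ s, finv ({0} : Finset (ZMod (pr i))))
    (s : ℝ) (hs : 0 < s) (hs1 : s ≤ 1) (hs2 : ∀ i, ((k:ℝ) + 1) ^ 2 * 44 ≤ s * √(pr i))
    (hs3 : ∑ i, ((k:ℝ) + 1) ^ 2 * (116 / (pr i * √(pr i))) ≤ s) :
    |∑ r ∈ A, ∑ q ∈ B, WW pr Ω c z r q ^ 2 - A.card * B.card * MainT pr Ω c z| ≤ (3/2) * s * (CA + CB) * (A.card * B.card * MainT pr Ω c z) := by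
  have hp' : ∀ i, (128:ℝ) ≤ pr i := fun i => by exact_mod_cast hpr i
  have h128 : ∀ i, (Ω' i).card ≤ 2 := fun i => (card_le_card (hΩ' i)).trans (hΩ i)
  have hne : ∀ i (S : Finset (ZMod (pr i))), S.card ≤ 2 → Nonempty {t : ZMod (pr i) // t ∉ S} := by
    intro i S hS
    have := loc_card S hS (hpr i) S subset_rfl
    have h3 : (0:ℝ) < Fintype.card {t : ZMod (pr i) // t ∉ S} := by linarith [hp' i]
    exact card_pos_iff.1 (by exact_mod_cast h3)
  haveI hn1 : ∀ i, Nonempty {t : ZMod (pr i) // t ∉ Ω' i} := fun i => hne i _ (h128 i)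
  haveI hn2 : ∀ i, Nonempty {t : ZMod (pr i) // t ∉ ({0} : Finset (ZMod (pr i)))} := fun i => hne i _ (by simp)
  set rA : ℤ → ∀ i, {t : ZMod (pr i) // t ∉ Ω' i} := fun r i =>
    if h : (r : ZMod (pr i)) ∉ Ω' i then ⟨r, h⟩ else Classical.arbitrary _ with hrAd
  set rB : ℤ → ∀ i, {t : ZMod (pr i) // t ∉ ({0} : Finset (ZMod (pr i)))} := fun r i =>
    if h : (r : ZMod (pr i)) ∉ ({0} : Finset (ZMod (pr i))) then ⟨r, h⟩ else Classical.arbitrary _ with hrBd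
  have hrA : ∀ r ∈ A, ∀ i, (rA r i).1 = (r : ZMod (pr i)) := by
    intro r hr i; simp only [hrAd]; rw [dif_pos (hAΩ r hr i)]
  have hrB : ∀ r ∈ B, ∀ i, (rB r i).1 = (r : ZMod (pr i)) := by
    intro r hr i; simp only [hrBd]; rw [dif_pos (by simpa using hB0 r hr i)]
  have hSpos : ∀ Θ : ∀ i, Finset (ZMod (pr i)), (0:ℝ) < ∑ s ∈ setsLe pr R, ∏ i ∈ s, finv (Θ i) := by
    intro Θ
    have : ∏ i ∈ (∅ : Finset ι), finv (Θ i) ≤ ∑ s ∈ setsLe pr R, ∏ i ∈ s, finv (Θ i) :=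
      single_le_sum (f := fun s => ∏ i ∈ s, finv (Θ i)) (fun s _ => prod_nonneg fun i _ => finv_nonneg _)
        (by simp [setsLe, hR])
    rw [Finset.prod_empty] at this; linarith
  have bA := bessel2 pr hinj Ω' A rA hrA a N hAI hA (fun i => finv_le_one _ (h128 i) (hpr i)) R hR
  have bB := bessel2 pr hinj (fun i => {0}) B rB hrB a' N' hBI hB (fun i => finv_le_one _ (by simp) (hpr i)) R hR
  have key := thmG A rA B rB hA hB (Γ := Option (Fin k) × Option (Fin k)) (none, none)
    (fun i γ x y => Vo (Ω i) (fun j => (c j : ZMod (pr i))) γ.1 x y * Vo (Ω i) (fun j => (c j : ZMod (pr i))) γ.2 x y)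
    (fun i γ => dd (Ω i) (fun j => (c j : ZMod (pr i))) γ)
    (fun i => 100 / (pr i : ℝ) ^ 2) (fun i => 16 / (pr i : ℝ)) (fun i => 6 / √(pr i : ℝ))
    (fun i => by positivity) (fun i => by positivity) (fun i => by positivity)
    (fun π => z (fun i => (π i).1) * z (fun i => (π i).2))
    (fun i => rfl) (fun i γ => dd_nonneg _ _ _) (fun i x y => by simp [Vo])
    (fun i γ hγ => loc_h0 (Ω i) (hΩ i) (hpr i) _ (hc i) (Ω' i) (hΩ' i) (hsp i) γ hγ)
    (fun i γ hγ x => (loc_h1 (Ω i) (hΩ i) (hpr i) _ (Ω' i) (hΩ' i) (hsp i) γ hγ x).trans (le_of_eq (by ring)))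
    (fun i γ hγ y => by
      have h1 := loc_h1' (Ω i) (hΩ i) (hpr i) (fun j => (c j : ZMod (pr i))) (Ω' i) (hΩ' i) γ hγ y
      rw [abs_mul, abs_of_nonneg (by positivity)]
      refine le_trans ?_ (h1.trans (le_of_eq (by ring)))
      exact mll (abs_sum_le_sum_abs _ _) (by positivity))
    (fun i γ hγ => by
      have h1 := loc_h2 (Ω i) (hΩ i) (hpr i) (fun j => (c j : ZMod (pr i))) (Ω' i) (hΩ' i) γ hγ
      have hP := hp' i
      rw [div_pow 6, sq_sqrt (by linarith)]
      have h2 : 8 * (16 / (pr i : ℝ)) ^ 2 ≤ 16 / pr i := by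
        rw [div_pow, ← mul_div_assoc, div_le_div_iff₀ (by positivity) (by positivity)]; nlinarith
      have h3 : 16 / (pr i : ℝ) + 16 / pr i ≤ 6 ^ 2 / pr i := by
        rw [← add_div]; gcongr; norm_num
      have h4 : 2 * (8 / (pr i : ℝ)) = 16 / pr i := by ring
      linarith)
    (fun π => mul_nonneg (hz.nonneg _) (hz.nonneg _))
    (fun π S => by
      have h1 := hz.mono (fun i => (π i).1) S
      have h2 := hz.mono (fun i => (π i).2) S
      have e1 : (fun i => (if i ∈ S then ((none, none) : Option (Fin k) × Option (Fin k)) else π i).1) =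
        fun i => if i ∈ S then none else (π i).1 := by funext i; split_ifs <;> rfl
      have e2 : (fun i => (if i ∈ S then ((none, none) : Option (Fin k) × Option (Fin k)) else π i).2) =
        fun i => if i ∈ S then none else (π i).2 := by funext i; split_ifs <;> rfl
      rw [e1, e2]
      exact mul_le_mul h1 h2 (hz.nonneg _) (hz.nonneg _))
    (setsLe pr (R ^ 2))
    (fun π hπ m hm => by
      have h1 := hz.supp _ (left_ne_zero_of_mul hπ)
      have h2 := hz.supp _ (right_ne_zero_of_mul hπ)
      simp only [setsLe, mem_filter, mem_univ, true_and] at h1 h2 ⊢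
      have hone : ∀ i, (1:ℝ) ≤ pr i := fun i => by linarith [hp' i]
      set s1 : Finset ι := univ.filter fun i => (π i).1 ≠ none
      set s2 : Finset ι := univ.filter fun i => (π i).2 ≠ none
      have hsub : m ⊆ s1 ∪ s2 := by
        intro i hi
        have := hm i hi
        simp only [s1, s2, mem_union, mem_filter, mem_univ, true_and]
        by_contra hcon
        push Not at hcon
        exact this (Prod.ext hcon.1 hcon.2)
      have hint : (1:ℝ) ≤ ∏ i ∈ s1 ∩ s2, (pr i : ℝ) := by
        have := prod_mono_one (empty_subset (s1 ∩ s2)) (fun i => (pr i : ℝ)) hone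
        simpa using this
      have hu : ∏ i ∈ s1 ∪ s2, (pr i : ℝ) ≤ (∏ i ∈ s1, (pr i : ℝ)) * ∏ i ∈ s2, (pr i : ℝ) := by
        rw [← Finset.prod_union_inter]
        exact le_mul_of_one_le_right (prod_nonneg fun i _ => by positivity) hint
      calc _ ≤ ∏ i ∈ s1 ∪ s2, (pr i : ℝ) := prod_mono_one hsub _ hone
        _ ≤ _ := hu
        _ ≤ R * R := mul_le_mul h1 h2 (prod_nonneg fun i _ => by positivity) (by linarith)
        _ = R ^ 2 := by ring)
    CA CB
    (by
      have hS := hSpos Ω'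
      refine le_of_mul_le_mul_right (bA.trans ?_) hS
      calc (A.card : ℝ) * (N + 2 * R ^ 18) ≤ A.card * (CA * A.card * ∑ s ∈ setsLe pr R, ∏ i ∈ s, finv (Ω' i)) := by gcongr
        _ = _ := by ring)
    (by
      have hS := hSpos (fun i => {0})
      refine le_of_mul_le_mul_right (bB.trans ?_) hS
      calc (B.card : ℝ) * (N' + 2 * R ^ 18) ≤ B.card * (CB * B.card * ∑ s ∈ setsLe pr R, ∏ i ∈ s, finv ({0} : Finset (ZMod (pr i)))) := by gcongr
        _ = _ := by ring)
    (fun i => √(pr i : ℝ)) (fun i => sqrt_pos.2 (by linarith [hp' i])) s hs hs1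
    (fun i => by
      have hcard : (Fintype.card (Option (Fin k) × Option (Fin k)) : ℝ) = ((k:ℝ) + 1) ^ 2 := by simp; ring
      have hq : 0 < √(pr i : ℝ) := sqrt_pos.2 (by linarith [hp' i])
      have hqq : √(pr i : ℝ) * √(pr i : ℝ) = pr i := mul_self_sqrt (by positivity)
      rw [hcard]
      have e : 16 / (pr i : ℝ) * √(pr i : ℝ) + 6 / √(pr i : ℝ) = 22 / √(pr i : ℝ) := by

        have hP := hp' i
        have e1 : 16 / (pr i : ℝ) * √(pr i : ℝ) = 16 / √(pr i : ℝ) := by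
          rw [div_mul_eq_mul_div, div_eq_div_iff (by linarith) hq.ne']; nlinarith
        rw [e1, ← add_div]; norm_num
      rw [e, ← mul_div_assoc, div_le_iff₀ hq]
      linarith [hs2 i])
    (by
      have hcard : (Fintype.card (Option (Fin k) × Option (Fin k)) : ℝ) = ((k:ℝ) + 1) ^ 2 := by simp; ring
      refine le_trans (sum_le_sum fun i _ => ?_) hs3
      rw [hcard]
      have hq : 1 ≤ √(pr i : ℝ) := Real.one_le_sqrt.2 (by linarith [hp' i])
      have hqq : √(pr i : ℝ) * √(pr i : ℝ) = pr i := mul_self_sqrt (by positivity)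
      have hP := hp' i
      gcongr
      have e1 : 100 / (pr i : ℝ) ^ 2 ≤ 100 / (pr i * √(pr i : ℝ)) := by
        gcongr; rw [pow_two]; gcongr; nlinarith
      have e2 : 16 / (pr i : ℝ) / √(pr i : ℝ) = 16 / (pr i * √(pr i : ℝ)) := by rw [div_div]
      rw [e2]
      calc _ ≤ 100 / (pr i * √(pr i : ℝ)) + 16 / (pr i * √(pr i : ℝ)) := by linarith
        _ = _ := by rw [← add_div]; norm_num)
  have e : ∑ r ∈ A, ∑ q ∈ B, WW pr Ω c z r q ^ 2 = ∑ π : ι → Option (Fin k) × Option (Fin k),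
      (z (fun i => (π i).1) * z (fun i => (π i).2)) * ∑ r ∈ A, ∑ b ∈ B, ∏ i,
        (Vo (Ω i) (fun j => (c j : ZMod (pr i))) (π i).1 (rA r i) (rB b i) * Vo (Ω i) (fun j => (c j : ZMod (pr i))) (π i).2 (rA r i) (rB b i)) := by
    simp only [mul_sum]
    symm
    rw [sum_comm]
    refine sum_congr rfl fun r hr => ?_
    rw [sum_comm]
    refine sum_congr rfl fun q hq => ?_
    rw [WW_sq]
    refine sum_congr rfl fun π _ => ?_
    simp only [hrA r hr, hrB q hq]
  rw [e]
  exact key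

lemma tuple_sum {L X : Type} [Fintype L] [Fintype X] (w : L → X → ℝ) :
    ∑ T : L → X, ∏ l, w l (T l) = ∏ l, ∑ x, w l x := by
  rw [prod_univ_sum, piFinset_univ]

noncomputable def sz {ι : Type} (pr : ι → ℕ) (ρ : Finset ι) : ℝ := ∏ i ∈ ρ, (pr i : ℝ)

noncomputable def goodT {ι L : Type} [Fintype ι] [Fintype L] (pr : ι → ℕ) (R : ℝ) : Finset (L → Finset ι) :=
  univ.filter fun T => (∀ l l', l ≠ l' → Disjoint (T l) (T l')) ∧ ∏ l, sz pr (T l) ≤ R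

theorem tuple_lower {ι L : Type} [Fintype ι] [Fintype L] (pr : ι → ℕ) (hpr : ∀ i, 1 ≤ pr i) (u : L → Finset ι → ℝ) (hu : ∀ l ρ, 0 ≤ u l ρ) (f : ι → ℝ) (hf : ∀ i, 0 ≤ f i) (e : L → ℝ) (he : ∀ l, 0 ≤ e l)
    (h1 : ∀ l i, ∑ ρ, (if i ∈ ρ then u l ρ else 0) ≤ f i * ∑ ρ, u l ρ)
    (h2 : ∀ l, ∑ ρ, u l ρ * log (sz pr ρ) ≤ e l * ∑ ρ, u l ρ) (R : ℝ) (hR : 1 < R) :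
    (1 - (Fintype.card L : ℝ) ^ 2 * ∑ i, f i ^ 2 - (∑ l, e l) / log R) * ∏ l, ∑ ρ, u l ρ ≤ ∑ T ∈ goodT pr R, ∏ l, u l (T l) := by
  have hlogR : 0 < log R := log_pos hR
  set UU : L → ℝ := fun l => ∑ ρ, u l ρ with hUU
  have hU0 : ∀ l, 0 ≤ UU l := fun l => sum_nonneg fun ρ _ => hu l ρ
  have hP0 : 0 ≤ ∏ l, UU l := prod_nonneg fun l _ => hU0 l
  have hszpos : ∀ ρ : Finset ι, 1 ≤ sz pr ρ := fun ρ => by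
    have := prod_mono_one (empty_subset ρ) (fun i => (pr i : ℝ)) (fun i => by exact_mod_cast hpr i)
    simpa [sz] using this

  have hpt : ∀ T : L → Finset ι, 1 - ∑ l, ∑ l', ∑ i, (if l ≠ l' ∧ i ∈ T l ∧ i ∈ T l' then (1:ℝ) else 0)
      - ∑ l, log (sz pr (T l)) / log R ≤ if T ∈ goodT pr R then 1 else 0 := by
    intro T
    have n1 : 0 ≤ ∑ l, ∑ l', ∑ i, (if l ≠ l' ∧ i ∈ T l ∧ i ∈ T l' then (1:ℝ) else 0) :=
      sum_nonneg fun _ _ => sum_nonneg fun _ _ => sum_nonneg fun _ _ => by split_ifs <;> norm_num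
    have n2 : 0 ≤ ∑ l, log (sz pr (T l)) / log R :=
      sum_nonneg fun l _ => div_nonneg (log_nonneg (hszpos _)) hlogR.le
    split_ifs with h
    · linarith
    · simp only [goodT, mem_filter, mem_univ, true_and, not_and_or, not_le] at h
      rcases h with h | h
      · push Not at h
        obtain ⟨l, l', hl, hd⟩ := h
        obtain ⟨i, hi, hi'⟩ := Finset.not_disjoint_iff.1 hd
        have : (1:ℝ) ≤ ∑ l, ∑ l', ∑ i, (if l ≠ l' ∧ i ∈ T l ∧ i ∈ T l' then (1:ℝ) else 0) := by
          have a1 := single_le_sum (f := fun i => if l ≠ l' ∧ i ∈ T l ∧ i ∈ T l' then (1:ℝ) else 0)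
            (s := univ) (fun _ _ => by split_ifs <;> norm_num) (mem_univ i)
          have a2 := single_le_sum (f := fun l' => ∑ i, if l ≠ l' ∧ i ∈ T l ∧ i ∈ T l' then (1:ℝ) else 0)
            (s := univ) (fun _ _ => sum_nonneg fun _ _ => by split_ifs <;> norm_num) (mem_univ l')
          have a3 := single_le_sum (f := fun l => ∑ l', ∑ i, if l ≠ l' ∧ i ∈ T l ∧ i ∈ T l' then (1:ℝ) else 0)
            (s := univ) (fun _ _ => sum_nonneg fun _ _ => sum_nonneg fun _ _ => by split_ifs <;> norm_num) (mem_univ l)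
          have a0 : (1:ℝ) = if l ≠ l' ∧ i ∈ T l ∧ i ∈ T l' then (1:ℝ) else 0 := by rw [if_pos ⟨hl, hi, hi'⟩]
          exact a0.le.trans (a1.trans (a2.trans a3))
        linarith
      · have : (1:ℝ) ≤ ∑ l, log (sz pr (T l)) / log R := by
          rw [← sum_div, le_div_iff₀ hlogR, one_mul, ← Real.log_prod (fun l _ => by linarith [hszpos (T l)])]
          exact log_le_log (by linarith) h.le
        linarith
  have hpair : ∀ l l' i, ∑ T : L → Finset ι, (∏ k, u k (T k)) * (if l ≠ l' ∧ i ∈ T l ∧ i ∈ T l' then (1:ℝ) else 0) ≤ f i ^ 2 * ∏ l, UU l := by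
    intro l l' i
    by_cases hl : l = l'
    · simp [hl]; positivity
    · have e1 : ∀ T : L → Finset ι, (∏ k, u k (T k)) * (if l ≠ l' ∧ i ∈ T l ∧ i ∈ T l' then (1:ℝ) else 0) =
          ∏ k, (if k = l ∨ k = l' then (if i ∈ T k then u k (T k) else 0) else u k (T k)) := by
        intro T
        by_cases hh : i ∈ T l ∧ i ∈ T l'
        · rw [if_pos ⟨hl, hh⟩, mul_one]
          refine prod_congr rfl fun k _ => ?_
          split_ifs with h3 h4
          · rfl
          · rcases h3 with rfl | rfl
            · exact absurd hh.1 h4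
            · exact absurd hh.2 h4
          · rfl
        · rw [if_neg (fun h => hh h.2), mul_zero]
          symm
          by_cases h3 : i ∈ T l
          · exact prod_eq_zero (mem_univ l') (by rw [if_pos (Or.inr rfl), if_neg (fun h => hh ⟨h3, h⟩)])
          · exact prod_eq_zero (mem_univ l) (by rw [if_pos (Or.inl rfl), if_neg h3])
      simp only [e1]
      rw [tuple_sum (fun k ρ => if k = l ∨ k = l' then (if i ∈ ρ then u k ρ else 0) else u k ρ)]
      have e2 : f i ^ 2 * ∏ l, UU l = ∏ k, ((if k = l ∨ k = l' then f i else 1) * UU k) := by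
        rw [prod_mul_distrib]
        congr 1
        rw [Finset.prod_ite, prod_const, Finset.prod_const_one, mul_one]
        congr 1
        have : (univ.filter fun k => k = l ∨ k = l') = {l, l'} := by ext k; simp
        rw [this, Finset.card_pair hl]
      rw [e2]
      refine prod_le_prod (fun k _ => sum_nonneg fun ρ _ => ?_) fun k _ => ?_
      · split_ifs <;> first | exact hu _ _ | exact le_rfl
      · by_cases h3 : k = l ∨ k = l'
        · simp only [h3, if_true]; exact h1 k i
        · simp only [h3, if_false, one_mul]; exact le_rfl
  have hlog : ∀ l, ∑ T : L → Finset ι, (∏ k, u k (T k)) * log (sz pr (T l)) ≤ e l * ∏ l, UU l := by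
    intro l
    have e1 : ∀ T : L → Finset ι, (∏ k, u k (T k)) * log (sz pr (T l)) =
        ∏ k, (u k (T k) * if k = l then log (sz pr (T k)) else 1) := by
      intro T; rw [prod_mul_distrib, prod_ite_eq']; simp
    simp only [e1]
    rw [tuple_sum (fun k ρ => u k ρ * if k = l then log (sz pr ρ) else 1)]
    have e2 : e l * ∏ l, UU l = ∏ k, ((if k = l then e k else 1) * UU k) := by
      rw [prod_mul_distrib, prod_ite_eq']; simp
    rw [e2]
    refine prod_le_prod (fun k _ => sum_nonneg fun ρ _ => mul_nonneg (hu _ _) ?_) fun k _ => ?_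
    · split_ifs
      · exact log_nonneg (hszpos _)
      · norm_num
    · by_cases h3 : k = l
      · simp only [h3, if_true]; exact h2 l
      · simp only [h3, if_false, one_mul, mul_one]; exact le_rfl
  have hsum : ∑ T : L → Finset ι, (∏ l, u l (T l)) * (1 - ∑ l, ∑ l', ∑ i, (if l ≠ l' ∧ i ∈ T l ∧ i ∈ T l' then (1:ℝ) else 0)
      - ∑ l, log (sz pr (T l)) / log R) ≤ ∑ T ∈ goodT pr R, ∏ l, u l (T l) := by
    calc _ ≤ ∑ T : L → Finset ι, (∏ l, u l (T l)) * (if T ∈ goodT pr R then 1 else 0) := by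
          refine sum_le_sum fun T _ => mll (hpt T) (prod_nonneg fun l _ => hu _ _)
      _ = _ := by simp
  refine le_trans ?_ hsum
  simp only [mul_sub, mul_one, sum_sub_distrib, mul_sum]
  rw [tuple_sum u]
  have a1 : ∑ T : L → Finset ι, ∑ l, ∑ l', ∑ i, (∏ k, u k (T k)) * (if l ≠ l' ∧ i ∈ T l ∧ i ∈ T l' then (1:ℝ) else 0)
      ≤ (Fintype.card L : ℝ) ^ 2 * (∑ i, f i ^ 2) * ∏ l, UU l := by
    rw [sum_comm]
    have : ∀ l ∈ univ, ∑ T : L → Finset ι, ∑ l', ∑ i, (∏ k, u k (T k)) * (if l ≠ l' ∧ i ∈ T l ∧ i ∈ T l' then (1:ℝ) else 0)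
        ≤ (Fintype.card L : ℝ) * ((∑ i, f i ^ 2) * ∏ l, UU l) := by
      intro l _
      rw [sum_comm]
      have h3 : ∀ l' ∈ univ, ∑ T : L → Finset ι, ∑ i, (∏ k, u k (T k)) * (if l ≠ l' ∧ i ∈ T l ∧ i ∈ T l' then (1:ℝ) else 0)
        ≤ ((∑ i, f i ^ 2) * ∏ l, UU l) := by
        intro l' _
        rw [sum_comm, sum_mul]
        exact sum_le_sum fun i _ => hpair l l' i
      refine (sum_le_sum h3).trans ?_
      rw [sum_const, nsmul_eq_mul, card_univ]
    refine (sum_le_sum this).trans ?_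
    rw [sum_const, nsmul_eq_mul, card_univ]
    exact le_of_eq (by ring)
  have a2 : ∑ T : L → Finset ι, ∑ l, (∏ k, u k (T k)) * (log (sz pr (T l)) / log R) ≤ (∑ l, e l) / log R * ∏ l, UU l := by
    rw [sum_comm, sum_div, sum_mul]
    refine sum_le_sum fun l _ => ?_
    simp only [← mul_div_assoc]
    rw [← sum_div, div_mul_eq_mul_div]
    gcongr
    exact hlog l
  simp only [mul_sum] at a1 a2 ⊢
  linarith

lemma fiber_prod {ι L : Type} [Fintype ι] [Fintype L] (lam : ι → Option L) (h : ι → ℝ) :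
    ∏ i, (lam i).elim 1 (fun _ => h i) = ∏ l, ∏ i ∈ univ.filter (fun i => lam i = some l), h i := by
  rw [← Finset.prod_fiberwise (s := univ) (g := lam), prod_option]
  have h1 : ∏ i ∈ univ.filter (fun i => lam i = none), (lam i).elim 1 (fun _ => h i) = 1 := by
    refine Finset.prod_eq_one fun i hi => ?_
    rw [(mem_filter.1 hi).2]; rfl
  rw [h1, one_mul]
  refine prod_congr rfl fun l _ => prod_congr rfl fun i hi => ?_
  rw [(mem_filter.1 hi).2]; rfl

noncomputable def pre {ι L : Type} [Fintype ι] (σ : ι → Option L) (j : L) : Finset ι :=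
  univ.filter fun i => σ i = some j

noncomputable def zz {ι : Type} [Fintype ι] (pr : ι → ℕ) {k : ℕ} (g : Finset ι → ℝ) (R : ℝ) (σ : ι → Option (Fin k)) : ℝ :=
  (∏ j, g (pre σ j)) * if sz pr (univ.filter fun i => σ i ≠ none) ≤ R then 1 else 0

lemma zz_good {ι : Type} [Fintype ι] (pr : ι → ℕ) (hpr : ∀ i, 1 ≤ pr i) {k : ℕ} (g : Finset ι → ℝ) (R : ℝ) (hg0 : ∀ ρ, 0 ≤ g ρ) (hg : ∀ ρ ρ', ρ ⊆ ρ' → g ρ' ≤ g ρ) : GoodZ pr R (zz (k := k) pr g R) where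
  nonneg σ := mul_nonneg (prod_nonneg fun j _ => hg0 _) (by split_ifs <;> norm_num)
  mono σ S := by
    unfold zz
    refine mul_le_mul (prod_le_prod (fun j _ => hg0 _) fun j _ => hg _ _ ?_) ?_
      (by split_ifs <;> norm_num) (prod_nonneg fun j _ => hg0 _)
    · intro i hi
      simp only [pre, mem_filter, mem_univ, true_and] at hi ⊢
      split_ifs at hi
      exact hi
    · have : sz pr (univ.filter fun i => (if i ∈ S then none else σ i) ≠ none) ≤ sz pr (univ.filter fun i => σ i ≠ none) := by
        refine prod_mono_one ?_ _ (fun i => by exact_mod_cast hpr i)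
        intro i hi
        simp only [mem_filter, mem_univ, true_and] at hi ⊢
        split_ifs at hi
        · exact absurd rfl hi
        · exact hi
      by_cases h1 : sz pr (univ.filter fun i => σ i ≠ none) ≤ R
      · rw [if_pos h1, if_pos (this.trans h1)]
      · rw [if_neg h1]; split_ifs <;> norm_num
  supp σ h := by
    have := right_ne_zero_of_mul h
    simp only [setsLe, mem_filter, mem_univ, true_and]
    by_contra hc
    exact this (if_neg hc)

lemma zz_le {ι : Type} [Fintype ι] (pr : ι → ℕ) {k : ℕ} (g : Finset ι → ℝ) (R : ℝ) (hg0 : ∀ ρ, 0 ≤ g ρ) (σ : ι → Option (Fin k)) : zz pr g R σ ≤ ∏ j, g (pre σ j) :=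
  mul_le_of_le_one_right (prod_nonneg fun j _ => hg0 _) (by split_ifs <;> norm_num)

theorem main1_le {ι : Type} [Fintype ι] (pr : ι → ℕ) [∀ i, Fact (pr i).Prime]
    (Ω : ∀ i, Finset (ZMod (pr i))) {k : ℕ} (c : Fin k → ℤ) (hc : ∀ i j, (c j : ZMod (pr i)) ≠ 0)
    (g : Finset ι → ℝ) (R : ℝ) (hg0 : ∀ ρ, 0 ≤ g ρ) :
    MainT pr Ω c (zz pr g R) ≤ (∑ ρ, g ρ ^ 2 * ∏ i ∈ ρ, finv (Ω i)) ^ k := by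
  have hz0 : ∀ σ : ι → Option (Fin k), 0 ≤ zz pr g R σ := fun σ =>
    mul_nonneg (prod_nonneg fun j _ => hg0 _) (by split_ifs <;> norm_num)
  set u : Finset ι → ℝ := fun ρ => g ρ ^ 2 * ∏ i ∈ ρ, finv (Ω i) with hu
  have hu0 : ∀ ρ, 0 ≤ u ρ := fun ρ => mul_nonneg (sq_nonneg _) (prod_nonneg fun i _ => finv_nonneg _)
  have e1 : (∑ ρ, u ρ) ^ k = ∑ T : Fin k → Finset ι, ∏ l, u (T l) := by
    have := tuple_sum (L := Fin k) (fun _ => u)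
    have h2 : (∑ ρ, u ρ) ^ k = ∏ _l : Fin k, ∑ x, u x := by simp
    rw [h2, ← this]
    exact sum_congr (by congr!) fun _ _ => rfl
  rw [e1]
  unfold MainT
  set DD : Finset (ι → Option (Fin k) × Option (Fin k)) := univ.filter fun π => ∀ i, (π i).1 = (π i).2 with hDD
  rw [← Finset.sum_subset (subset_univ DD)]
  · have hb : ∀ π ∈ DD, zz pr g R (fun i => (π i).1) * zz pr g R (fun i => (π i).2) *
        ∏ i, dd (Ω i) (fun j => (c j : ZMod (pr i))) (π i) ≤ ∏ l, u (pre (fun i => (π i).1) l) := by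
      intro π hπ
      simp only [hDD, mem_filter, mem_univ, true_and] at hπ
      have e2 : (fun i => (π i).2) = fun i => (π i).1 := funext fun i => (hπ i).symm
      rw [e2]
      have e3 : ∏ i, dd (Ω i) (fun j => (c j : ZMod (pr i))) (π i) = ∏ l, ∏ i ∈ pre (fun i => (π i).1) l, finv (Ω i) := by
        unfold pre
        rw [← fiber_prod]
        refine prod_congr rfl fun i _ => ?_
        have := hπ i
        rcases h : π i with ⟨_ | j, o⟩
        · rw [h] at this; simp only at this; rw [← this]; rfl
        · rw [h] at this; simp only at this; rw [← this]
          simp [dd, hc i j]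
      rw [e3]
      simp only [hu]
      rw [prod_mul_distrib, prod_pow, pow_two]
      have := zz_le pr g R hg0 (fun i => (π i).1)
      exact mlr (mul_le_mul this this (hz0 _) (prod_nonneg fun j _ => hg0 _))
        (prod_nonneg fun l _ => prod_nonneg fun i _ => finv_nonneg _)
    refine (sum_le_sum hb).trans ?_
    rw [← sum_image (s := DD) (g := fun π => pre (fun i => (π i).1)) (f := fun T : Fin k → Finset ι => ∏ l, u (T l))]
    · exact sum_le_sum_of_subset_of_nonneg (subset_univ _) (fun T _ _ => prod_nonneg fun l _ => hu0 _)
    · intro π hπ π' hπ' h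
      simp only [hDD, coe_filter, mem_univ, true_and, Set.mem_setOf_eq] at hπ hπ'
      have h1 : ∀ i, (π i).1 = (π' i).1 := by
        intro i
        ext j
        have := ext_iff.1 (congrFun h j) i
        simpa [pre] using this
      funext i
      exact Prod.ext (h1 i) (by rw [← hπ i, ← hπ' i, h1 i])
  · intro π _ hπ
    simp only [hDD, mem_filter, mem_univ, true_and, not_forall] at hπ
    obtain ⟨i, hi⟩ := hπ
    have : dd (Ω i) (fun j => (c j : ZMod (pr i))) (π i) = 0 := by
      rcases h : π i with ⟨_ | j, _ | j'⟩ <;> rw [h] at hi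
      · exact absurd rfl hi
      · simp [dd, hc]
      · simp [dd, hc]
      · have : j ≠ j' := fun h => hi (by rw [h])
        simp [dd, this]
    rw [prod_eq_zero (mem_univ i) this, mul_zero]

noncomputable def uu {ι : Type} [Fintype ι] (f : ι → ℝ) (g : Finset ι → ℝ) {k : ℕ} (m : Fin k) (l : Option (Fin k)) (ρ : Finset ι) : ℝ :=
  (match l with
    | none => g ρ
    | some j => if j = m then g ρ else g ρ ^ 2) * ∏ i ∈ ρ, f i

def code {k : ℕ} (m : Fin k) (l : Option (Fin k)) : Option (Fin k) × Option (Fin k) :=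
  match l with
  | none => (none, some m)
  | some j => if j = m then (some m, none) else (some j, some j)

lemma code_fst {k : ℕ} (m : Fin k) (l : Option (Fin k)) (j : Fin k) : (code m l).1 = some j ↔ l = some j := by
  rcases l with _ | j'
  · simp [code]
  · by_cases h : j' = m
    · subst h; simp [code]
    · simp [code, h]

lemma code_snd {k : ℕ} (m : Fin k) (l : Option (Fin k)) (j : Fin k) :
    (code m l).2 = some j ↔ l = (if j = m then none else some j) := by
  rcases l with _ | j'
  · by_cases h : j = m
    · simp [code, h]
    · simp [code, h]; exact fun h' => h h'.symm
  · by_cases h : j' = m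
    · by_cases h2 : j = m
      · simp [code, h, h2]
      · simp [code, h, h2]; exact fun h' => h2 h'.symm
    · by_cases h2 : j = m
      · simp [code, h, h2]
      · simp [code, h, h2]

set_option maxHeartbeats 1000000 in
theorem main2_ge {ι : Type} [Fintype ι] (pr : ι → ℕ) [∀ i, Fact (pr i).Prime]
    (Ω : ∀ i, Finset (ZMod (pr i))) {k : ℕ} (c : Fin k → ℤ) (m : Fin k) (hcm : ∀ i, (c m : ZMod (pr i)) = 0)
    (hc : ∀ i j, j ≠ m → (c j : ZMod (pr i)) ≠ 0)
    (g : Finset ι → ℝ) (R : ℝ) (hg0 : ∀ ρ, 0 ≤ g ρ) :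
    ∑ T ∈ goodT pr R, ∏ l, uu (fun i => finv (Ω i)) g m l (T l) ≤ MainT pr Ω c (zz pr g R) := by
  have hz0 : ∀ σ : ι → Option (Fin k), 0 ≤ zz pr g R σ := fun σ =>
    mul_nonneg (prod_nonneg fun j _ => hg0 _) (by split_ifs <;> norm_num)
  set lam : (Option (Fin k) → Finset ι) → ι → Option (Option (Fin k)) := fun T i =>
    if h : ∃ l, i ∈ T l then some h.choose else none with hlam
  have hlamT : ∀ T ∈ goodT (L := Option (Fin k)) pr R, ∀ i l, lam T i = some l ↔ i ∈ T l := by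
    intro T hT i l
    simp only [goodT, mem_filter, mem_univ, true_and] at hT
    simp only [hlam]
    constructor
    · intro h
      split_ifs at h with h1
      rw [Option.some.injEq] at h
      rw [← h]; exact h1.choose_spec
    · intro h
      have h1 : ∃ l, i ∈ T l := ⟨l, h⟩
      rw [dif_pos h1, Option.some.injEq]
      by_contra hne
      exact disjoint_left.1 (hT.1 _ _ hne) h1.choose_spec h
  set psi : (Option (Fin k) → Finset ι) → ι → Option (Fin k) × Option (Fin k) := fun T i =>
    (lam T i).elim (none, none) (code m) with hpsi
  have hfst : ∀ T ∈ goodT (L := Option (Fin k)) pr R, ∀ j, pre (fun i => (psi T i).1) j = T (some j) := by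
    intro T hT j
    ext i
    simp only [pre, mem_filter, mem_univ, true_and, hpsi]
    rw [← hlamT T hT]
    rcases lam T i with _ | l
    · simp
    · simp only [Option.elim, code_fst, Option.some.injEq]
  have hsnd : ∀ T ∈ goodT (L := Option (Fin k)) pr R, ∀ j, pre (fun i => (psi T i).2) j = T (if j = m then none else some j) := by
    intro T hT j
    ext i
    simp only [pre, mem_filter, mem_univ, true_and, hpsi]
    rw [← hlamT T hT]
    rcases lam T i with _ | l
    · simp
    · simp only [Option.elim, code_snd, Option.some.injEq]
  have hfib : ∀ T ∈ goodT (L := Option (Fin k)) pr R, ∀ h : ι → ℝ, ∏ i, (lam T i).elim 1 (fun _ => h i) = ∏ l, ∏ i ∈ T l, h i := by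
    intro T hT h
    rw [fiber_prod]
    refine prod_congr rfl fun l _ => ?_
    congr 1
    ext i
    simp [hlamT T hT]
  have hone : ∀ i, (1:ℝ) ≤ pr i := fun i => by exact_mod_cast (Fact.out : (pr i).Prime).one_le
  have hsz : ∀ T ∈ goodT (L := Option (Fin k)) pr R, ∀ σ : ι → Option (Fin k), (∀ i, lam T i = none → σ i = none) →
      sz pr (univ.filter fun i => σ i ≠ none) ≤ R := by
    intro T hT σ hσ
    have hT' := hT
    simp only [goodT, mem_filter, mem_univ, true_and] at hT'
    have h1 := hT'.2
    refine le_trans ?_ h1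
    unfold sz
    rw [← hfib T hT (fun i => (pr i : ℝ)), prod_filter]
    refine prod_le_prod (fun i _ => by split_ifs <;> positivity) fun i _ => ?_
    rcases h : lam T i with _ | l
    · simp [hσ i h]
    · simp only [Option.elim]; split_ifs
      · exact le_rfl
      · exact hone i
  have hterm : ∀ T ∈ goodT (L := Option (Fin k)) pr R, ∏ l, uu (fun i => finv (Ω i)) g m l (T l) =
      zz pr g R (fun i => (psi T i).1) * zz pr g R (fun i => (psi T i).2) *
        ∏ i, dd (Ω i) (fun j => (c j : ZMod (pr i))) (psi T i) := by
    intro T hT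
    have d1 : ∏ i, dd (Ω i) (fun j => (c j : ZMod (pr i))) (psi T i) = ∏ l, ∏ i ∈ T l, finv (Ω i) := by
      rw [← hfib T hT]
      refine prod_congr rfl fun i _ => ?_
      simp only [hpsi]
      rcases lam T i with _ | l
      · rfl
      · simp only [Option.elim]
        rcases l with _ | j
        · simp [code, dd, hcm i]
        · by_cases hj : j = m
          · simp [code, dd, hj, hcm i]
          · simp [code, dd, hj, hc i j hj]
    rw [d1]
    unfold zz
    rw [if_pos (hsz T hT _ (fun i h => by simp [hpsi, h])), if_pos (hsz T hT _ (fun i h => by simp [hpsi, h])), mul_one, mul_one]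
    simp only [hfst T hT, hsnd T hT, uu]
    rw [prod_mul_distrib]
    congr 1
    rw [prod_option, ← prod_mul_distrib]
    have : ∀ j : Fin k, g (T (some j)) * g (T (if j = m then none else some j)) =
        (if j = m then g (T none) else 1) * (if j = m then g (T (some j)) else g (T (some j)) ^ 2) := by
      intro j; split_ifs <;> ring
    simp only [this]
    rw [prod_mul_distrib, prod_ite_eq']
    simp
  rw [sum_congr rfl hterm]
  unfold MainT
  rw [← sum_image (s := goodT pr R) (g := psi) (f := fun π => zz pr g R (fun i => (π i).1) * zz pr g R (fun i => (π i).2) *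
        ∏ i, dd (Ω i) (fun j => (c j : ZMod (pr i))) (π i))]
  · exact sum_le_sum_of_subset_of_nonneg (subset_univ _) (fun π _ _ =>
      mul_nonneg (mul_nonneg (hz0 _) (hz0 _)) (prod_nonneg fun i _ => dd_nonneg _ _ _))
  · intro T hT T' hT' h
    funext l
    rcases l with _ | j
    · have h1 := hsnd T hT m
      have h2 := hsnd T' hT' m
      rw [h] at h1
      simp only [if_true] at h1 h2
      rw [← h1, ← h2]
    · rw [← hfst T hT j, ← hfst T' hT' j, h]

lemma geo_sq (N : ℕ) (b : ℕ → Prop) (hb : ∀ n, b n → b (n+1)) :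
    (∑ n ∈ range N, (1/2:ℝ)^n * (if b n then 1 else 0)) ^ 2 ≤
      4 * ∑ n ∈ range N, (1/4:ℝ)^n * (if b n then 1 else 0) := by
  induction N generalizing b with
  | zero => simp
  | succ N ih =>
    rw [Finset.sum_range_succ', Finset.sum_range_succ']
    have h := ih (fun n => b (n+1)) (fun n => hb (n+1))
    have e1 : ∑ n ∈ range N, (1/2:ℝ)^(n+1) * (if b (n+1) then (1:ℝ) else 0) =
      (1/2) * ∑ n ∈ range N, (1/2:ℝ)^n * (if b (n+1) then (1:ℝ) else 0) := by
      rw [mul_sum]; exact sum_congr rfl fun n _ => by ring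
    have e2 : ∑ n ∈ range N, (1/4:ℝ)^(n+1) * (if b (n+1) then (1:ℝ) else 0) =
      (1/4) * ∑ n ∈ range N, (1/4:ℝ)^n * (if b (n+1) then (1:ℝ) else 0) := by
      rw [mul_sum]; exact sum_congr rfl fun n _ => by ring
    rw [e1, e2]
    set X := ∑ n ∈ range N, (1/2:ℝ)^n * (if b (n+1) then (1:ℝ) else 0) with hX
    set Y := ∑ n ∈ range N, (1/4:ℝ)^n * (if b (n+1) then (1:ℝ) else 0) with hY
    have hX2 : X ≤ 2 := by
      calc X ≤ ∑ n ∈ range N, (1/2:ℝ)^n := sum_le_sum fun n _ => by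
            split_ifs <;> simp
        _ ≤ 2 := by
            have := geom_sum_eq (x := (1/2:ℝ)) (by norm_num) N
            rw [this]
            have : (0:ℝ) < (1/2)^N := by positivity
            rw [div_le_iff_of_neg (by norm_num)]; linarith
    have hX0 : 0 ≤ X := sum_nonneg fun n _ => by positivity
    by_cases h0 : b 0
    · simp only [h0, if_true, pow_zero]
      nlinarith
    · simp only [h0, if_false, pow_zero]
      nlinarith

noncomputable def gg {ι : Type} (pr : ι → ℕ) (N0 : ℕ) (L0 : ℝ) (ρ : Finset ι) : ℝ :=
  ∑ n ∈ range N0, (1/2:ℝ)^n * (if sz pr ρ ≤ exp (2^n * L0) then 1 else 0)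

lemma gg_nonneg {ι : Type} (pr : ι → ℕ) (N0 : ℕ) (L0 : ℝ) (ρ : Finset ι) : 0 ≤ gg pr N0 L0 ρ :=
  sum_nonneg fun n _ => by positivity

lemma sz_mono {ι : Type} (pr : ι → ℕ) (hpr : ∀ i, 1 ≤ pr i) {ρ ρ' : Finset ι} (h : ρ ⊆ ρ') : sz pr ρ ≤ sz pr ρ' :=
  prod_mono_one h _ (fun i => by exact_mod_cast hpr i)

lemma gg_anti {ι : Type} (pr : ι → ℕ) (hpr : ∀ i, 1 ≤ pr i) (N0 : ℕ) (L0 : ℝ) (ρ ρ' : Finset ι) (h : ρ ⊆ ρ') :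
    gg pr N0 L0 ρ' ≤ gg pr N0 L0 ρ := by
  refine sum_le_sum fun n _ => mll ?_ (by positivity)
  have := sz_mono pr hpr h
  split_ifs with h1 h2
  · exact le_rfl
  · exact absurd (this.trans h1) h2
  · norm_num
  · exact le_rfl

lemma sz_one {ι : Type} (pr : ι → ℕ) (hpr : ∀ i, 1 ≤ pr i) (ρ : Finset ι) : 1 ≤ sz pr ρ := by
  have := sz_mono pr hpr (empty_subset ρ)
  simpa [sz] using this

lemma erase_sum {ι : Type} [Fintype ι] (f : ι → ℝ) (hf : ∀ i, 0 ≤ f i) (w : Finset ι → ℝ) (hw0 : ∀ ρ, 0 ≤ w ρ) (hw : ∀ ρ ρ', ρ ⊆ ρ' → w ρ' ≤ w ρ) (i : ι) :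
    ∑ ρ, (if i ∈ ρ then w ρ * ∏ j ∈ ρ, f j else 0) ≤ f i * ∑ ρ, w ρ * ∏ j ∈ ρ, f j := by
  rw [← sum_filter]
  have h1 : ∀ ρ ∈ univ.filter (fun ρ : Finset ι => i ∈ ρ), w ρ * ∏ j ∈ ρ, f j ≤ f i * (w (ρ.erase i) * ∏ j ∈ ρ.erase i, f j) := by
    intro ρ hρ
    have hi := (mem_filter.1 hρ).2
    rw [← mul_prod_erase ρ f hi]
    have := hw _ _ (Finset.erase_subset i ρ)
    have h3 : 0 ≤ f i * ∏ j ∈ ρ.erase i, f j := mul_nonneg (hf i) (prod_nonneg fun j _ => hf j)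
    calc _ ≤ w (ρ.erase i) * (f i * ∏ j ∈ ρ.erase i, f j) := mlr this h3
      _ = _ := by ring
  refine (sum_le_sum h1).trans ?_
  rw [← mul_sum]
  refine mll ?_ (hf i)
  rw [← sum_image (s := univ.filter (fun ρ : Finset ι => i ∈ ρ)) (g := fun ρ => ρ.erase i) (f := fun ρ => w ρ * ∏ j ∈ ρ, f j)]
  · exact sum_le_sum_of_subset_of_nonneg (subset_univ _) (fun T _ _ => mul_nonneg (hw0 _) (prod_nonneg fun l _ => hf _))
  · intro a ha b hb h
    simp only [coe_filter, mem_univ, true_and, Set.mem_setOf_eq] at ha hb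
    rw [← Finset.insert_erase ha, ← Finset.insert_erase hb]
    simp only at h
    rw [h]

section
variable {ι : Type} [Fintype ι]

lemma sum_ind (pr : ι → ℕ) (F : Finset ι → ℝ) (t : ℝ) :
    ∑ ρ, F ρ * (if sz pr ρ ≤ t then 1 else 0) = ∑ ρ ∈ setsLe pr t, F ρ := by
  unfold setsLe
  rw [sum_filter]
  refine sum_congr rfl fun ρ _ => ?_
  unfold sz
  split_ifs <;> simp

lemma gJ (pr : ι → ℕ) (F : Finset ι → ℝ) (N0 : ℕ) (L0 cS : ℝ) (hlo : ∀ n < N0, cS * (2^n * L0) ≤ ∑ ρ ∈ setsLe pr (exp (2^n * L0)), F ρ) :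
    N0 * (cS * L0) ≤ ∑ ρ, gg pr N0 L0 ρ * F ρ := by
  have : ∑ ρ, gg pr N0 L0 ρ * F ρ = ∑ n ∈ range N0, (1/2:ℝ)^n * ∑ ρ ∈ setsLe pr (exp (2^n * L0)), F ρ := by
    simp only [gg, sum_mul]
    rw [sum_comm]
    refine sum_congr rfl fun n _ => ?_
    rw [← sum_ind, mul_sum]
    exact sum_congr rfl fun ρ _ => by ring
  rw [this]
  have h2 : (N0:ℝ) * (cS * L0) = ∑ n ∈ range N0, cS * L0 := by simp
  rw [h2]
  refine sum_le_sum fun n hn => ?_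
  have := mll (hlo n (mem_range.1 hn)) (by positivity : (0:ℝ) ≤ (1/2)^n)
  refine le_trans (le_of_eq ?_) this
  have h3 : (1/2:ℝ)^n * 2^n = 1 := by rw [← mul_pow]; norm_num
  linear_combination (-(cS * L0)) * h3

lemma gg_sq (pr : ι → ℕ) (N0 : ℕ) (L0 : ℝ) (hL : 0 ≤ L0) (ρ : Finset ι) :
    gg pr N0 L0 ρ ^ 2 ≤ 4 * ∑ n ∈ range N0, (1/4:ℝ)^n * (if sz pr ρ ≤ exp (2^n * L0) then 1 else 0) := by
  refine geo_sq N0 (fun n => sz pr ρ ≤ exp (2^n * L0)) fun n h => h.trans (exp_le_exp.2 ?_)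
  exact mlr (pow_le_pow_right₀ (by norm_num) (by omega)) hL

lemma gI_le (pr : ι → ℕ) (F : Finset ι → ℝ) (hF : ∀ ρ, 0 ≤ F ρ) (N0 : ℕ) (L0 CS : ℝ) (hL : 0 ≤ L0) (hCS : 0 ≤ CS) (hhi : ∀ n < N0, ∑ ρ ∈ setsLe pr (exp (2^n * L0)), F ρ ≤ CS * (2^n * L0)) :
    ∑ ρ, gg pr N0 L0 ρ ^ 2 * F ρ ≤ 8 * CS * L0 := by
  calc ∑ ρ, gg pr N0 L0 ρ ^ 2 * F ρ ≤ ∑ ρ, (4 * ∑ n ∈ range N0, (1/4:ℝ)^n * (if sz pr ρ ≤ exp (2^n * L0) then 1 else 0)) * F ρ :=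
        sum_le_sum fun ρ _ => mlr (gg_sq pr N0 L0 hL ρ) (hF ρ)
    _ = ∑ n ∈ range N0, 4 * (1/4:ℝ)^n * ∑ ρ ∈ setsLe pr (exp (2^n * L0)), F ρ := by
        simp only [sum_mul, mul_sum]
        rw [sum_comm]
        refine sum_congr rfl fun n _ => ?_
        rw [← mul_sum, ← sum_ind, mul_sum]
        exact sum_congr rfl fun ρ _ => by ring
    _ ≤ ∑ n ∈ range N0, 4 * (CS * L0) * (1/2:ℝ)^n := by
        refine sum_le_sum fun n hn => ?_
        have := mll (hhi n (mem_range.1 hn)) (by positivity : (0:ℝ) ≤ 4 * (1/4)^n)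
        refine this.trans (le_of_eq ?_)
        have h3 : (1/4:ℝ)^n * 2^n = (1/2)^n := by rw [← mul_pow]; norm_num
        rw [← h3]; ring
    _ ≤ 8 * CS * L0 := by
        rw [← mul_sum]
        have : ∑ n ∈ range N0, (1/2:ℝ)^n ≤ 2 := by
          rw [geom_sum_eq (x := (1/2:ℝ)) (by norm_num) N0]
          have : (0:ℝ) < (1/2)^N0 := by positivity
          rw [div_le_iff_of_neg (by norm_num)]; linarith
        nlinarith [mul_nonneg hCS hL]

lemma gI_ge (pr : ι → ℕ) (F : Finset ι → ℝ) (hF : ∀ ρ, 0 ≤ F ρ) (N0 : ℕ) (hN : 1 ≤ N0) (L0 cS : ℝ) (hlo : ∀ n < N0, cS * (2^n * L0) ≤ ∑ ρ ∈ setsLe pr (exp (2^n * L0)), F ρ) :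
    cS * L0 ≤ ∑ ρ, gg pr N0 L0 ρ ^ 2 * F ρ := by
  have h := hlo 0 (by omega)
  rw [← sum_ind] at h
  simp only [pow_zero, one_mul] at h
  refine h.trans (sum_le_sum fun ρ _ => ?_)
  rw [mul_comm]
  refine mlr ?_ (hF ρ)
  have h1 : (if sz pr ρ ≤ exp L0 then (1:ℝ) else 0) ≤ gg pr N0 L0 ρ := by
    have := single_le_sum (s := range N0) (f := fun n => (1/2:ℝ)^n * (if sz pr ρ ≤ exp (2^n * L0) then (1:ℝ) else 0))
      (fun n _ => by positivity) (mem_range.2 (by omega : 0 < N0))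
    simpa only [gg, pow_zero, one_mul] using this
  split_ifs at h1 ⊢
  · nlinarith
  · positivity

lemma glog2 (pr : ι → ℕ) (hpr : ∀ i, 1 ≤ pr i) (F : Finset ι → ℝ) (hF : ∀ ρ, 0 ≤ F ρ) (N0 : ℕ) (L0 CS : ℝ) (hL : 0 ≤ L0) (hhi : ∀ n < N0, ∑ ρ ∈ setsLe pr (exp (2^n * L0)), F ρ ≤ CS * (2^n * L0)) :
    ∑ ρ, gg pr N0 L0 ρ ^ 2 * F ρ * log (sz pr ρ) ≤ 4 * N0 * CS * L0 ^ 2 := by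
  have hl0 : ∀ ρ, 1 ≤ sz pr ρ := sz_one pr hpr
  calc ∑ ρ, gg pr N0 L0 ρ ^ 2 * F ρ * log (sz pr ρ) ≤ ∑ ρ, (4 * ∑ n ∈ range N0, (1/4:ℝ)^n * (if sz pr ρ ≤ exp (2^n * L0) then 1 else 0)) * F ρ * log (sz pr ρ) :=
        sum_le_sum fun ρ _ => mlr (mlr (gg_sq pr N0 L0 hL ρ) (hF ρ)) (log_nonneg (hl0 ρ))
    _ = ∑ n ∈ range N0, ∑ ρ, 4 * (1/4:ℝ)^n * (F ρ * log (sz pr ρ) * (if sz pr ρ ≤ exp (2^n * L0) then 1 else 0)) := by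
        simp only [sum_mul, mul_sum]
        rw [sum_comm]
        refine sum_congr rfl fun n _ => ?_
        exact sum_congr rfl fun ρ _ => by ring
    _ ≤ ∑ n ∈ range N0, ∑ ρ, 4 * (1/4:ℝ)^n * (2^n * L0) * (F ρ * (if sz pr ρ ≤ exp (2^n * L0) then 1 else 0)) := by
        refine sum_le_sum fun n hn => sum_le_sum fun ρ _ => ?_
        by_cases h : sz pr ρ ≤ exp (2^n * L0)
        · simp only [h, if_true, mul_one]
          have h1 : log (sz pr ρ) ≤ 2^n * L0 := by
            rw [Real.log_le_iff_le_exp (by linarith [hl0 ρ])]; exact h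
          have h2 : (0:ℝ) ≤ 4 * (1/4)^n * F ρ := mul_nonneg (by positivity) (hF ρ)
          nlinarith [mll h1 h2]
        · simp [h]
    _ = ∑ n ∈ range N0, 4 * (1/4:ℝ)^n * (2^n * L0) * ∑ ρ ∈ setsLe pr (exp (2^n * L0)), F ρ := by
        refine sum_congr rfl fun n _ => ?_
        rw [← mul_sum, sum_ind]
    _ ≤ ∑ n ∈ range N0, 4 * CS * L0^2 := by
        refine sum_le_sum fun n hn => ?_
        have := mll (hhi n (mem_range.1 hn)) (by positivity : (0:ℝ) ≤ 4 * (1/4)^n * (2^n * L0))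
        refine this.trans (le_of_eq ?_)
        have h3 : (1/4:ℝ)^n * (2^n * 2^n) = 1 := by rw [← mul_pow, ← mul_pow]; norm_num
        linear_combination (4 * CS * L0^2) * h3
    _ = _ := by simp; ring

lemma glog1 (pr : ι → ℕ) (hpr : ∀ i, 1 ≤ pr i) (F : Finset ι → ℝ) (hF : ∀ ρ, 0 ≤ F ρ) (N0 : ℕ) (L0 : ℝ) (hL : 0 ≤ L0) :
    ∑ ρ, gg pr N0 L0 ρ * F ρ * log (sz pr ρ) ≤ 2^N0 * L0 * ∑ ρ, gg pr N0 L0 ρ * F ρ := by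
  have hl0 : ∀ ρ, 1 ≤ sz pr ρ := sz_one pr hpr
  rw [mul_sum]
  refine sum_le_sum fun ρ _ => ?_
  by_cases h : sz pr ρ ≤ exp (2^N0 * L0)
  · have h1 : log (sz pr ρ) ≤ 2^N0 * L0 := by
      rw [Real.log_le_iff_le_exp (by linarith [hl0 ρ])]; exact h
    have := mll h1 (mul_nonneg (gg_nonneg pr N0 L0 ρ) (hF ρ))
    linarith
  · have : gg pr N0 L0 ρ = 0 := by
      refine Finset.sum_eq_zero fun n hn => ?_
      rw [if_neg, mul_zero]
      intro h2
      refine h (h2.trans (exp_le_exp.2 ?_))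
      exact mlr (pow_le_pow_right₀ (by norm_num) (mem_range.1 hn).le) hL
    rw [this]; simp
end

theorem main2_lower {ι : Type} [Fintype ι] (pr : ι → ℕ) [∀ i, Fact (pr i).Prime]
    (Ω : ∀ i, Finset (ZMod (pr i))) {k : ℕ} (c : Fin k → ℤ) (m : Fin k) (hcm : ∀ i, (c m : ZMod (pr i)) = 0)
    (hc : ∀ i j, j ≠ m → (c j : ZMod (pr i)) ≠ 0) (N0 : ℕ) (hN : 1 ≤ N0) (L0 cS CS : ℝ) (hL : 0 < L0) (hcS : 0 < cS)
    (hCS : 0 < CS) (R : ℝ) (hR : 1 < R)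
    (hlo : ∀ n < N0, cS * (2^n * L0) ≤ ∑ ρ ∈ setsLe pr (exp (2^n * L0)), ∏ i ∈ ρ, finv (Ω i))
    (hhi : ∀ n < N0, ∑ ρ ∈ setsLe pr (exp (2^n * L0)), ∏ i ∈ ρ, finv (Ω i) ≤ CS * (2^n * L0))
    (hf : ((k:ℝ)+1)^2 * ∑ i, finv (Ω i) ^ 2 ≤ 1/4)
    (he : k * (4 * N0 * (CS / cS) * L0) + 2 * (2^N0 * L0) ≤ log R / 4) :
    (1/2) * ((∑ ρ, gg pr N0 L0 ρ ^ 2 * ∏ i ∈ ρ, finv (Ω i)) ^ (k-1) * (∑ ρ, gg pr N0 L0 ρ * ∏ i ∈ ρ, finv (Ω i)) ^ 2) ≤ MainT pr Ω c (zz pr (gg pr N0 L0) R) := by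
  have hone : ∀ i, 1 ≤ pr i := fun i => (Fact.out : (pr i).Prime).one_le
  set f : ι → ℝ := fun i => finv (Ω i) with hfdef
  have hf0 : ∀ i, 0 ≤ f i := fun i => finv_nonneg _
  set F : Finset ι → ℝ := fun ρ => ∏ i ∈ ρ, f i with hFdef
  have hF : ∀ ρ, 0 ≤ F ρ := fun ρ => prod_nonneg fun i _ => hf0 i
  set I1 := ∑ ρ, gg pr N0 L0 ρ ^ 2 * F ρ with hI1
  set J := ∑ ρ, gg pr N0 L0 ρ * F ρ with hJ
  have hI1ge : cS * L0 ≤ I1 := gI_ge pr F hF N0 hN L0 cS hlo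
  have hI1pos : 0 < I1 := lt_of_lt_of_le (mul_pos hcS hL) hI1ge
  have hJ0 : 0 ≤ J := sum_nonneg fun ρ _ => mul_nonneg (gg_nonneg _ _ _ _) (hF ρ)
  set w : Option (Fin k) → Finset ι → ℝ := fun l ρ => (match l with
    | none => gg pr N0 L0 ρ
    | some j => if j = m then gg pr N0 L0 ρ else gg pr N0 L0 ρ ^ 2) with hw
  have hw0 : ∀ l ρ, 0 ≤ w l ρ := by
    intro l ρ
    have := gg_nonneg pr N0 L0 ρ
    rcases l with _ | j
    · exact this
    · simp only [hw]; split_ifs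
      · exact this
      · positivity
  have hwa : ∀ l ρ ρ', ρ ⊆ ρ' → w l ρ' ≤ w l ρ := by
    intro l ρ ρ' h
    have h0 := gg_nonneg pr N0 L0 ρ'
    have := gg_anti pr hone N0 L0 ρ ρ' h
    rcases l with _ | j
    · exact this
    · simp only [hw]; split_ifs
      · exact this
      · exact pow_le_pow_left₀ h0 this 2
  have huw : ∀ l ρ, uu f (gg pr N0 L0) m l ρ = w l ρ * F ρ := fun l ρ => rfl
  have hs : ∀ l, ∑ ρ, uu f (gg pr N0 L0) m l ρ = match l with
      | none => J
      | some j => if j = m then J else I1 := by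
    intro l
    simp only [huw]
    rcases l with _ | j
    · rfl
    · by_cases hj : j = m <;> simp only [hw, hj, if_true, if_false] <;> rfl
  set e : Option (Fin k) → ℝ := fun l => match l with
    | none => 2^N0 * L0
    | some j => if j = m then 2^N0 * L0 else 4 * N0 * (CS / cS) * L0 with he'
  have heA : (0:ℝ) ≤ 4 * N0 * (CS / cS) * L0 := by positivity
  have key := tuple_lower pr hone (uu f (gg pr N0 L0) m) (fun l ρ => by rw [huw]; exact mul_nonneg (hw0 l ρ) (hF ρ))
    f hf0 e (fun l => by
      rcases l with _ | j
      · simp only [he']; positivity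
      · simp only [he']; split_ifs <;> positivity)
    (fun l i => by simp only [huw]; exact erase_sum f hf0 (w l) (hw0 l) (hwa l) i)
    (fun l => by
      rw [hs l]
      simp only [huw]
      have A1 := glog1 pr hone F hF N0 L0 hL.le
      have A2 : ∑ ρ, gg pr N0 L0 ρ ^ 2 * F ρ * log (sz pr ρ) ≤ 4 * N0 * (CS / cS) * L0 * I1 := by
        refine (glog2 pr hone F hF N0 L0 CS hL.le hhi).trans ?_
        have : 4 * N0 * CS * L0 ^ 2 = 4 * N0 * (CS / cS) * L0 * (cS * L0) := by field_simp
        rw [this]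
        exact mll hI1ge heA
      rcases l with _ | j
      · exact A1
      · by_cases hj : j = m
        · simp only [hw, he', hj, if_true]; exact A1
        · simp only [hw, he', hj, if_false]; exact A2) R hR
  have hprod : ∏ l, ∑ ρ, uu f (gg pr N0 L0) m l ρ = I1 ^ (k-1) * J ^ 2 := by
    simp only [hs]
    rw [prod_option]
    simp only
    rw [← mul_prod_erase univ _ (mem_univ m)]
    rw [prod_congr rfl (g := fun _ => I1) (fun j hj => by simp [ne_of_mem_erase hj])]
    simp; ring
  have hesum : ∑ l, e l ≤ k * (4 * N0 * (CS / cS) * L0) + 2 * (2^N0 * L0) := by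
    rw [sum_option]
    simp only [he']
    rw [← Finset.add_sum_erase univ _ (mem_univ m)]
    rw [sum_congr rfl (g := fun _ => 4 * N0 * (CS / cS) * L0) (fun j hj => by simp [ne_of_mem_erase hj])]
    simp only [if_true, sum_const, nsmul_eq_mul, card_erase_of_mem (mem_univ m), card_univ, Fintype.card_fin]
    have : ((k-1:ℕ):ℝ) ≤ k := by exact_mod_cast Nat.sub_le k 1
    nlinarith
  rw [hprod] at key
  refine le_trans (le_trans ?_ key) (main2_ge pr Ω c m hcm hc (gg pr N0 L0) R (gg_nonneg pr N0 L0))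
  refine mlr ?_ (by positivity)
  have hlogR : 0 < log R := log_pos hR
  have h1 : (∑ l, e l) / log R ≤ 1/4 := by
    rw [div_le_iff₀ hlogR]; linarith
  have h2 : (Fintype.card (Option (Fin k)) : ℝ) ^ 2 * ∑ i, f i ^ 2 ≤ 1/4 := by
    simp only [Fintype.card_option, Fintype.card_fin, Nat.cast_add, Nat.cast_one]
    exact hf
  linarith

lemma WW_shift {ι : Type} [Fintype ι] (pr : ι → ℕ) [∀ i, Fact (pr i).Prime]
    (Ω : ∀ i, Finset (ZMod (pr i))) {k : ℕ} (c c' : Fin k → ℤ) (z : (ι → Option (Fin k)) → ℝ) (r r' q : ℤ)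
    (h : ∀ j, r + c j * q = r' + c' j * q) : WW pr Ω c z r q = WW pr Ω c' z r' q := by
  unfold WW
  refine sum_congr rfl fun σ _ => ?_
  congr 1
  refine prod_congr rfl fun i _ => ?_
  rcases σ i with _ | j
  · rfl
  · simp only [Vo]
    congr 1
    exact_mod_cast congrArg (Int.cast : ℤ → ZMod (pr i)) (h j)

lemma cast_ne {p : ℕ} [Fact p.Prime] {t : ℤ} (h0 : t ≠ 0) (h : |t| < p) : (t : ZMod p) ≠ 0 := by
  intro hz
  rw [ZMod.intCast_zmod_eq_zero_iff_dvd] at hz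
  exact h0 (Int.eq_zero_of_abs_lt_dvd hz h)

set_option maxHeartbeats 1000000 in
theorem coreA {ι : Type} [Fintype ι] (pr : ι → ℕ) [∀ i, Fact (pr i).Prime]
    (hinj : Function.Injective pr) (Ω : ∀ i, Finset (ZMod (pr i)))
    (hΩ : ∀ i, (Ω i).card ≤ 2) (hpr : ∀ i, 128 ≤ pr i) (k : ℕ) (hk : 1 ≤ k) (hkp : ∀ i, k + 1 < pr i)
    (K : ℕ) (A B : Finset ℤ) (hA : A.Nonempty) (hB : B.Nonempty) (N X : ℕ)
    (hAI : ∀ r ∈ A, 0 ≤ r ∧ r < N) (hBI : ∀ q ∈ B, 0 ≤ q ∧ q < X)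
    (hAΩ : ∀ r ∈ A, ∀ i, (r : ZMod (pr i)) ∉ Ω i) (hB0 : ∀ q ∈ B, ∀ i, (q : ZMod (pr i)) ≠ 0)
    (R : ℝ) (hR : 1 < R) (hRN : 2 * R ^ 18 ≤ N) (CA CB : ℝ) (hCA2 : 2 ≤ CA)
    (hCA : (N + 2 * R ^ 18 : ℝ) ≤ CA * A.card * ∑ s ∈ setsLe pr R, ∏ i ∈ s, finv (Ω i))
    (hCB : (X + 2 * R ^ 18 : ℝ) ≤ CB * B.card * ∑ s ∈ setsLe pr R, ∏ i ∈ s, finv ({0} : Finset (ZMod (pr i))))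
    (s : ℝ) (hs : 0 < s) (hs1 : s ≤ 1) (hs2 : ∀ i, ((k:ℝ) + 1) ^ 2 * 44 ≤ s * √(pr i))
    (hs3 : ∑ i, ((k:ℝ) + 1) ^ 2 * (116 / (pr i * √(pr i))) ≤ s)
    (hsC : (3/2) * s * (CA + CB) ≤ 1/2)
    (N0 : ℕ) (hN : 1 ≤ N0) (L0 cS CS : ℝ) (hL : 0 < L0) (hcS : 0 < cS) (hCS : 0 < CS)
    (hlo : ∀ n < N0, cS * (2^n * L0) ≤ ∑ ρ ∈ setsLe pr (exp (2^n * L0)), ∏ i ∈ ρ, finv (Ω i))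
    (hhi : ∀ n < N0, ∑ ρ ∈ setsLe pr (exp (2^n * L0)), ∏ i ∈ ρ, finv (Ω i) ≤ CS * (2^n * L0))
    (hf : ((k:ℝ)+1)^2 * ∑ i, finv (Ω i) ^ 2 ≤ 1/4)
    (he : k * (4 * N0 * (CS / cS) * L0) + 2 * (2^N0 * L0) ≤ log R / 4)
    (hfin : 6 * K * ((N:ℝ) + k * X) * (8 * CS * L0) < k * A.card * (N0 * (cS * L0)) ^ 2) :
    ∃ q ∈ B, ∃ n : ℤ, K ≤ (univ.filter fun j : Fin k => n + ((j:ℕ) + 1 : ℤ) * q ∈ A).card := by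
  by_contra hcon
  push Not at hcon
  have hone : ∀ i, 1 ≤ pr i := fun i => (Fact.out : (pr i).Prime).one_le
  set z := zz (k := k) pr (gg pr N0 L0) R with hz
  have hzg : GoodZ pr R z := zz_good pr hone (gg pr N0 L0) R (gg_nonneg pr N0 L0) (gg_anti pr hone N0 L0)
  set F : Finset ι → ℝ := fun ρ => ∏ i ∈ ρ, finv (Ω i) with hFdef
  have hF : ∀ ρ, 0 ≤ F ρ := fun ρ => prod_nonneg fun i _ => finv_nonneg _
  set I1 := ∑ ρ, gg pr N0 L0 ρ ^ 2 * F ρ with hI1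
  set J := ∑ ρ, gg pr N0 L0 ρ * F ρ with hJ
  have hI1ge : cS * L0 ≤ I1 := gI_ge pr F hF N0 hN L0 cS hlo
  have hI1pos : 0 < I1 := lt_of_lt_of_le (mul_pos hcS hL) hI1ge
  have hI1le : I1 ≤ 8 * CS * L0 := gI_le pr F hF N0 L0 CS hL.le hCS.le hhi
  have hJge : N0 * (cS * L0) ≤ J := gJ pr F N0 L0 cS hlo
  set I : Finset ℤ := Ico (-((k * X : ℕ):ℤ)) N with hI
  have hIcard : (I.card : ℝ) = N + k * X := by
    rw [hI, Int.card_Ico]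
    have : ((N:ℤ) - -((k * X : ℕ):ℤ)).toNat = N + k * X := by push_cast; omega
    rw [this]; push_cast; ring
  have hNpos : (0:ℝ) < N := lt_of_lt_of_le (by positivity) hRN
  have hINe : I.Nonempty := by
    rw [← card_pos]
    have : (0:ℝ) < I.card := by rw [hIcard]; positivity
    exact_mod_cast this
  set c1 : Fin k → ℤ := fun j => (j:ℕ) + 1 with hc1
  have hcinj : ∀ (d : ℤ) i, Function.Injective fun j : Fin k => (((j:ℕ) + d : ℤ) : ZMod (pr i)) := by
    intro d i j j' h
    by_contra hne
    have h2 : ((((j:ℕ):ℤ) - ((j':ℕ):ℤ) : ℤ) : ZMod (pr i)) = 0 := by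
      simp only [Int.cast_add] at h
      push_cast
      have h3 := add_right_cancel h
      push_cast at h3
      rw [h3, sub_self]
    refine cast_ne ?_ ?_ h2
    · intro h; exact hne (Fin.ext (by omega))
    · have := hkp i; have := j.2; have := j'.2
      rw [abs_lt]; omega
  have hc1ne : ∀ i j, (c1 j : ZMod (pr i)) ≠ 0 := by
    intro i j
    refine cast_ne ?_ ?_
    · simp only [hc1]; omega
    · have := hkp i; have := j.2
      simp only [hc1]; rw [abs_lt]; omega
  have hcard0 : (0:ℝ) < A.card := by exact_mod_cast hA.card_pos
  have hcardB : (0:ℝ) < B.card := by exact_mod_cast hB.card_pos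
  have hBI' : ∀ r ∈ B, ∃ j < X, r = 0 + (j : ℤ) := fun r hr => ⟨r.toNat, by have := hBI r hr; omega, by have := hBI r hr; omega⟩

  have S1 := sumW pr hinj Ω (fun _ => ∅) hΩ hpr (fun i => empty_subset _) c1 (hcinj 1)
    (fun i j h => absurd h (hc1ne i j)) I B hINe hB (fun r _ i => by simp) hB0 (-((k * X : ℕ):ℤ)) 0 (N + k * X) X
    (fun r hr => ⟨(r + (k * X : ℕ)).toNat, by rw [hI, mem_Ico] at hr; push_cast at hr ⊢; omega, by rw [hI, mem_Ico] at hr; push_cast at hr ⊢; omega⟩)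
    hBI' R hR.le z hzg CA CB (by
      have h1 : (1:ℝ) ≤ ∑ s ∈ setsLe pr R, ∏ i ∈ s, finv (∅ : Finset (ZMod (pr i))) := by
        have := single_le_sum (s := setsLe pr R) (f := fun s => ∏ i ∈ s, finv (∅ : Finset (ZMod (pr i))))
          (fun s _ => prod_nonneg fun i _ => finv_nonneg _) (a := ∅) (by simp [setsLe, hR.le])
        simpa using this
      rw [hIcard]; push_cast
      have h2 : (0:ℝ) ≤ k * X := by positivity
      calc ((N:ℝ) + k * X + 2 * R^18) ≤ 2 * (N + k * X) := by linarith
        _ ≤ CA * (N + k * X) := mlr hCA2 (by positivity)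
        _ ≤ CA * (N + k * X) * _ := le_mul_of_one_le_right (by positivity) h1) hCB s hs hs1 hs2 hs3
  have M1 : MainT pr Ω c1 z ≤ I1 ^ k := main1_le pr Ω c1 hc1ne (gg pr N0 L0) R (gg_nonneg pr N0 L0)
  have M10 : 0 ≤ MainT pr Ω c1 z := sum_nonneg fun π _ => mul_nonneg (mul_nonneg (hzg.nonneg _) (hzg.nonneg _))
    (prod_nonneg fun i _ => dd_nonneg _ _ _)
  have hS1 : ∑ r ∈ I, ∑ q ∈ B, WW pr Ω c1 z r q ^ 2 ≤ (3/2) * ((N + k * X) * B.card * I1 ^ k) := by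
    have h1 := (abs_le.1 S1).2
    have h0 : 0 ≤ I.card * B.card * MainT pr Ω c1 z := by positivity
    have h2 := mlr hsC h0
    have h3 : I.card * B.card * MainT pr Ω c1 z ≤ (N + k * X) * B.card * I1 ^ k := by
      rw [hIcard]; exact mll M1 (by positivity)
    linarith

  have hS2 : ∀ m : Fin k, (1/4) * (A.card * B.card * (I1 ^ (k-1) * J ^ 2)) ≤ ∑ r ∈ A, ∑ q ∈ B, WW pr Ω c1 z (r - ((m:ℕ)+1:ℤ) * q) q ^ 2 := by
    intro m
    set c2 : Fin k → ℤ := fun j => (j:ℕ) + (-(m:ℕ) : ℤ) with hc2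
    have e1 : ∀ r q, WW pr Ω c1 z (r - ((m:ℕ)+1:ℤ) * q) q = WW pr Ω c2 z r q := fun r q =>
      WW_shift pr Ω c1 c2 z _ _ q (fun j => by simp only [hc1, hc2]; ring)
    simp only [e1]
    have S2 := sumW pr hinj Ω Ω hΩ hpr (fun i => subset_rfl) c2 (hcinj _)
      (fun i j h => rfl) A B hA hB hAΩ hB0 0 0 N X
      (fun r hr => ⟨r.toNat, by have := hAI r hr; omega, by have := hAI r hr; omega⟩)
      hBI' R hR.le z hzg CA CB hCA hCB s hs hs1 hs2 hs3
    have M2 := main2_lower pr Ω c2 m (fun i => by simp [hc2]) (fun i j hj => cast_ne (by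
        simp only [hc2]; intro h; exact hj (Fin.ext (by omega))) (by
        have := hkp i; have := j.2; have := m.2
        simp only [hc2]; rw [abs_lt]; omega)) N0 hN L0 cS CS hL hcS hCS R hR hlo hhi hf he
    have h0 : 0 ≤ A.card * B.card * MainT pr Ω c2 z := mul_nonneg (by positivity) (le_trans (by positivity) M2)
    have h1 := (abs_le.1 S2).1
    have h2 := mlr hsC h0
    have h3 := mll M2 (by positivity : (0:ℝ) ≤ A.card * B.card)
    linarith

  have hcomb : ∑ m : Fin k, ∑ r ∈ A, ∑ q ∈ B, WW pr Ω c1 z (r - ((m:ℕ)+1:ℤ) * q) q ^ 2 ≤ K * ∑ r ∈ I, ∑ q ∈ B, WW pr Ω c1 z r q ^ 2 := by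
    have e1 : ∀ m : Fin k, ∀ q ∈ B, ∑ r ∈ A, WW pr Ω c1 z (r - ((m:ℕ)+1:ℤ) * q) q ^ 2 ≤
        ∑ n ∈ I, if n + ((m:ℕ)+1:ℤ) * q ∈ A then WW pr Ω c1 z n q ^ 2 else 0 := by
      intro m q hq
      rw [← sum_filter]
      rw [← sum_image (s := A) (g := fun r => r - ((m:ℕ)+1:ℤ) * q) (f := fun n => WW pr Ω c1 z n q ^ 2)
        (fun a _ b _ h => by simpa using h)]
      refine sum_le_sum_of_subset_of_nonneg ?_ (fun _ _ _ => sq_nonneg _)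
      intro n hn
      rw [mem_image] at hn
      obtain ⟨r, hr, rfl⟩ := hn
      rw [mem_filter]
      refine ⟨?_, by simpa using hr⟩
      rw [hI, mem_Ico]
      have h1 := hAI r hr
      have h2 := hBI q hq
      have h3 : ((m:ℕ)+1:ℤ) * q ≤ k * X := mul_le_mul (by have := m.2; omega) h2.2.le h2.1 (by positivity)
      have h4 : 0 ≤ ((m:ℕ)+1:ℤ) * q := mul_nonneg (by positivity) h2.1
      push_cast
      constructor <;> linarith
    calc ∑ m : Fin k, ∑ r ∈ A, ∑ q ∈ B, WW pr Ω c1 z (r - ((m:ℕ)+1:ℤ) * q) q ^ 2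
        = ∑ m : Fin k, ∑ q ∈ B, ∑ r ∈ A, WW pr Ω c1 z (r - ((m:ℕ)+1:ℤ) * q) q ^ 2 :=
          sum_congr rfl fun m _ => sum_comm
      _ ≤ ∑ m : Fin k, ∑ q ∈ B, ∑ n ∈ I, if n + ((m:ℕ)+1:ℤ) * q ∈ A then WW pr Ω c1 z n q ^ 2 else 0 :=
          sum_le_sum fun m _ => sum_le_sum fun q hq => e1 m q hq
      _ = ∑ q ∈ B, ∑ n ∈ I, ∑ m : Fin k, if n + ((m:ℕ)+1:ℤ) * q ∈ A then WW pr Ω c1 z n q ^ 2 else 0 := by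
          rw [sum_comm]
          exact sum_congr rfl fun q _ => sum_comm
      _ ≤ ∑ q ∈ B, ∑ n ∈ I, K * WW pr Ω c1 z n q ^ 2 := by
          refine sum_le_sum fun q hq => sum_le_sum fun n _ => ?_
          rw [← sum_filter, sum_const, nsmul_eq_mul]
          have := (hcon q hq n).le
          exact mlr (by exact_mod_cast this) (sq_nonneg _)
      _ = _ := by
          rw [sum_comm, mul_sum]
          exact sum_congr rfl fun n _ => by rw [mul_sum]
  have hsum : (k:ℝ) * ((1/4) * (A.card * B.card * (I1 ^ (k-1) * J ^ 2))) ≤ K * ((3/2) * ((N + k * X) * B.card * I1 ^ k)) := by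
    calc (k:ℝ) * ((1/4) * (A.card * B.card * (I1 ^ (k-1) * J ^ 2))) = ∑ m : Fin k, (1/4) * (A.card * B.card * (I1 ^ (k-1) * J ^ 2)) := by simp
      _ ≤ _ := sum_le_sum fun m _ => hS2 m
      _ ≤ _ := hcomb
      _ ≤ _ := mll hS1 (by positivity)
  have hpow : I1 ^ k = I1 ^ (k-1) * I1 := by rw [← pow_succ]; congr 1; omega
  rw [hpow] at hsum
  have hP : 0 < B.card * I1 ^ (k-1) := by positivity
  have h5 : (k:ℝ) * A.card * J^2 ≤ 6 * K * (N + k * X) * I1 := by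
    have : (B.card * I1 ^ (k-1)) * ((k:ℝ) * A.card * J^2) ≤ (B.card * I1 ^ (k-1)) * (6 * K * (N + k * X) * I1) := by
      linarith
    exact lml this hP
  have h6 : (k:ℝ) * A.card * (N0 * (cS * L0)) ^ 2 ≤ k * A.card * J^2 :=
    mll (pow_le_pow_left₀ (by positivity) hJge 2) (by positivity)
  have h7 : 6 * K * ((N:ℝ) + k * X) * I1 ≤ 6 * K * (N + k * X) * (8 * CS * L0) :=
    mll hI1le (by positivity)
  linarith

noncomputable def nhom (σ : ℝ) : ℕ →* ℝ where
  toFun n := ((n:ℝ) ^ σ)⁻¹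
  map_one' := by simp
  map_mul' a b := by
    rw [Nat.cast_mul, Real.mul_rpow (by positivity) (by positivity), mul_inv]

lemma fac_sum_le (σ : ℝ) (hσ : 0 < σ) (P S : Finset ℕ) (hP : ∀ p ∈ P, p.Prime) (hS : ∀ n ∈ S, n ≠ 0 ∧ ∀ p, p.Prime → p ∣ n → p ∈ P) :
    ∑ n ∈ S, ((n:ℝ) ^ σ)⁻¹ ≤ ∏ p ∈ P, (1 - ((p:ℝ) ^ σ)⁻¹)⁻¹ := by
  have key := EulerProduct.summable_and_hasSum_factoredNumbers_prod_filter_prime_geometric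
    (f := nhom σ) (fun {p} hp => by
      change ‖((p:ℝ) ^ σ)⁻¹‖ < 1
      rw [Real.norm_of_nonneg (by positivity)]
      exact inv_lt_one_of_one_lt₀ (one_lt_rpow (by exact_mod_cast hp.one_lt) hσ)) P
  have hP' : P.filter Nat.Prime = P := Finset.filter_true_of_mem hP
  rw [hP'] at key
  have h2 := key.2
  change HasSum (fun m : factoredNumbers P => (((m:ℕ):ℝ) ^ σ)⁻¹) (∏ p ∈ P, (1 - ((p:ℝ) ^ σ)⁻¹)⁻¹) at h2
  have hmem : ∀ n ∈ S, n ∈ factoredNumbers P := by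
    intro n hn
    rw [Nat.mem_factoredNumbers]
    refine ⟨(hS n hn).1, fun p hp => ?_⟩
    have := Nat.prime_of_mem_primeFactorsList hp
    exact (hS n hn).2 p this (Nat.dvd_of_mem_primeFactorsList hp)
  set S' : Finset (factoredNumbers P) := S.attach.image (fun n => ⟨n.1, hmem n.1 n.2⟩) with hS'
  have h3 := sum_le_hasSum S' (fun m _ => by positivity) h2
  refine le_trans (le_of_eq ?_) h3
  rw [hS', sum_image (fun a _ b _ h => Subtype.ext (by simpa using h))]
  exact (Finset.sum_attach S (fun n => ((n:ℝ) ^ σ)⁻¹)).symm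

lemma fac_sum_one (P S : Finset ℕ) (hP : ∀ p ∈ P, p.Prime) (hS : ∀ n ∈ S, n ≠ 0 ∧ ∀ p, p.Prime → p ∣ n → p ∈ P) :
    ∑ n ∈ S, (1:ℝ) / n ≤ ∏ p ∈ P, (1 - 1 / (p:ℝ))⁻¹ := by
  have := fac_sum_le 1 one_pos P S hP hS
  simpa [rpow_one] using this

noncomputable def Pr (t : ℝ) : Finset ℕ := (range (⌊t⌋₊ + 1)).filter Nat.Prime

lemma mem_Pr {t : ℝ} (ht : 0 ≤ t) {p : ℕ} : p ∈ Pr t ↔ p.Prime ∧ (p:ℝ) ≤ t := by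
  simp only [Pr, mem_filter, mem_range, lt_succ_iff, le_floor_iff ht]
  tauto

lemma log_le_harm (t : ℝ) (ht : 1 ≤ t) : log t ≤ ∑ n ∈ Icc 1 ⌊t⌋₊, (1:ℝ) / n := by
  have h := log_add_one_le_harmonic ⌊t⌋₊
  rw [harmonic_eq_sum_Icc] at h
  push_cast at h
  have h2 : log t ≤ log (⌊t⌋₊ + 1) := log_le_log (by linarith) (Nat.lt_floor_add_one t).le
  refine h2.trans (le_trans h (le_of_eq ?_))
  exact sum_congr rfl fun n _ => by simp

lemma pinv_pos {p : ℕ} (hp : p.Prime) : 1 ≤ (1 - 1 / (p:ℝ))⁻¹ := by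
  have : (2:ℝ) ≤ p := by exact_mod_cast hp.two_le
  have h1 : 0 < 1 - 1 / (p:ℝ) := by rw [sub_pos, div_lt_one (by linarith)]; linarith
  rw [one_le_inv₀ h1]
  have : 0 < 1 / (p:ℝ) := by positivity
  linarith

lemma pinv_eq {p : ℕ} (hp : p.Prime) : 1 / (p:ℝ) * (1 - 1 / (p:ℝ))⁻¹ = 1 / ((p:ℝ) - 1) := by
  have : (2:ℝ) ≤ p := by exact_mod_cast hp.two_le
  have h1 : (p:ℝ) - 1 ≠ 0 := by linarith
  field_simp

lemma log_le_split (t : ℝ) (ht : 1 ≤ t) (Q : Finset ℕ) (hQ : Q ⊆ Pr t) :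
    log t ≤ (∏ p ∈ Pr t \ Q, (1 - 1 / (p:ℝ))⁻¹) *
      ∑ s ∈ Q.powerset.filter (fun s : Finset ℕ => ∏ p ∈ s, (p:ℝ) ≤ t), ∏ p ∈ s, 1 / ((p:ℝ) - 1) := by
  refine (log_le_harm t ht).trans ?_
  have hPrp : ∀ p ∈ Pr t, p.Prime := fun p hp => ((mem_Pr (by linarith)).1 hp).1
  set F := Q.powerset.filter (fun s : Finset ℕ => ∏ p ∈ s, (p:ℝ) ≤ t) with hF
  set sn : ℕ → Finset ℕ := fun n => n.primeFactors ∩ Q with hsn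
  have hprd : ∀ n, ∏ p ∈ sn n, p ∣ n := fun n =>
    (Finset.prod_dvd_prod_of_subset _ _ _ Finset.inter_subset_left).trans (Nat.prod_primeFactors_dvd n)
  have hmaps : ∀ n ∈ Icc 1 ⌊t⌋₊, sn n ∈ F := by
    intro n hn
    rw [mem_Icc] at hn
    rw [hF, mem_filter, mem_powerset]
    refine ⟨inter_subset_right, ?_⟩
    have h1 : ∏ p ∈ sn n, p ≤ n := le_of_dvd (by omega) (hprd n)
    have h2 : (n:ℝ) ≤ t := (le_floor_iff (by linarith)).1 hn.2
    calc (∏ p ∈ sn n, (p:ℝ)) = ((∏ p ∈ sn n, p : ℕ) : ℝ) := by push_cast; rfl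
      _ ≤ n := by exact_mod_cast h1
      _ ≤ t := h2
  rw [← sum_fiberwise_of_maps_to hmaps, mul_sum]
  refine sum_le_sum fun s hs => ?_
  rw [hF, mem_filter, mem_powerset] at hs
  have hsp : ∀ p ∈ s, p.Prime := fun p hp => hPrp p (hQ (hs.1 hp))
  have hd0 : 0 < ∏ p ∈ s, p := prod_pos fun p hp => (hsp p hp).pos
  set d := ∏ p ∈ s, p with hd
  set Fib := (Icc 1 ⌊t⌋₊).filter (fun n => sn n = s) with hFib
  have hfd : ∀ n ∈ Fib, d ∣ n := by
    intro n hn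
    rw [hFib, mem_filter] at hn
    rw [hd, ← hn.2]; exact hprd n
  have h1 : ∑ n ∈ Fib, (1:ℝ)/n = 1/d * ∑ m ∈ Fib.image (fun n => n / d), (1:ℝ)/m := by
    rw [sum_image, mul_sum]
    · refine sum_congr rfl fun n hn => ?_
      rw [Nat.cast_div (hfd n hn) (by positivity)]
      have : (d:ℝ) ≠ 0 := by positivity
      rw [one_div_div]; field_simp
    · intro a ha b hb h
      have := hfd a ha; have := hfd b hb
      simp only at h
      rw [← Nat.div_mul_cancel (hfd a ha), ← Nat.div_mul_cancel (hfd b hb), h]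
  rw [h1]
  have h2 : ∑ m ∈ Fib.image (fun n => n / d), (1:ℝ)/m ≤ ∏ p ∈ (Pr t \ Q) ∪ s, (1 - 1/(p:ℝ))⁻¹ := by
    refine fac_sum_one _ _ ?_ ?_
    · intro p hp
      rcases mem_union.1 hp with h | h
      · exact hPrp p (Finset.mem_sdiff.1 h).1
      · exact hsp p h
    · intro m hm
      rw [mem_image] at hm
      obtain ⟨n, hn, rfl⟩ := hm
      have hdn := hfd n hn
      rw [hFib, mem_filter, mem_Icc] at hn
      refine ⟨(Nat.div_pos (le_of_dvd (by omega) hdn) hd0).ne', fun p hp hpd => ?_⟩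
      have hpn : p ∣ n := hpd.trans (Nat.div_dvd_of_dvd hdn)
      have hpt : p ∈ Pr t := (mem_Pr (by linarith)).2 ⟨hp, le_trans (by exact_mod_cast le_of_dvd (by omega) hpn) ((le_floor_iff (by linarith)).1 hn.1.2)⟩
      rw [mem_union, Finset.mem_sdiff]
      by_cases hpQ : p ∈ Q
      · right
        rw [← hn.2, hsn, mem_inter, mem_primeFactors]
        exact ⟨⟨hp, hpn, by omega⟩, hpQ⟩
      · exact Or.inl ⟨hpt, hpQ⟩
  have h3 : ∏ p ∈ (Pr t \ Q) ∪ s, (1 - 1/(p:ℝ))⁻¹ = (∏ p ∈ Pr t \ Q, (1 - 1/(p:ℝ))⁻¹) * ∏ p ∈ s, (1 - 1/(p:ℝ))⁻¹ := by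
    refine prod_union ?_
    exact disjoint_left.2 fun p hp hps => (Finset.mem_sdiff.1 hp).2 (hs.1 hps)
  rw [h3] at h2
  have h4 := mll h2 (by positivity : (0:ℝ) ≤ 1/d)
  refine h4.trans (le_of_eq ?_)
  rw [mul_left_comm]
  congr 1
  rw [prod_congr rfl (fun p hp => (pinv_eq (hsp p hp)).symm), prod_mul_distrib, hd]
  push_cast
  rw [Finset.prod_div_distrib, Finset.prod_const_one]

noncomputable def VV (t : ℝ) : ℝ := ∏ p ∈ Pr t, (1 - 1 / (p:ℝ))⁻¹

lemma log_le_VV (t : ℝ) (ht : 1 ≤ t) : log t ≤ VV t := by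
  have := log_le_split t ht ∅ (empty_subset _)
  refine this.trans (le_of_eq ?_)
  simp [VV, Finset.filter_singleton, ht]

lemma sum_logp (t : ℝ) (ht : 1 ≤ t) : ∑ p ∈ Pr t, log p / p ≤ 2 * log t := by
  set n := ⌊t⌋₊ with hn
  have hn1 : 1 ≤ n := Nat.one_le_floor_iff _ |>.2 ht
  have hnt : (n:ℝ) ≤ t := floor_le (by linarith)
  have h1 : ∑ p ∈ Pr t, log p * ((n / p : ℕ):ℝ) ≤ n * log t := by
    calc ∑ p ∈ Pr t, log p * ((n / p : ℕ):ℝ)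
        = ∑ p ∈ Pr t, ∑ m ∈ Ioc 0 n, if p ∣ m then ArithmeticFunction.vonMangoldt p else 0 := by
          refine sum_congr rfl fun p hp => ?_
          have hpp := ((mem_Pr (by linarith)).1 hp).1
          rw [← sum_filter, sum_const, Nat.Ioc_filter_dvd_card_eq_div, nsmul_eq_mul,
            ArithmeticFunction.vonMangoldt_apply_prime hpp, mul_comm]
      _ = ∑ m ∈ Ioc 0 n, ∑ p ∈ Pr t, if p ∣ m then ArithmeticFunction.vonMangoldt p else 0 := sum_comm
      _ ≤ ∑ m ∈ Ioc 0 n, ∑ d ∈ m.divisors, ArithmeticFunction.vonMangoldt d := by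
          refine sum_le_sum fun m hm => ?_
          rw [← sum_filter]
          refine sum_le_sum_of_subset_of_nonneg ?_ (fun _ _ _ => ArithmeticFunction.vonMangoldt_nonneg)
          intro p hp
          rw [mem_filter] at hp
          rw [Nat.mem_divisors]
          exact ⟨hp.2, by have := mem_Ioc.1 hm; omega⟩
      _ ≤ ∑ m ∈ Ioc 0 n, log t := by
          refine sum_le_sum fun m hm => ?_
          rw [ArithmeticFunction.vonMangoldt_sum]
          have := mem_Ioc.1 hm
          exact log_le_log (by exact_mod_cast this.1) (le_trans (by exact_mod_cast this.2) hnt)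
      _ = n * log t := by simp
  have h2 : ∀ p ∈ Pr t, (n:ℝ) * (log p / p) ≤ 2 * (log p * ((n / p : ℕ):ℝ)) := by
    intro p hp
    have hpp := ((mem_Pr (by linarith)).1 hp)
    have hp0 : (0:ℝ) < p := by exact_mod_cast hpp.1.pos
    have hpn : p ≤ n := (le_floor_iff (by linarith)).2 hpp.2
    have h3 : n < 2 * (p * (n / p)) := by
      have h4 := div_add_mod n p
      have h5 := mod_lt n hpp.1.pos
      have h6 : p ≤ p * (n/p) := Nat.le_mul_of_pos_right p (Nat.div_pos hpn hpp.1.pos)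
      omega
    have h3' : (n:ℝ) ≤ 2 * (p * ((n/p:ℕ):ℝ)) := by exact_mod_cast h3.le
    have hl : 0 ≤ log p / p := div_nonneg (log_nonneg (by exact_mod_cast hpp.1.one_le)) hp0.le
    have := mlr h3' hl
    refine this.trans (le_of_eq ?_)
    field_simp
  have h3 := sum_le_sum h2
  rw [← mul_sum, ← mul_sum] at h3
  have hn0 : (0:ℝ) < n := by exact_mod_cast hn1
  have : (n:ℝ) * ∑ p ∈ Pr t, log p / p ≤ n * (2 * log t) := by linarith
  exact lml this hn0

lemma zeta_partial (a : ℝ) (ha : 0 < a) (N : ℕ) :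
    ∑ n ∈ Icc 1 (N+1), ((n:ℝ) ^ (1 + a))⁻¹ ≤ 1 + (1/a) * (1 - ((N+1:ℕ):ℝ) ^ (-a)) := by
  induction N with
  | zero => simp
  | succ N ih =>
    rw [Finset.sum_Icc_succ_top (by omega)]
    set X : ℝ := ((N+1+1:ℕ):ℝ) with hX
    have hXN : ((N+1:ℕ):ℝ) = X - 1 := by rw [hX]; push_cast; ring
    have hX2 : 2 ≤ X := by rw [hX]; push_cast; linarith [(cast_nonneg N : (0:ℝ) ≤ N)]
    rw [hXN] at ih
    have h1 : X ^ (-a) * (1 + a / X) ≤ (X - 1) ^ (-a) := by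
      have e1 : (X - 1) ^ (-a) = X ^ (-a) * (1 - 1/X) ^ (-a) := by
        rw [← Real.mul_rpow (by linarith) (by rw [sub_nonneg, div_le_one (by linarith)]; linarith)]
        congr 1; field_simp
      rw [e1]
      refine mll ?_ (by positivity)
      have h2 : 0 < 1 - 1/X := by rw [sub_pos, div_lt_one (by linarith)]; linarith
      rw [rpow_def_of_pos h2]
      have h3 : log (1 - 1/X) ≤ - (1/X) := by have := log_le_sub_one_of_pos h2; linarith
      have h4 : a / X ≤ log (1 - 1/X) * (-a) := by
        have := mll h3 ha.le
        have e : a / X = a * (1/X) := by ring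
        linarith
      have := add_one_le_exp (log (1 - 1/X) * (-a))
      linarith
    have h5 : (X ^ (1 + a))⁻¹ = X ^ (-a) / X := by
      rw [rpow_add (by linarith), rpow_one, rpow_neg (by linarith)]; field_simp
    rw [h5]
    have h6 : X ^ (-a) / X ≤ (1/a) * ((X-1) ^ (-a) - X ^ (-a)) := by
      have : X ^ (-a) / X = (1/a) * (X ^ (-a) * (a / X)) := by field_simp
      rw [this]
      refine mll ?_ (by positivity)
      linarith
    have h7 : (1/a) * (1 - (X - 1) ^ (-a)) + (1/a) * ((X-1) ^ (-a) - X ^ (-a)) = (1/a) * (1 - X^(-a)) := by ring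
    linarith

lemma euler_zeta (a : ℝ) (ha : 0 < a) (P : Finset ℕ) (hP : ∀ p ∈ P, p.Prime) :
    ∏ p ∈ P, (1 - ((p:ℝ) ^ (1+a))⁻¹)⁻¹ ≤ 1 + 1/a := by
  have hσ : 0 < 1 + a := by linarith
  have key := EulerProduct.summable_and_hasSum_factoredNumbers_prod_filter_prime_geometric
    (f := nhom (1+a)) (fun {p} hp => by
      change ‖((p:ℝ) ^ (1+a))⁻¹‖ < 1
      rw [Real.norm_of_nonneg (by positivity)]
      exact inv_lt_one_of_one_lt₀ (one_lt_rpow (by exact_mod_cast hp.one_lt) hσ)) P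
  have hP' : P.filter Nat.Prime = P := Finset.filter_true_of_mem hP
  rw [hP'] at key
  have h2 := key.2
  change HasSum (fun m : factoredNumbers P => (((m:ℕ):ℝ) ^ (1+a))⁻¹) (∏ p ∈ P, (1 - ((p:ℝ) ^ (1+a))⁻¹)⁻¹) at h2
  refine hasSum_le_of_sum_le h2 fun S => ?_
  set N := S.sup (fun m => (m:ℕ)) with hN
  have h3 : ∑ m ∈ S, (((m:ℕ):ℝ) ^ (1+a))⁻¹ ≤ ∑ n ∈ Icc 1 (N+1), ((n:ℝ) ^ (1 + a))⁻¹ := by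
    rw [← sum_image (s := S) (g := fun m : factoredNumbers P => (m:ℕ)) (f := fun n : ℕ => ((n:ℝ) ^ (1 + a))⁻¹)
      (fun a _ b _ h => Subtype.ext h)]
    refine sum_le_sum_of_subset_of_nonneg ?_ (fun _ _ _ => by positivity)
    intro n hn
    rw [mem_image] at hn
    obtain ⟨m, hm, rfl⟩ := hn
    have h4 : (m:ℕ) ≤ N := Finset.le_sup (f := fun m : factoredNumbers P => (m:ℕ)) hm
    have h5 : (m:ℕ) ≠ 0 := (Nat.mem_factoredNumbers.1 m.2).1
    rw [mem_Icc]; omega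
  refine h3.trans ((zeta_partial a ha N).trans ?_)
  have : 0 ≤ ((N+1:ℕ):ℝ) ^ (-a) := by positivity
  have h6 : 0 ≤ 1/a := by positivity
  nlinarith

lemma inv_ratio {u v c : ℝ} (huv : v ≤ u) (hc : 0 < c) (hu : 1/c ≤ 1 - u) :
    (1 - u)⁻¹ ≤ (1 - v)⁻¹ * exp (c * (u - v)) := by
  have hc' : 0 < 1/c := by positivity
  have h1 : 0 < 1 - u := by linarith
  have h2 : 0 < 1 - v := by linarith
  have h3 : (1 - v) ≤ (1 - u) * exp (c * (u - v)) := by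
    have h4 := add_one_le_exp (c * (u - v))
    have h5 : 1 ≤ c * (1 - u) := by
      rw [div_le_iff₀ hc] at hu; linarith
    have h6 : (1-u) * (c * (u - v) + 1) ≤ (1 - u) * exp (c * (u - v)) := mll h4 h1.le
    nlinarith [mul_nonneg (sub_nonneg.2 huv) (sub_nonneg.2 h5)]
  rw [inv_mul_eq_div, le_div_iff₀ h2, inv_mul_eq_div, div_le_iff₀ h1]
  linarith

noncomputable def CM : ℝ := 3 * exp 4

lemma VV_le (t : ℝ) (ht : 2 ≤ t) : VV t ≤ CM * log t := by
  have hlog : 0 < log t := log_pos (by linarith)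
  set a := 1 / log t with ha
  have ha0 : 0 < a := by positivity
  have hPr : ∀ p ∈ Pr t, p.Prime := fun p hp => ((mem_Pr (by linarith)).1 hp).1
  have h1 : VV t ≤ ∏ p ∈ Pr t, ((1 - ((p:ℝ) ^ (1+a))⁻¹)⁻¹ * exp (2 * (a * (log p / p)))) := by
    unfold VV
    refine prod_le_prod (fun p hp => le_trans zero_le_one (pinv_pos (hPr p hp))) fun p hp => ?_
    have hp2 : (2:ℝ) ≤ p := by exact_mod_cast (hPr p hp).two_le
    have hp0 : (0:ℝ) < p := by linarith
    have e1 : ((p:ℝ) ^ (1+a))⁻¹ = 1/p * exp (-(a * log p)) := by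
      rw [rpow_add hp0, rpow_one, rpow_def_of_pos hp0, Real.exp_neg, mul_inv, mul_comm a]; simp
    have h2 := add_one_le_exp (-(a * log p))
    have hlp : 0 ≤ log p := log_nonneg (by linarith)
    have h3 : exp (-(a * log p)) ≤ 1 := Real.exp_le_one_iff.2 (by nlinarith)
    have h4 : ((p:ℝ) ^ (1+a))⁻¹ ≤ 1/p := by
      rw [e1]; exact mul_le_of_le_one_right (by positivity) h3
    have h5 := inv_ratio (c := 2) h4 two_pos (by
      have : (1:ℝ)/p ≤ 1/2 := one_div_le_one_div_of_le two_pos hp2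
      linarith)
    refine h5.trans (mll (exp_le_exp.2 ?_) (inv_nonneg.2 (by
      have : (1:ℝ)/p ≤ 1/2 := one_div_le_one_div_of_le two_pos hp2
      linarith)))
    rw [e1]
    have h6 : 1/(p:ℝ) * (1 - exp (-(a * log p))) ≤ 1/p * (a * log p) :=
      mll (by linarith) (by positivity)
    have e2 : a * (log p / p) = 1/p * (a * log p) := by ring
    rw [e2]; linarith
  rw [prod_mul_distrib, ← exp_sum, ← mul_sum, ← mul_sum] at h1
  have h2 := euler_zeta a ha0 (Pr t) hPr
  have h3 := sum_logp t (by linarith)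
  have h4 : 2 * (a * ∑ p ∈ Pr t, log p / p) ≤ 4 := by
    have : a * ∑ p ∈ Pr t, log p / p ≤ a * (2 * log t) := mll h3 ha0.le
    have e : a * (2 * log t) = 2 := by rw [ha]; field_simp
    linarith
  have h5 : 1 + 1/a ≤ 3 * log t := by
    have e : 1/a = log t := by rw [ha]; field_simp
    rw [e]
    have : log 2 ≤ log t := log_le_log two_pos ht
    have := log_two_gt_d9
    linarith
  calc VV t ≤ _ := h1
    _ ≤ (3 * log t) * exp 4 := by
      refine mul_le_mul (h2.trans h5) (exp_le_exp.2 h4) (Real.exp_nonneg _) (by positivity)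
    _ = _ := by unfold CM; ring

lemma setsLe_conv (Q : Finset ℕ) (t : ℝ) (w : ℕ → ℝ) :
    ∑ s ∈ setsLe (fun i : Q => i.1) t, ∏ i ∈ s, w i.1 =
      ∑ s ∈ Q.powerset.filter (fun s : Finset ℕ => ∏ p ∈ s, (p:ℝ) ≤ t), ∏ p ∈ s, w p := by
  refine Finset.sum_nbij' (fun s => s.map (Function.Embedding.subtype _)) (fun s => s.subtype (· ∈ Q)) ?_ ?_ ?_ ?_ ?_
  · intro s hs
    simp only [setsLe, mem_filter, mem_univ, true_and] at hs
    rw [mem_filter, mem_powerset, prod_map]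
    refine ⟨?_, hs⟩
    intro p hp
    rw [Finset.mem_map] at hp
    obtain ⟨i, _, rfl⟩ := hp
    exact i.2
  · intro s hs
    rw [mem_filter, mem_powerset] at hs
    simp only [setsLe, mem_filter, mem_univ, true_and]
    have h := Finset.subtype_map_of_mem (s := s) (p := (· ∈ Q)) hs.1
    have h2 := hs.2
    rw [← h, prod_map] at h2
    exact h2
  · intro s hs
    ext i; simp
  · intro s hs
    rw [mem_filter, mem_powerset] at hs
    exact Finset.subtype_map_of_mem (s := s) (p := (· ∈ Q)) hs.1
  · intro s hs
    rw [prod_map]; rfl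

lemma union_expand {ι : Type} [Fintype ι] (w1 w2 : ι → ℝ) (s : Finset ι) :
    ∏ i ∈ s, (w1 i + w2 i + w1 i * w2 i) =
      ∑ x ∈ (univ : Finset (Finset ι × Finset ι)).filter (fun x => x.1 ∪ x.2 = s), (∏ i ∈ x.1, w1 i) * ∏ i ∈ x.2, w2 i := by
  have e : ∀ i, w1 i + w2 i + w1 i * w2 i = (1 + w1 i) * w2 i + w1 i := fun i => by ring
  simp only [e]
  rw [Finset.prod_add]
  have e2 : ∀ a ∈ s.powerset, (∏ i ∈ a, (1 + w1 i) * w2 i) * ∏ i ∈ s \ a, w1 i = ∑ b ∈ a.powerset, (∏ i ∈ b ∪ (s \ a), w1 i) * ∏ i ∈ a, w2 i := by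
    intro a _
    rw [prod_mul_distrib, Finset.prod_one_add, sum_mul, sum_mul]
    refine sum_congr rfl fun b hb => ?_
    rw [prod_union (disjoint_left.2 fun i hi hi' => (Finset.mem_sdiff.1 hi').2 (mem_powerset.1 hb hi))]
    ring
  rw [sum_congr rfl e2, sum_sigma']
  refine Finset.sum_nbij' (fun x => (x.2 ∪ (s \ x.1), x.1)) (fun x => ⟨x.2, x.1 ∩ x.2⟩) ?_ ?_ ?_ ?_ ?_
  · intro x hx
    simp only [mem_sigma, mem_powerset] at hx
    simp only [mem_filter, mem_univ, true_and]
    ext i; have h1 := @hx.1 i; have h2 := @hx.2 i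
    simp only [mem_union, Finset.mem_sdiff]; tauto
  · intro x hx
    simp only [mem_filter, mem_univ, true_and] at hx
    simp only [mem_sigma, mem_powerset]
    exact ⟨hx ▸ Finset.subset_union_right, inter_subset_right⟩
  · intro x hx
    simp only [mem_sigma, mem_powerset] at hx
    rcases x with ⟨a, b⟩
    simp only at hx ⊢
    congr 1
    ext i; have h1 := @hx.1 i; have h2 := @hx.2 i
    simp only [mem_union, Finset.mem_sdiff, mem_inter]; tauto
  · intro x hx
    simp only [mem_filter, mem_univ, true_and] at hx
    refine Prod.ext ?_ rfl
    ext i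
    have := ext_iff.1 hx i
    simp only [mem_union, Finset.mem_sdiff, mem_inter] at this ⊢; tauto
  · intro x hx; rfl

lemma S_mul {ι : Type} [Fintype ι] (pr : ι → ℕ) (hpr : ∀ i, 1 ≤ pr i) (w1 w2 f : ι → ℝ) (h1 : ∀ i, 0 ≤ w1 i) (h2 : ∀ i, 0 ≤ w2 i) (hf : ∀ i, w1 i + w2 i + w1 i * w2 i ≤ f i) (t1 t2 : ℝ) (ht1 : 0 ≤ t1) (t : ℝ) (ht : t1 * t2 ≤ t) :
    (∑ s ∈ setsLe pr t1, ∏ i ∈ s, w1 i) * (∑ s ∈ setsLe pr t2, ∏ i ∈ s, w2 i) ≤ ∑ s ∈ setsLe pr t, ∏ i ∈ s, f i := by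
  rw [sum_mul_sum, ← Finset.sum_product']
  have hone : ∀ i, (1:ℝ) ≤ pr i := fun i => by exact_mod_cast hpr i
  have hmaps : ∀ x ∈ setsLe pr t1 ×ˢ setsLe pr t2, x.1 ∪ x.2 ∈ setsLe pr t := by
    intro x hx
    rw [mem_product] at hx
    simp only [setsLe, mem_filter, mem_univ, true_and] at hx ⊢
    refine le_trans ?_ ht
    have hA : ∏ i ∈ x.1 ∪ x.2, (pr i:ℝ) ≤ (∏ i ∈ x.1, (pr i:ℝ)) * ∏ i ∈ x.2, (pr i : ℝ) := by
      rw [← Finset.prod_union_inter]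
      refine le_mul_of_one_le_right (prod_nonneg fun i _ => by positivity) ?_
      have := prod_mono_one (empty_subset (x.1 ∩ x.2)) (fun i => (pr i:ℝ)) hone
      simpa using this
    refine hA.trans (mul_le_mul hx.1 hx.2 (prod_nonneg fun i _ => by positivity) ht1)
  rw [← sum_fiberwise_of_maps_to hmaps]
  refine sum_le_sum fun s _ => ?_
  refine le_trans ?_ (prod_le_prod (fun i _ => by have := h1 i; have := h2 i; positivity) fun i _ => hf i)
  rw [union_expand]
  refine sum_le_sum_of_subset_of_nonneg ?_ (fun x _ _ => mul_nonneg (prod_nonneg fun i _ => h1 i) (prod_nonneg fun i _ => h2 i))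
  intro x hx
  rw [mem_filter] at hx ⊢
  exact ⟨mem_univ _, hx.2⟩

lemma S_le_prod {ι : Type} [Fintype ι] (pr : ι → ℕ) (hpr : ∀ i, 1 ≤ pr i) (f : ι → ℝ) (hf : ∀ i, 0 ≤ f i) (t : ℝ) :
    ∑ s ∈ setsLe pr t, ∏ i ∈ s, f i ≤ ∏ i ∈ univ.filter (fun i => (pr i:ℝ) ≤ t), (1 + f i) := by
  rw [Finset.prod_one_add]
  refine sum_le_sum_of_subset_of_nonneg ?_ (fun x _ _ => prod_nonneg fun i _ => hf i)
  intro s hs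
  simp only [setsLe, mem_filter, mem_univ, true_and] at hs
  rw [mem_powerset]
  intro i hi
  rw [mem_filter]
  refine ⟨mem_univ _, le_trans ?_ hs⟩
  have := prod_mono_one (Finset.singleton_subset_iff.2 hi) (fun i => (pr i:ℝ)) (fun i => by exact_mod_cast hpr i)
  simpa using this

noncomputable def QQ (D0 R : ℝ) : Finset ℕ := (Pr R).filter (fun p => D0 < (p:ℝ))

lemma mem_QQ {D0 R : ℝ} (hR : 0 ≤ R) {p : ℕ} : p ∈ QQ D0 R ↔ p.Prime ∧ (p:ℝ) ≤ R ∧ D0 < p := by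
  rw [QQ, mem_filter, mem_Pr hR, and_assoc]

lemma prod_mono_mem {s t : Finset ℕ} (h : s ⊆ t) (f : ℕ → ℝ) (hf : ∀ i ∈ t, 1 ≤ f i) : ∏ i ∈ s, f i ≤ ∏ i ∈ t, f i := by
  rw [← prod_sdiff h]
  refine le_mul_of_one_le_left (prod_nonneg fun i hi => le_trans zero_le_one (hf i (h hi))) ?_
  have : ∏ i ∈ t \ s, (1:ℝ) ≤ ∏ i ∈ t \ s, f i :=
    prod_le_prod (fun _ _ => zero_le_one) fun i hi => hf i (Finset.mem_sdiff.1 hi).1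
  simpa using this

lemma S_lower_gen (Q W : Finset ℕ) (hQ : ∀ p ∈ Q, p.Prime) (hW : W ⊆ Q) (t : ℝ) (ht : 1 ≤ t) (E : ℝ) (hE : ∏ p ∈ Pr t \ W, (1 - 1/(p:ℝ))⁻¹ ≤ E) :
    log t ≤ E * ∑ s ∈ setsLe (fun i : Q => i.1) t, ∏ i ∈ s, (if i.1 ∈ W then 1 / ((i.1:ℝ) - 1) else 0) := by
  rw [setsLe_conv Q t (fun p => if p ∈ W then 1 / ((p:ℝ) - 1) else 0)]
  have h1 := log_le_split t ht (W ∩ Pr t) inter_subset_right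
  have hnn : ∀ p ∈ Q, (0:ℝ) ≤ 1 / ((p:ℝ) - 1) := by
    intro p hp
    have : (2:ℝ) ≤ p := by exact_mod_cast (hQ p hp).two_le
    exact one_div_nonneg.2 (by linarith)
  have hpos : ∀ (s : Finset ℕ), s ⊆ Q → 0 ≤ ∏ p ∈ s, (if p ∈ W then 1 / ((p:ℝ) - 1) else 0) := by
    intro s hs
    refine prod_nonneg fun p hp => ?_
    split_ifs
    · exact hnn p (hs hp)
    · exact le_rfl
  have h2 : ∑ s ∈ (W ∩ Pr t).powerset.filter (fun s : Finset ℕ => ∏ p ∈ s, (p:ℝ) ≤ t), ∏ p ∈ s, 1 / ((p:ℝ) - 1) ≤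
      ∑ s ∈ Q.powerset.filter (fun s : Finset ℕ => ∏ p ∈ s, (p:ℝ) ≤ t), ∏ p ∈ s, (if p ∈ W then 1 / ((p:ℝ) - 1) else 0) := by
    refine le_trans (le_of_eq ?_) (sum_le_sum_of_subset_of_nonneg (s := (W ∩ Pr t).powerset.filter (fun s : Finset ℕ => ∏ p ∈ s, (p:ℝ) ≤ t)) ?_ (fun s hs _ => hpos s (mem_powerset.1 (mem_filter.1 hs).1)))
    · refine sum_congr rfl fun s hs => prod_congr rfl fun p hp => ?_
      rw [if_pos]
      exact (mem_inter.1 (mem_powerset.1 (mem_filter.1 hs).1 hp)).1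
    · exact Finset.filter_subset_filter _ (Finset.powerset_mono.2 (Finset.inter_subset_left.trans hW))
  have e : Pr t \ (W ∩ Pr t) = Pr t \ W := by ext p; simp
  rw [e] at h1
  refine h1.trans (mul_le_mul hE h2 ?_ (le_trans (prod_nonneg fun p hp => ?_) hE))
  · refine sum_nonneg fun s hs => prod_nonneg fun p hp => hnn p (hW ?_)
    exact (mem_inter.1 (mem_powerset.1 (mem_filter.1 hs).1 hp)).1
  · exact le_trans zero_le_one (pinv_pos ((mem_Pr (by linarith)).1 (Finset.mem_sdiff.1 hp).1).1)

lemma CM_pos : 0 < CM := by unfold CM; positivity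

lemma Sh_lower (D0 R t : ℝ) (hD0 : 2 ≤ D0) (ht : 1 ≤ t) (htR : t ≤ R) :
    log t ≤ (CM * log D0) *
      ∑ s ∈ setsLe (fun i : QQ D0 R => i.1) t, ∏ i ∈ s, 1 / ((i.1:ℝ) - 1) := by
  have h := S_lower_gen (QQ D0 R) (QQ D0 R) (fun p hp => ((mem_QQ (by linarith)).1 hp).1) (le_refl _) t ht (CM * log D0) ?_
  · refine h.trans (le_of_eq ?_)
    congr 1
    refine sum_congr rfl fun s _ => prod_congr rfl fun i _ => ?_
    rw [if_pos i.2]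
  · refine le_trans ?_ (VV_le D0 hD0)
    unfold VV
    refine prod_mono_mem ?_ _ (fun p hp => pinv_pos ((mem_Pr (by linarith)).1 hp).1)
    intro p hp
    rw [Finset.mem_sdiff, mem_QQ (by linarith), mem_Pr (by linarith)] at hp
    rw [mem_Pr (by linarith)]
    refine ⟨hp.1.1, ?_⟩
    by_contra hc
    exact hp.2 ⟨hp.1.1, hp.1.2.trans htR, not_le.1 hc⟩

lemma finv_one {p : ℕ} [Fact p.Prime] (Ω : Finset (ZMod p)) (h : Ω.card = 1) : finv Ω = 1 / ((p:ℝ) - 1) := by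
  have h1 := card_al Ω
  rw [h] at h1
  unfold finv
  rw [h, show (p:ℝ) - 1 = (Fintype.card {t : ZMod p // t ∉ Ω} : ℝ) by push_cast at h1; linarith]
  push_cast; rfl

lemma finv_two {p : ℕ} [Fact p.Prime] (Ω : Finset (ZMod p)) (h : Ω.card = 2) : finv Ω = 2 / ((p:ℝ) - 2) := by
  have h1 := card_al Ω
  rw [h] at h1
  unfold finv
  rw [h, show (p:ℝ) - 2 = (Fintype.card {t : ZMod p // t ∉ Ω} : ℝ) by push_cast at h1; linarith]
  push_cast; rfl

lemma tail_sum (D0 : ℕ) (h : 1 ≤ D0) (S : Finset ℕ) (hS : ∀ n ∈ S, D0 < n) :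
    ∑ n ∈ S, 1 / ((n:ℝ) * √n) ≤ 2 / √D0 := by
  obtain ⟨N, hN⟩ : ∃ N, ∀ n ∈ S, n < N := ⟨S.sup id + 1, fun n hn => Nat.lt_succ_of_le (Finset.le_sup (f := id) hn)⟩
  have hb : ∀ N, D0 + 1 ≤ N → ∑ n ∈ Ico (D0+1) N, 1 / ((n:ℝ) * √n) ≤ 2 / √D0 - 2 / √((N-1:ℕ):ℝ) := by
    intro N hN
    induction N, hN using Nat.le_induction with
    | base => simp
    | succ n hn ih =>
      rw [Finset.sum_Ico_succ_top hn]
      have hn2 : 2 ≤ n := by omega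
      have key : 1 / ((n:ℝ) * √n) ≤ 2 / √((n-1:ℕ):ℝ) - 2 / √n := by
        have e : ((n-1:ℕ):ℝ) = (n:ℝ) - 1 := by push_cast [cast_sub (by omega : 1 ≤ n)]; ring
        rw [e]
        have hn' : (2:ℝ) ≤ n := by exact_mod_cast hn2
        set a := √((n:ℝ) - 1) with ha
        set b := √(n:ℝ) with hb
        have ha0 : 0 < a := sqrt_pos.2 (by linarith)
        have hb0 : 0 < b := sqrt_pos.2 (by linarith)
        have ha2 : a ^ 2 = n - 1 := sq_sqrt (by linarith)
        have hb2 : b ^ 2 = n := sq_sqrt (by linarith)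
        have hab : a ≤ b := sqrt_le_sqrt (by linarith)
        rw [← hb2, div_sub_div _ _ ha0.ne' hb0.ne', div_le_div_iff₀ (by positivity) (by positivity)]
        have h1 : b ^ 2 - a ^ 2 = 1 := by linarith
        have h2 : (b - a) * (b + a) = 1 := by linarith
        have h3 : 1 ≤ (b - a) * (2 * b) := by nlinarith
        have : a * b ≤ b ^ 2 := by nlinarith
        nlinarith [mll h3 (by positivity : 0 ≤ b^2)]
      have : n + 1 - 1 = n := by omega
      rw [this]; linarith
  have hsub : S ⊆ Ico (D0+1) (max N (D0+1)) := by
    intro n hn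
    rw [mem_Ico]
    exact ⟨hS n hn, lt_of_lt_of_le (hN n hn) (le_max_left _ _)⟩
  refine (sum_le_sum_of_subset_of_nonneg hsub fun n _ _ => by positivity).trans ?_
  refine (hb _ (le_max_right _ _)).trans ?_
  have : (0:ℝ) ≤ 2 / √((max N (D0+1) - 1 : ℕ):ℝ) := by positivity
  linarith

lemma S_lower (D0 : ℕ) (R y e1 ℓ : ℝ) (hD0 : 2 ≤ D0) (hy : 1 ≤ y) (he : 0 < e1) (hℓ : 0 < ℓ) (V : Finset ℕ) (hV : V ⊆ QQ D0 R) (hE : ∏ p ∈ Pr y \ V, (1 - 1/(p:ℝ))⁻¹ ≤ e1 * ℓ) (f : QQ D0 R → ℝ) (hf1 : ∀ i, i.1 ∉ V → f i = 1 / ((i.1:ℝ) - 1)) (hf2 : ∀ i, i.1 ∈ V → f i = 2 / ((i.1:ℝ) - 2)) (t : ℝ) (ht : y ^ 2 ≤ t) (htR : t ≤ R) :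
    log t * (log y / (ℓ * log D0)) / (2 * CM * e1) ≤ ∑ s ∈ setsLe (fun i : QQ D0 R => i.1) t, ∏ i ∈ s, f i := by
  have hR : 0 ≤ R := le_trans (by positivity) (ht.trans htR)
  have hD0' : (2:ℝ) ≤ D0 := by exact_mod_cast hD0
  have hlog : 0 < log D0 := log_pos (by linarith)
  have hCM := CM_pos
  have hy0 : 0 < y := by linarith
  have hpr : ∀ i : QQ D0 R, i.1.Prime ∧ (D0:ℝ) < (i.1:ℝ) := fun i => ⟨((mem_QQ hR).1 i.2).1, ((mem_QQ hR).1 i.2).2.2⟩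
  have hty : y ≤ t / y := by rw [le_div_iff₀ hy0]; nlinarith
  have htle : t / y ≤ t := div_le_self (le_trans (by positivity) ht) hy
  have h1 := Sh_lower D0 R (t / y) hD0' (hy.trans hty) (htle.trans htR)
  have h2 := S_lower_gen (QQ D0 R) V (fun p hp => ((mem_QQ hR).1 hp).1) hV y hy (e1 * ℓ) hE
  have hmul := S_mul (fun i : QQ D0 R => i.1) (fun i => (hpr i).1.one_le) (fun i => 1 / ((i.1:ℝ) - 1))
    (fun i => if i.1 ∈ V then 1 / ((i.1:ℝ) - 1) else 0) f
    (fun i => by have := (hpr i).2; exact one_div_nonneg.2 (by linarith))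
    (fun i => by
      have := (hpr i).2
      split_ifs
      · exact one_div_nonneg.2 (by linarith)
      · exact le_rfl)
    (fun i => by
      have h3 := (hpr i).2
      by_cases hi : i.1 ∈ V
      · rw [if_pos hi, hf2 i hi]
        have ha : (0:ℝ) < (i.1:ℝ) - 1 := by linarith
        have hb : (0:ℝ) < (i.1:ℝ) - 2 := by linarith
        generalize (i.1:ℝ) = P at *
        have e : 1 / (P - 1) + 1 / (P - 1) + 1 / (P - 1) * (1 / (P - 1)) = (2 * (P - 1) + 1) / ((P - 1) * (P - 1)) := by
          field_simp; ring
        rw [e, div_le_div_iff₀ (by positivity) hb]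
        nlinarith
      · rw [if_neg hi, hf1 i hi]; simp)
    (t / y) y (hy0.le.trans hty) t (by rw [div_mul_cancel₀ _ hy0.ne'])
  refine le_trans ?_ hmul
  set a := ∑ s ∈ setsLe (fun i : QQ D0 R => i.1) (t / y), ∏ i ∈ s, 1 / ((i.1:ℝ) - 1)
  set b := ∑ s ∈ setsLe (fun i : QQ D0 R => i.1) y, ∏ i ∈ s, (if i.1 ∈ V then 1 / ((i.1:ℝ) - 1) else 0)
  have hly : 0 ≤ log y := log_nonneg hy
  have ht0 : 0 < t := lt_of_lt_of_le (by positivity) ht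
  have hlt : log t / 2 ≤ log (t / y) := by
    rw [Real.log_div ht0.ne' hy0.ne']
    have := log_le_log (by positivity) ht
    rw [log_pow] at this; push_cast at this; linarith
  have hlt0 : 0 ≤ log t / 2 := by
    have : 1 ≤ t := hy.trans (hty.trans htle)
    have := log_nonneg this; linarith
  clear_value a b
  have h3 : log t / 2 / (CM * log D0) ≤ a := by
    rw [div_le_iff₀ (by positivity)]; linarith
  have h4 : log y / (e1 * ℓ) ≤ b := by
    rw [div_le_iff₀ (by positivity)]; linarith
  calc log t * (log y / (ℓ * log D0)) / (2 * CM * e1) = log t / 2 / (CM * log D0) * (log y / (e1 * ℓ)) := by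
        field_simp
    _ ≤ a * b := mul_le_mul h3 h4 (by positivity) (le_trans (by positivity) h3)

lemma S_upper (D0 : ℕ) (R y e1 ℓ : ℝ) (hD0 : 4 ≤ D0) (hℓ : 0 < ℓ) (V : Finset ℕ) (hV : V ⊆ QQ D0 R) (hE : ∏ p ∈ V, (1 - 1/(p:ℝ))⁻¹ ≤ e1 * log y / ℓ) (f : QQ D0 R → ℝ) (hf1 : ∀ i, i.1 ∉ V → f i = 1 / ((i.1:ℝ) - 1)) (hf2 : ∀ i, i.1 ∈ V → f i = 2 / ((i.1:ℝ) - 2)) (t : ℝ) (ht : D0 ≤ t) (hVt : ∀ p ∈ V, (p:ℝ) ≤ t) (htR : t ≤ R) :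
    ∑ s ∈ setsLe (fun i : QQ D0 R => i.1) t, ∏ i ∈ s, f i ≤ (CM * exp 4 * e1) * (log y / (ℓ * log D0)) * log t := by
  have hD0' : (4:ℝ) ≤ D0 := by exact_mod_cast hD0
  have hR : 0 ≤ R := by linarith
  have hlog : 0 < log D0 := log_pos (by linarith)
  have hCM := CM_pos
  have hpr : ∀ i : QQ D0 R, i.1.Prime ∧ (D0:ℝ) < (i.1:ℝ) := fun i => ⟨((mem_QQ hR).1 i.2).1, ((mem_QQ hR).1 i.2).2.2⟩
  have hf0 : ∀ i, 0 ≤ f i := by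
    intro i
    have := (hpr i).2
    by_cases hi : i.1 ∈ V
    · rw [hf2 i hi]; exact div_nonneg (by norm_num) (by linarith)
    · rw [hf1 i hi]; exact div_nonneg (by norm_num) (by linarith)
  refine (S_le_prod (fun i : QQ D0 R => i.1) (fun i => (hpr i).1.one_le) f hf0 t).trans ?_
  set u : ℕ → ℝ := fun p => (1 - 1/(p:ℝ))⁻¹ with hu
  have hloc : ∀ i ∈ univ.filter (fun i : QQ D0 R => ((i.1:ℕ):ℝ) ≤ t), 1 + f i ≤ u i.1 * (if i.1 ∈ V then u i.1 else 1) * exp (4 * (1 / ((i.1:ℝ) * √i.1))) := by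
    intro i _
    have h3 := (hpr i).2
    have hP : (4:ℝ) ≤ i.1 := by linarith
    have hu' : u i.1 = (i.1:ℝ) / (i.1 - 1) := by
      simp only [hu]
      have : (i.1:ℝ) - 1 ≠ 0 := by linarith
      field_simp
    have hs0 : (0:ℝ) ≤ 4 * (1 / ((i.1:ℝ) * √i.1)) := by positivity
    by_cases hi : i.1 ∈ V
    · rw [if_pos hi, hf2 i hi, hu']
      have hsq : √(i.1:ℝ) ≤ i.1 := by
        rw [sqrt_le_left (by linarith)]; nlinarith
      have h5 : 1 + 4 / ((i.1:ℝ) * i.1) ≤ exp (4 * (1 / ((i.1:ℝ) * √i.1))) := by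
        refine le_trans ?_ (add_one_le_exp _)
        have : 4 / ((i.1:ℝ) * i.1) ≤ 4 * (1 / ((i.1:ℝ) * √i.1)) := by
          rw [mul_one_div]
          have : 0 < √(i.1:ℝ) := sqrt_pos.2 (by linarith)
          exact div_le_div_of_nonneg_left (by norm_num) (by positivity) (by gcongr)
        linarith
      refine le_trans ?_ (mll h5 (by
        have : (0:ℝ) ≤ (i.1:ℝ) / (i.1 - 1) := div_nonneg (by linarith) (by linarith)
        positivity))
      generalize (i.1:ℝ) = P at *
      have ha : 0 < P - 1 := by linarith
      have hb : 0 < P - 2 := by linarith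
      have hP0 : 0 < P := by linarith
      have e1' : 1 + 2 / (P - 2) = P / (P - 2) := by field_simp; ring
      have e2 : P / (P - 1) * (P / (P - 1)) * (1 + 4 / (P * P)) = (P * P + 4) / ((P - 1)*(P-1)) := by field_simp
      rw [e1', e2, div_le_div_iff₀ hb (by positivity)]
      nlinarith
    · rw [if_neg hi, hf1 i hi, hu', mul_one]
      have ha : (0:ℝ) < (i.1:ℝ) - 1 := by linarith
      have e1' : 1 + 1 / ((i.1:ℝ) - 1) = i.1 / (i.1 - 1) := by field_simp; ring
      rw [e1']
      refine le_mul_of_one_le_right (by positivity) (one_le_exp hs0)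
  refine (prod_le_prod (fun i _ => by have := hf0 i; linarith) hloc).trans ?_
  have ht0 : 0 ≤ t := by linarith
  have hconv : ∀ w : ℕ → ℝ, ∏ i ∈ univ.filter (fun i : QQ D0 R => ((i.1:ℕ):ℝ) ≤ t), w i.1 = ∏ p ∈ QQ D0 t, w p := by
    intro w
    refine Finset.prod_nbij (fun i => i.1) ?_ ?_ ?_ ?_
    · intro i hi
      rw [mem_QQ ht0]
      exact ⟨(hpr i).1, (mem_filter.1 hi).2, (hpr i).2⟩
    · intro i _ j _ h; exact Subtype.ext h
    · intro p hp
      have hp := (mem_QQ ht0).1 hp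
      refine ⟨⟨p, (mem_QQ hR).2 ⟨hp.1, hp.2.1.trans htR, hp.2.2⟩⟩, ?_, rfl⟩
      simp [hp.2.1]
    · intro i _; rfl
  rw [hconv (fun p => u p * (if p ∈ V then u p else 1) * exp (4 * (1 / ((p:ℝ) * √p))))]
  rw [prod_mul_distrib, prod_mul_distrib, ← exp_sum, ← mul_sum]
  have hu1 : ∀ p ∈ Pr t, 1 ≤ u p := fun p hp => pinv_pos ((mem_Pr ht0).1 hp).1
  have h1 : ∏ p ∈ QQ D0 t, u p ≤ CM * log t / log D0 := by
    rw [le_div_iff₀ hlog]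
    refine le_trans ?_ (VV_le t (by linarith))
    have hV0 := log_le_VV D0 (by linarith)
    have hsplit : VV t = (∏ p ∈ QQ D0 t, u p) * VV D0 := by
      unfold VV
      rw [← Finset.prod_filter_mul_prod_filter_not (Pr t) (fun p => (D0:ℝ) < p)]
      congr 1
      refine prod_congr ?_ fun _ _ => rfl
      ext p
      rw [mem_filter, mem_Pr ht0, mem_Pr (by linarith), not_lt]
      constructor
      · rintro ⟨⟨a, b⟩, c⟩; exact ⟨a, c⟩
      · rintro ⟨a, c⟩; exact ⟨⟨a, c.trans ht⟩, c⟩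
    rw [hsplit]
    refine mll hV0 (prod_nonneg fun p hp => le_trans zero_le_one (hu1 p (mem_filter.1 hp).1))
  have h2 : ∏ p ∈ QQ D0 t, (if p ∈ V then u p else 1) = ∏ p ∈ V, u p := by
    rw [← prod_filter]
    refine prod_congr ?_ fun _ _ => rfl
    ext p
    rw [mem_filter, mem_QQ ht0]
    constructor
    · exact fun h => h.2
    · intro h
      have := (mem_QQ hR).1 (hV h)
      exact ⟨⟨this.1, hVt p h, this.2.2⟩, h⟩
  have h3 : exp (4 * ∑ p ∈ QQ D0 t, 1 / ((p:ℝ) * √p)) ≤ exp 4 := by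
    rw [exp_le_exp]
    have := tail_sum D0 (by omega) (QQ D0 t) (fun p hp => by exact_mod_cast ((mem_QQ ht0).1 hp).2.2)
    have h4 : (2:ℝ) ≤ √D0 := by
      rw [Real.le_sqrt (by norm_num) (by linarith)]; linarith
    have : 2 / √(D0:ℝ) ≤ 1 := by rw [div_le_one (by linarith)]; exact h4
    linarith
  have hV1 : 0 ≤ ∏ p ∈ V, u p := prod_nonneg fun p hp => le_trans zero_le_one (pinv_pos ((mem_QQ hR).1 (hV hp)).1)
  have hlt : 0 ≤ log t := log_nonneg (by linarith)
  rw [h2]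
  calc (∏ p ∈ QQ D0 t, u p) * (∏ p ∈ V, u p) * exp (4 * ∑ p ∈ QQ D0 t, 1 / ((p:ℝ) * √p))
      ≤ (CM * log t / log D0) * (e1 * log y / ℓ) * exp 4 := by
        refine mul_le_mul (mul_le_mul h1 hE hV1 (by positivity)) h3 (exp_pos _).le ?_
        exact mul_nonneg (by positivity) (hV1.trans hE)
    _ = _ := by field_simp

lemma three_sq (p : ℝ) (h : 1 ≤ p) : (3 / p) ^ 2 ≤ 9 * (1 / (p * √p)) := by
  have hip : 0 < p := by linarith
  have hsq : √p ≤ p := by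
    rw [sqrt_le_left (by linarith)]; nlinarith
  have hsq0 : 0 < √p := sqrt_pos.2 hip
  rw [div_pow, mul_one_div, div_le_div_iff₀ (by positivity) (by positivity)]
  nlinarith

open Filter in
set_option maxHeartbeats 1000000 in
theorem coreB (K : ℕ) (ρ : ℝ) (hρ : 0 < ρ) (hρ1 : ρ ≤ 1) (e1 : ℝ) (he1 : 1 ≤ e1) :
    ∃ k : ℕ, 1 ≤ k ∧ ∃ D0 : ℕ, 128 ≤ D0 ∧ ∃ τ : ℝ, 0 < τ ∧ ∃ x0 : ℝ, ∀ x ≥ x0, ∀ y : ℝ, 1 < y → log y ≤ τ * log x →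
    ∀ V : Finset ℕ, V ⊆ QQ D0 y → ∀ ℓ : ℝ, 0 < ℓ → ∏ p ∈ Pr y \ V, (1 - 1/(p:ℝ))⁻¹ ≤ e1 * ℓ →
    ∏ p ∈ V, (1 - 1/(p:ℝ))⁻¹ ≤ e1 * log y / ℓ →
    ∀ Ω : ∀ p : ℕ, Finset (ZMod p),
    (∀ p ∈ QQ D0 (x ^ ((1:ℝ)/40)), (Ω p).card = if p ∈ V then 2 else 1) →
    ∀ A B : Finset ℤ, ∀ N : ℕ, k * x ≤ N → (∀ r ∈ A, 0 ≤ r ∧ r < N) →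
    (∀ r ∈ A, ∀ p ∈ QQ D0 (x ^ ((1:ℝ)/40)), (r : ZMod p) ∉ Ω p) →
    ρ * N ≤ A.card * ((log y / (ℓ * log D0)) * log x) →
    (∀ q ∈ B, ∃ q' : ℕ, q = q' ∧ q'.Prime ∧ x / 4 < q' ∧ (q':ℝ) ≤ x) → x ≤ B.card * (8 * log x) →
    ∃ q ∈ B, ∃ n : ℤ, K ≤ (univ.filter fun j : Fin k => n + ((j:ℕ) + 1 : ℤ) * q ∈ A).card := by
  have hCM := CM_pos
  have hCM1 : 1 ≤ CM := by
    unfold CM; have := one_le_exp (show (0:ℝ) ≤ 4 by norm_num); linarith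
  set C0 : ℝ := 2 * CM ^ 2 * exp 4 * e1 ^ 2 with hC0
  have hC01 : 1 ≤ C0 := by
    have h1 : 1 ≤ CM ^ 2 := one_le_pow₀ hCM1
    have h2 : 1 ≤ e1 ^ 2 := one_le_pow₀ he1
    have h3 := one_le_exp (show (0:ℝ) ≤ 4 by norm_num)
    have h4 : 1 ≤ CM ^ 2 * exp 4 := one_le_mul_of_one_le_of_one_le h1 h3
    have h5 := one_le_mul_of_one_le_of_one_le h4 h2
    rw [hC0]; linarith
  set c : ℝ := 1 / (2 * CM * e1) with hc
  have hc0 : 0 < c := by positivity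
  obtain ⟨N0, hN0⟩ := exists_nat_gt (144 * 1280 * K * C0 ^ 2 / (ρ * c))
  have hN0' : 144 * 1280 * K * C0 ^ 2 < ρ * c * N0 := by
    rw [div_lt_iff₀ (by positivity)] at hN0; linarith
  have hN01 : 1 ≤ N0 := by
    by_contra h
    have : N0 = 0 := by omega
    subst this
    have : 0 ≤ 144 * 1280 * K * C0 ^ 2 := by positivity
    simp at hN0'; linarith
  have hN0r : (1:ℝ) ≤ N0 := by exact_mod_cast hN01
  set k : ℕ := 2 ^ N0 with hk
  have hk1 : 1 ≤ k := Nat.one_le_two_pow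
  have hkr : (k:ℝ) = 2 ^ N0 := by rw [hk]; push_cast; rfl
  have hk1r : (1:ℝ) ≤ k := by exact_mod_cast hk1
  set CA : ℝ := 160 * CM * e1 / ρ with hCAd
  have hCA2 : 2 ≤ CA := by
    rw [hCAd, le_div_iff₀ hρ]
    have : 1 ≤ CM * e1 := one_le_mul_of_one_le_of_one_le hCM1 he1
    nlinarith

  have hev : ∀ᶠ D : ℕ in atTop, ((k:ℝ)+1)^2 * 400 * (3 * (CA + 640 * CM * log D)) ≤ √(D:ℝ) := by
    have hl : Tendsto (fun D : ℝ => (((k:ℝ)+1)^2 * 400 * (3 * (CA + 640 * CM * log D))) / D ^ ((1:ℝ)/2)) atTop (nhds 0) := by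
      have h1 : Tendsto (fun D : ℝ => log D / D ^ ((1:ℝ)/2)) atTop (nhds 0) :=
        (isLittleO_log_rpow_atTop (by norm_num)).tendsto_div_nhds_zero
      have h2 : Tendsto (fun D : ℝ => D ^ (-((1:ℝ)/2))) atTop (nhds 0) := tendsto_rpow_neg_atTop (by norm_num)
      have h3 := ((h2.const_mul CA).add (h1.const_mul (640 * CM))).const_mul (((k:ℝ)+1)^2 * 400 * 3)
      simp only [mul_zero, add_zero] at h3
      refine h3.congr' ?_
      filter_upwards [eventually_gt_atTop 0] with D hD
      rw [rpow_neg hD.le]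
      have := rpow_pos_of_pos hD ((1:ℝ)/2)
      field_simp
    have h4 := (hl.comp tendsto_natCast_atTop_atTop).eventually (gt_mem_nhds one_pos)
    filter_upwards [h4, eventually_gt_atTop 0] with D hD hD0
    have hD0' : (0:ℝ) < D := by exact_mod_cast hD0
    simp only [Function.comp] at hD
    rw [← sqrt_eq_rpow, div_lt_one (sqrt_pos.2 hD0')] at hD
    exact hD.le
  obtain ⟨D0, hD0, hD128, hDk⟩ := (hev.and ((eventually_ge_atTop 128).and (eventually_ge_atTop (k+1)))).exists
  have hD0r : (128:ℝ) ≤ D0 := by exact_mod_cast hD128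
  have hlD : 0 < log D0 := log_pos (by linarith)
  set CB : ℝ := 640 * CM * log D0 with hCBd
  have hCB0 : 0 < CB := by positivity
  set s : ℝ := 1 / (3 * (CA + CB)) with hs
  have hs0 : 0 < s := by positivity
  have hs1 : s ≤ 1 := by rw [hs, div_le_one (by positivity)]; linarith
  have hsD : ((k:ℝ)+1)^2 * 400 ≤ s * √(D0:ℝ) := by
    rw [hs, div_mul_eq_mul_div, le_div_iff₀ (by positivity), one_mul]; exact hD0
  set τ : ℝ := 1 / (1280 * k * N0 * C0) with hτ
  have hC0p : 0 < C0 := by linarith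
  have hτ0 : 0 < τ := by positivity
  refine ⟨k, hk1, D0, hD128, τ / 2, by positivity, ?_⟩
  have hxev : ∀ᶠ x : ℝ in atTop, 1 < x ∧ 1 + 2 * x ^ ((9:ℝ)/20) ≤ x ∧ log D0 ≤ τ * log x ∧ x ^ ((1:ℝ)/40) ≤ x / 4 := by
    have a1 : Tendsto (fun x : ℝ => x ^ (-((11:ℝ)/20))) atTop (nhds 0) := tendsto_rpow_neg_atTop (by norm_num)
    have a2 : Tendsto (fun x : ℝ => x ^ (-((39:ℝ)/40))) atTop (nhds 0) := tendsto_rpow_neg_atTop (by norm_num)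
    filter_upwards [eventually_gt_atTop 2, a1.eventually (gt_mem_nhds (show (0:ℝ) < 1/4 by norm_num)),
      a2.eventually (gt_mem_nhds (show (0:ℝ) < 1/4 by norm_num)),
      tendsto_log_atTop.eventually_ge_atTop (log D0 / τ)] with x h2 h3 h4 h5
    have hx0 : 0 < x := by linarith
    have e1 : x ^ ((9:ℝ)/20) = x * x ^ (-((11:ℝ)/20)) := by
      nth_rw 2 [← rpow_one x]; rw [← rpow_add hx0]; norm_num
    have e2 : x ^ ((1:ℝ)/40) = x * x ^ (-((39:ℝ)/40)) := by
      nth_rw 2 [← rpow_one x]; rw [← rpow_add hx0]; norm_num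
    refine ⟨by linarith, ?_, ?_, ?_⟩
    · have := mul_lt_mul_of_pos_left h3 hx0; rw [e1]; linarith
    · rw [div_le_iff₀ hτ0] at h5; linarith
    · have := mul_lt_mul_of_pos_left h4 hx0; rw [e2]; linarith
  obtain ⟨x0, hx0⟩ := eventually_atTop.1 hxev
  refine ⟨x0, ?_⟩
  intro x hx y hy hyx V hV ℓ hℓ hE1 hE2 Ω hΩ A B N hN hAI hAΩ hAc hB hBc
  obtain ⟨hx1, hx2, hxD, hx4⟩ := hx0 x hx
  have hxp : 0 < x := by linarith
  set R : ℝ := x ^ ((1:ℝ)/40) with hR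
  have hR1 : 1 < R := one_lt_rpow hx1 (by norm_num)
  have hR0 : 0 ≤ R := by linarith
  have hlogR : log R = log x / 40 := by rw [hR, log_rpow hxp]; ring
  have hR18 : R ^ 18 = x ^ ((9:ℝ)/20) := by
    rw [hR, ← Real.rpow_natCast, ← Real.rpow_mul hxp.le]; norm_num
  have hlx : 0 < log x := log_pos hx1
  have hly : 0 < log y := log_pos hy
  set L0 : ℝ := τ * log x with hL0
  have hL0p : 0 < L0 := by positivity
  set Λ : ℝ := log y / (ℓ * log D0) with hΛ
  have hΛp : 0 < Λ := by positivity

  have hkN : (2:ℝ) ^ N0 * L0 ≤ log R / 16 := by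
    rw [hlogR, hL0, hτ, ← hkr]
    have : (k:ℝ) * (1 / (1280 * k * N0 * C0) * log x) = log x / (1280 * (N0 * C0)) := by
      field_simp
    rw [this, div_div]
    refine div_le_div_of_nonneg_left hlx.le (by norm_num) ?_
    have : 1 ≤ (N0:ℝ) * C0 := one_le_mul_of_one_le_of_one_le hN0r hC01
    linarith
  have hnL : ∀ n < N0, L0 ≤ 2 ^ n * L0 ∧ 2 ^ n * L0 ≤ log R := by
    intro n hn
    have h1 : (1:ℝ) ≤ 2 ^ n := one_le_pow₀ (by norm_num)
    have h2 : (2:ℝ) ^ n ≤ 2 ^ N0 := pow_le_pow_right₀ (by norm_num) hn.le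
    constructor
    · exact le_mul_of_one_le_left hL0p.le h1
    · have : 0 < log R := log_pos hR1
      exact (mlr h2 hL0p.le).trans (hkN.trans (by linarith))
  have hy2 : y ^ 2 ≤ exp L0 := by
    rw [← exp_log (show 0 < y by linarith), ← exp_nat_mul]
    rw [exp_le_exp]; push_cast; linarith
  have hexpR : ∀ t, t ≤ log R → exp t ≤ R := by
    intro t ht
    calc exp t ≤ exp (log R) := exp_le_exp.2 ht
      _ = R := exp_log (by linarith)
  have hL0R : exp L0 ≤ R := hexpR _ ((hnL 0 (by omega)).1.trans (hnL 0 (by omega)).2)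
  have hyy2 : y ≤ y ^ 2 := by rw [sq]; exact le_mul_of_one_le_left (by linarith) hy.le
  have hyR : y ≤ R := hyy2.trans (hy2.trans hL0R)
  have hVR : V ⊆ QQ D0 R := by
    intro p hp
    have := (mem_QQ (by linarith)).1 (hV hp)
    exact (mem_QQ hR0).2 ⟨this.1, this.2.1.trans hyR, this.2.2⟩
  have hfact : ∀ i : QQ D0 R, Fact (i.1.Prime) := fun i => ⟨((mem_QQ hR0).1 i.2).1⟩
  have hgt : ∀ i : QQ D0 R, D0 < i.1 := fun i => by exact_mod_cast ((mem_QQ hR0).1 i.2).2.2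
  have hgtr : ∀ i : QQ D0 R, (D0:ℝ) < i.1 := fun i => by exact_mod_cast hgt i
  set f : QQ D0 R → ℝ := fun i => finv (Ω i.1) with hf
  have hf1 : ∀ i : QQ D0 R, i.1 ∉ V → f i = 1 / ((i.1:ℝ) - 1) := fun i hi => finv_one _ (by rw [hΩ i.1 i.2, if_neg hi])
  have hf2 : ∀ i : QQ D0 R, i.1 ∈ V → f i = 2 / ((i.1:ℝ) - 2) := fun i hi => finv_two _ (by rw [hΩ i.1 i.2, if_pos hi])
  have hcard : ∀ i : QQ D0 R, (Ω i.1).card ≤ 2 := fun i => by rw [hΩ i.1 i.2]; split_ifs <;> norm_num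
  have hSlo : ∀ t, y ^ 2 ≤ t → t ≤ R → c * Λ * log t ≤ ∑ s ∈ setsLe (fun i : QQ D0 R => i.1) t, ∏ i ∈ s, f i := by
    intro t h1 h2
    refine le_trans (le_of_eq ?_) (S_lower D0 R y e1 ℓ (by omega) hy.le (by linarith) hℓ V hVR hE1 f hf1 hf2 t h1 h2)
    rw [hc]; ring
  have hShi : ∀ t, exp L0 ≤ t → t ≤ R → ∑ s ∈ setsLe (fun i : QQ D0 R => i.1) t, ∏ i ∈ s, f i ≤ C0 * (c * Λ) * log t := by
    intro t h1 h2
    have hD : (D0:ℝ) ≤ t := by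
      refine le_trans ?_ h1
      rw [← exp_log (show (0:ℝ) < D0 by linarith)]; exact exp_le_exp.2 hxD
    refine le_trans (S_upper D0 R y e1 ℓ (by omega) hℓ V hVR hE2 f hf1 hf2 t hD ?_ h2) (le_of_eq ?_)
    · intro p hp
      have := ((mem_QQ (by linarith)).1 (hV hp)).2.1
      exact this.trans (hyy2.trans (hy2.trans h1))
    · rw [hc, hC0, hΛ]; field_simp
  have hNx : x ≤ N := le_trans (le_mul_of_one_le_left hxp.le hk1r) hN
  have hNp : (0:ℝ) < N := by linarith
  have hAp : 0 < A.card := by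
    by_contra h
    have : A.card = 0 := by omega
    rw [this] at hAc
    have : 0 < ρ * N := by positivity
    simp at hAc; linarith
  have hBp : 0 < B.card := by
    by_contra h
    have : B.card = 0 := by omega
    rw [this] at hBc
    simp at hBc; linarith
  have hx920 : 0 < x ^ ((9:ℝ)/20) := by positivity
  have hX : ((⌊x⌋₊ + 1 : ℕ):ℝ) ≤ x + 1 := by push_cast; have := floor_le hxp.le; linarith
  have htail : ∑ i : QQ D0 R, 1 / ((i.1:ℝ) * √i.1) ≤ 2 / √(D0:ℝ) := by
    have := tail_sum D0 (by omega) (QQ D0 R) (fun p hp => hgt ⟨p, hp⟩)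
    rw [← Finset.sum_coe_sort] at this
    exact this
  have hsqD : 0 < √(D0:ℝ) := sqrt_pos.2 (by linarith)
  have htail2 : ((k:ℝ)+1)^2 * 116 * ∑ i : QQ D0 R, 1 / ((i.1:ℝ) * √i.1) ≤ s := by
    refine (mll htail (by positivity)).trans ?_
    rw [mul_div_assoc', div_le_iff₀ hsqD]
    have : 0 ≤ ((k:ℝ)+1)^2 := by positivity
    linarith
  have hSR := hSlo R (hy2.trans hL0R) le_rfl
  refine coreA (fun i : QQ D0 R => i.1) Subtype.coe_injective (fun i => Ω i.1) hcard
    (fun i => by have := hgt i; omega) k hk1 (fun i => by have := hgt i; omega) K A B (card_pos.1 hAp) (card_pos.1 hBp)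
    N (⌊x⌋₊ + 1) hAI ?_ (fun r hr i => hAΩ r hr i.1 i.2) ?_ R hR1 ?_ CA CB hCA2 ?_ ?_ s hs0 hs1 ?_ ?_ ?_ N0 hN01 L0 (c * Λ) (C0 * (c * Λ)) hL0p
    (by positivity) (by positivity) ?_ ?_ ?_ ?_ ?_
  · intro q hq
    obtain ⟨q', rfl, _, _, h⟩ := hB q hq
    refine ⟨by positivity, ?_⟩
    have : q' ≤ ⌊x⌋₊ := le_floor h
    exact_mod_cast Nat.lt_succ_of_le this
  · intro q hq i
    obtain ⟨q', rfl, hp, h4, h⟩ := hB q hq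
    rw [Int.cast_natCast, Ne, ZMod.natCast_eq_zero_iff]
    intro hd
    rw [Nat.prime_dvd_prime_iff_eq (hfact i).out hp] at hd
    have := ((mem_QQ hR0).1 i.2).2.1
    rw [hd] at this
    linarith
  · rw [hR18]; linarith
  · rw [hR18]
    have h1 : (N:ℝ) + 2 * x ^ ((9:ℝ)/20) ≤ 2 * N := by linarith
    refine h1.trans ?_
    rw [hlogR] at hSR
    have h2 : CA * A.card * (c * Λ * (log x / 40)) ≤ CA * A.card * ∑ s ∈ setsLe (fun i : QQ D0 R => i.1) R, ∏ i ∈ s, f i :=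
      mll hSR (mul_nonneg (by linarith only [hCA2]) (cast_nonneg _))
    refine le_trans ?_ h2
    have : CA * A.card * (c * Λ * (log x / 40)) = 2 / ρ * (A.card * (Λ * log x)) := by
      generalize (A.card : ℝ) = w
      rw [hCAd, hc]; field_simp; ring
    rw [this]
    have h3 := mll hAc (show 0 ≤ 2 / ρ by positivity)
    refine le_trans (le_of_eq ?_) h3
    field_simp
  · rw [hR18]
    have h1 : ((⌊x⌋₊ + 1 : ℕ):ℝ) + 2 * x ^ ((9:ℝ)/20) ≤ 2 * x := by linarith
    refine h1.trans ?_
    have h2 := Sh_lower D0 R R (by linarith) hR1.le le_rfl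
    have h3 : ∑ s ∈ setsLe (fun i : QQ D0 R => i.1) R, ∏ i ∈ s, finv ({0} : Finset (ZMod i.1)) = ∑ s ∈ setsLe (fun i : QQ D0 R => i.1) R, ∏ i ∈ s, 1 / ((i.1:ℝ) - 1) := by
      refine sum_congr rfl fun s _ => prod_congr rfl fun i _ => ?_
      exact finv_one _ (card_singleton _)
    rw [h3]
    set S := ∑ s ∈ setsLe (fun i : QQ D0 R => i.1) R, ∏ i ∈ s, 1 / ((i.1:ℝ) - 1)
    rw [hlogR] at h2
    have h4 : (B.card:ℝ) * (16 * log x) ≤ CB * B.card * S := by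
      rw [hCBd]
      have : 640 * CM * log D0 * B.card * S = B.card * (640 * (CM * log D0 * S)) := by ring
      rw [this]
      refine mll ?_ (cast_nonneg _)
      linarith only [h2]
    linarith
  · intro i
    have h1 : √(D0:ℝ) ≤ √(i.1:ℝ) := sqrt_le_sqrt (hgtr i).le
    have h2 := mll h1 hs0.le
    have : 0 ≤ ((k:ℝ)+1)^2 := by positivity
    linarith
  · refine le_trans (le_of_eq ?_) htail2
    rw [mul_sum]
    refine sum_congr rfl fun i _ => ?_
    ring
  · rw [hs];
    have : (3/2) * (1 / (3 * (CA + CB))) * (CA + CB) = 1/2 := by field_simp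
    exact this.le
  · intro n hn
    have := hSlo (exp (2^n * L0)) (hy2.trans (exp_le_exp.2 (hnL n hn).1)) (hexpR _ (hnL n hn).2)
    rwa [Real.log_exp] at this
  · intro n hn
    have := hShi (exp (2^n * L0)) (exp_le_exp.2 (hnL n hn).1) (hexpR _ (hnL n hn).2)
    rwa [Real.log_exp] at this
  · have h1 : ∑ i : QQ D0 R, finv (Ω i.1) ^ 2 ≤ 9 * ∑ i : QQ D0 R, 1 / ((i.1:ℝ) * √i.1) := by
      rw [mul_sum]
      refine sum_le_sum fun i _ => ?_
      have hi := hgtr i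
      have hip : (0:ℝ) < i.1 := by linarith
      have h2 := finv_le (Ω i.1) (hcard i) (by have := hgt i; omega)
      have h3 : 0 ≤ finv (Ω i.1) := finv_nonneg _
      have h4 : finv (Ω i.1) ^ 2 ≤ (3 / (i.1:ℝ)) ^ 2 := pow_le_pow_left₀ h3 h2 2
      refine h4.trans ?_
      exact three_sq (i.1:ℝ) (le_trans (le_trans (by norm_num) hD0r) hi.le)
    have h2 := mll h1 (show 0 ≤ ((k:ℝ)+1)^2 by positivity)
    have h3 : 9 * (((k:ℝ)+1)^2 * ∑ i : QQ D0 R, 1 / ((i.1:ℝ) * √i.1)) ≤ 9 / 116 * s := by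
      clear_value s; clear * - htail2; linarith
    clear_value s; clear * - h2 h3 hs1; linarith
  · have e1 : C0 * (c * Λ) / (c * Λ) = C0 := by field_simp
    rw [e1]
    have e2 : (k:ℝ) * (4 * N0 * C0 * L0) = log R / 8 := by
      rw [hL0, hτ, hlogR]; field_simp; norm_num
    rw [e2]; linarith
  · have h1 : (N:ℝ) + k * ((⌊x⌋₊ + 1 : ℕ):ℝ) ≤ 3 * N := by
      have : (k:ℝ) * ((⌊x⌋₊ + 1 : ℕ):ℝ) ≤ k * (2 * x) := mll (by linarith) (by positivity)
      linarith
    have hK : (0:ℝ) ≤ K := cast_nonneg _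
    have h2 : 6 * (K:ℝ) * ((N:ℝ) + k * ((⌊x⌋₊ + 1 : ℕ):ℝ)) * (8 * (C0 * (c * Λ)) * L0) ≤ 6 * K * (3 * N) * (8 * (C0 * (c * Λ)) * L0) := by
      exact mlr (mll h1 (by linarith only [hK])) (by positivity)
    refine lt_of_le_of_lt h2 ?_
    have h3 : ρ * N * ((k:ℝ) * (N0 ^ 2 * (c ^ 2 * Λ * L0 * τ))) ≤ k * A.card * (N0 * (c * Λ * L0)) ^ 2 := by
      have := mlr hAc (show 0 ≤ (k:ℝ) * (N0 ^ 2 * (c ^ 2 * Λ * L0 * τ)) by positivity)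
      refine this.trans (le_of_eq ?_)
      rw [hL0]; ring
    refine lt_of_lt_of_le ?_ h3
    have e3 : ρ * N * ((k:ℝ) * (N0 ^ 2 * (c ^ 2 * Λ * L0 * τ))) = (ρ * c * N0) * (N * c * Λ * L0 / (1280 * C0)) := by
      rw [hτ]; field_simp
    have e4 : 6 * (K:ℝ) * (3 * N) * (8 * (C0 * (c * Λ)) * L0) = (144 * 1280 * K * C0 ^ 2) * (N * c * Λ * L0 / (1280 * C0)) := by
      field_simp; ring
    rw [e3, e4]
    exact mul_lt_mul_of_pos_right hN0' (by positivity)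

lemma mphi (M : ℕ) (hM : 1 ≤ M) : (M:ℝ) / M.totient = ∏ p ∈ M.primeFactors, (1 - 1 / (p:ℝ))⁻¹ := by
  have h := congrArg (fun q : ℚ => (q:ℝ)) (Nat.totient_eq_mul_prod_factors M)
  simp only [Rat.cast_natCast, Rat.cast_mul, Rat.cast_prod, Rat.cast_sub, Rat.cast_one, Rat.cast_inv] at h
  have hM0 : (0:ℝ) < M := by exact_mod_cast hM
  rw [h, prod_inv_distrib]
  simp only [one_div]
  rw [div_mul_eq_div_div, div_self hM0.ne', one_div]

lemma omega_le (M : ℕ) (hM : 1 ≤ M) (x : ℝ) (hx : 1 < x) (h : (M:ℝ) ≤ x ^ ((1:ℝ)/5)) : (M.primeFactors.card : ℝ) ≤ log x := by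
  have h1 : (2:ℕ) ^ M.primeFactors.card ≤ M := by
    refine le_trans ?_ (le_of_dvd hM (Nat.prod_primeFactors_dvd M))
    rw [← prod_const]
    exact Finset.prod_le_prod' fun p hp => (prime_of_mem_primeFactors hp).two_le
  have h2 : ((2:ℝ)) ^ M.primeFactors.card ≤ x ^ ((1:ℝ)/5) := le_trans (by exact_mod_cast h1) h
  have h3 := log_le_log (by positivity) h2
  rw [log_pow, log_rpow (by linarith)] at h3
  have := log_two_gt_d9
  have := log_pos hx
  have hc : (0:ℝ) ≤ M.primeFactors.card := by positivity
  nlinarith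

lemma pinv_exp {p : ℕ} (hp : p.Prime) : (1 - 1 / (p:ℝ))⁻¹ ≤ exp (2 / p) := by
  have h2 : (2:ℝ) ≤ p := by exact_mod_cast hp.two_le
  have := inv_ratio (u := 1/(p:ℝ)) (v := 0) (c := 2) (by positivity) (by norm_num) (by
    have : 1 / (p:ℝ) ≤ 1/2 := one_div_le_one_div_of_le (by norm_num) h2
    linarith)
  simpa [mul_one_div, div_eq_mul_inv] using this

lemma bigprod (P : Finset ℕ) (hP : ∀ p ∈ P, p.Prime) (D : ℝ) (hD : 0 < D) (h : ∀ p ∈ P, D < (p:ℝ)) (hc : (P.card:ℝ) ≤ D) :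
    ∏ p ∈ P, (1 - 1 / (p:ℝ))⁻¹ ≤ exp 2 := by
  calc ∏ p ∈ P, (1 - 1 / (p:ℝ))⁻¹ ≤ ∏ p ∈ P, exp (2 / D) := by
        refine prod_le_prod (fun p hp => le_trans zero_le_one (pinv_pos (hP p hp))) fun p hp => (pinv_exp (hP p hp)).trans ?_
        rw [exp_le_exp]
        exact div_le_div_of_nonneg_left (by norm_num) hD (h p hp).le
    _ = exp (P.card * (2 / D)) := by rw [prod_const, exp_nat_mul]
    _ ≤ exp 2 := by
        rw [exp_le_exp, mul_div_assoc', div_le_iff₀ hD]; linarith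

noncomputable def e1c : ℝ := CM * exp 2

lemma e1c_one : 1 ≤ e1c := by
  have hCM1 : 1 ≤ CM := by
    unfold CM; have := one_le_exp (show (0:ℝ) ≤ 4 by norm_num); linarith
  exact one_le_mul_of_one_le_of_one_le hCM1 (one_le_exp (by norm_num))

lemma prodDM (M : ℕ) (D : ℝ) (hD : 2 ≤ D) (hω : (M.primeFactors.card:ℝ) ≤ D) (P : Finset ℕ) (hP : ∀ p ∈ P, p.Prime ∧ ((p:ℝ) ≤ D ∨ p ∈ M.primeFactors)) :
    ∏ p ∈ P, (1 - 1 / (p:ℝ))⁻¹ ≤ e1c * log D := by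
  rw [← Finset.prod_filter_mul_prod_filter_not P (fun p : ℕ => (p:ℝ) ≤ D)]
  have h1 : ∏ p ∈ P.filter (fun p : ℕ => (p:ℝ) ≤ D), (1 - 1 / (p:ℝ))⁻¹ ≤ CM * log D := by
    refine le_trans ?_ (VV_le D hD)
    unfold VV
    refine prod_mono_mem ?_ _ (fun p hp => pinv_pos ((mem_Pr (by linarith)).1 hp).1)
    intro p hp
    rw [mem_filter] at hp
    exact (mem_Pr (by linarith)).2 ⟨(hP p hp.1).1, hp.2⟩
  have hsub : P.filter (fun p : ℕ => ¬ (p:ℝ) ≤ D) ⊆ M.primeFactors := by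
    intro p hp
    rw [mem_filter] at hp
    exact (hP p hp.1).2.resolve_left hp.2
  have h2 : ∏ p ∈ P.filter (fun p : ℕ => ¬ (p:ℝ) ≤ D), (1 - 1 / (p:ℝ))⁻¹ ≤ exp 2 := by
    refine bigprod _ (fun p hp => (hP p (mem_filter.1 hp).1).1) D (by linarith) (fun p hp => not_le.1 (mem_filter.1 hp).2) ?_
    refine le_trans ?_ hω
    exact_mod_cast card_le_card hsub
  calc _ ≤ (CM * log D) * exp 2 := mul_le_mul h1 h2 (prod_nonneg fun p hp => le_trans zero_le_one (pinv_pos (hP p (mem_filter.1 hp).1).1))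
        (mul_nonneg CM_pos.le (log_nonneg (by linarith)))
    _ = _ := by rw [e1c]; ring

noncomputable def VD (M : ℕ) (D y : ℝ) : Finset ℕ := (Pr y).filter fun p => D < (p:ℝ) ∧ ¬ p ∣ M

lemma mem_VD {M : ℕ} {D y : ℝ} (hy : 0 ≤ y) {p : ℕ} : p ∈ VD M D y ↔ p.Prime ∧ (p:ℝ) ≤ y ∧ D < p ∧ ¬ p ∣ M := by
  rw [VD, mem_filter, mem_Pr hy, and_assoc]

lemma VD_E1 (M : ℕ) (hM : 1 ≤ M) (D y : ℝ) (hD : 2 ≤ D) (hy : 0 ≤ y) (hω : (M.primeFactors.card:ℝ) ≤ D) :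
    ∏ p ∈ Pr y \ VD M D y, (1 - 1 / (p:ℝ))⁻¹ ≤ e1c * log D := by
  refine prodDM M D hD hω _ fun p hp => ?_
  rw [Finset.mem_sdiff, mem_Pr hy, mem_VD hy] at hp
  refine ⟨hp.1.1, ?_⟩
  by_contra hc
  push Not at hc
  refine hp.2 ⟨hp.1.1, hp.1.2, hc.1, fun hd => hc.2 ?_⟩
  exact mem_primeFactors.2 ⟨hp.1.1, hd, by omega⟩

lemma VD_E2 (M : ℕ) (D y : ℝ) (hD : 2 ≤ D) (hDy : D ≤ y) :
    ∏ p ∈ VD M D y, (1 - 1 / (p:ℝ))⁻¹ ≤ e1c * log y / log D := by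
  have hlD : 0 < log D := log_pos (by linarith)
  have hly : 0 ≤ log y := log_nonneg (by linarith)
  have hy : 0 ≤ y := by linarith
  rw [le_div_iff₀ hlD]
  have h0 : 0 ≤ ∏ p ∈ VD M D y, (1 - 1 / (p:ℝ))⁻¹ := prod_nonneg fun p hp => le_trans zero_le_one (pinv_pos ((mem_VD hy).1 hp).1)
  have hdis : Disjoint (VD M D y) (Pr D) := by
    rw [disjoint_left]
    intro p h1 h2
    have := ((mem_VD hy).1 h1).2.2.1
    have := ((mem_Pr (by linarith)).1 h2).2
    linarith
  calc (∏ p ∈ VD M D y, (1 - 1 / (p:ℝ))⁻¹) * log D ≤ (∏ p ∈ VD M D y, (1 - 1 / (p:ℝ))⁻¹) * VV D :=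
        mll (log_le_VV D (by linarith)) h0
    _ ≤ VV y := by
        unfold VV
        rw [← prod_union hdis]
        refine prod_mono_mem ?_ _ (fun p hp => pinv_pos ((mem_Pr hy).1 hp).1)
        refine Finset.union_subset (filter_subset _ _) ?_
        intro p hp
        have := (mem_Pr (by linarith)).1 hp
        exact (mem_Pr hy).2 ⟨this.1, this.2.trans hDy⟩
    _ ≤ CM * log y := VV_le y (by linarith)
    _ ≤ e1c * log y := by
        refine mlr ?_ hly
        exact le_mul_of_one_le_right CM_pos.le (one_le_exp (by norm_num))

lemma VD_E3 (M : ℕ) (hM : 1 ≤ M) (D y : ℝ) (hD : 2 ≤ D) (hy : 1 < y) (hω : (M.primeFactors.card:ℝ) ≤ D) :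
    ∏ p ∈ VD M D y, (1 - 1 / (p:ℝ)) ≤ e1c * log D / log y := by
  have hly : 0 < log y := log_pos hy
  have h1 := VD_E1 M hM D y hD (by linarith) hω
  have h2 := log_le_VV y hy.le
  have hsub : VD M D y ⊆ Pr y := filter_subset _ _
  unfold VV at h2
  rw [← prod_sdiff hsub] at h2
  have e : ∏ p ∈ VD M D y, (1 - 1 / (p:ℝ)) = (∏ p ∈ VD M D y, (1 - 1 / (p:ℝ))⁻¹)⁻¹ := by
    rw [prod_inv_distrib, inv_inv]
  rw [e]
  set b := ∏ p ∈ VD M D y, (1 - 1 / (p:ℝ))⁻¹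
  have hb : 0 < b := prod_pos fun p hp => lt_of_lt_of_le zero_lt_one (pinv_pos ((mem_VD (by linarith)).1 hp).1)
  rw [inv_eq_one_div, div_le_div_iff₀ hb hly, one_mul]
  exact h2.trans (mlr h1 hb.le)

lemma mphi_le (M : ℕ) (hM : 1 ≤ M) (D : ℝ) (hD : 2 ≤ D) (hω : (M.primeFactors.card:ℝ) ≤ D) : (M:ℝ) / M.totient ≤ e1c * log D := by
  rw [mphi M hM]
  exact prodDM M D hD hω _ fun p hp => ⟨prime_of_mem_primeFactors hp, Or.inr hp⟩

open Filter

lemma theta_Pr (x : ℝ) : Chebyshev.theta x = ∑ p ∈ Pr x, log p := by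
  rw [Chebyshev.theta_eq_sum_Icc, Pr]
  refine sum_congr ?_ fun _ _ => rfl
  ext p; simp [lt_succ_iff]

noncomputable def B0 (x : ℝ) : Finset ℕ := (Pr x).filter fun p : ℕ => x / 4 < (p:ℝ)

lemma B0_card : ∀ᶠ x : ℝ in atTop, x ≤ (B0 x).card * (4 * log x) := by
  have a1 : Tendsto (fun x : ℝ => log x / x ^ ((1:ℝ)/2)) atTop (nhds 0) :=
    (isLittleO_log_rpow_atTop (by norm_num)).tendsto_div_nhds_zero
  filter_upwards [eventually_gt_atTop 1000, a1.eventually (gt_mem_nhds (show (0:ℝ) < 1/100 by norm_num))] with x hx h1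
  have hx0 : 0 < x := by linarith
  rw [← sqrt_eq_rpow, div_lt_iff₀ (sqrt_pos.2 hx0)] at h1
  have hlx : 0 < log x := log_pos (by linarith)
  have h2 := Chebyshev.theta_ge' (x := x) (by linarith)
  have h3 := Chebyshev.theta_le_log4_mul_x (x := x/4) (by linarith)
  have h4 : log 4 = 2 * log 2 := by
    rw [show (4:ℝ) = 2 ^ 2 by norm_num, log_pow]; norm_num
  have hsq : √x * √x = x := mul_self_sqrt hx0.le
  have hs : 30 ≤ √x := by rw [Real.le_sqrt (by norm_num) hx0.le]; linarith
  have h5 : log (x + 2) ≤ 2 * log x := by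
    rw [← log_rpow hx0]
    refine log_le_log (by linarith) ?_
    norm_num; nlinarith
  have h6 : Chebyshev.theta x = ∑ p ∈ B0 x, log p + Chebyshev.theta (x/4) := by
    rw [theta_Pr, theta_Pr, ← Finset.sum_filter_add_sum_filter_not (Pr x) (fun p : ℕ => x / 4 < (p:ℝ))]
    congr 1
    refine sum_congr ?_ fun _ _ => rfl
    ext p
    rw [mem_filter, mem_Pr hx0.le, mem_Pr (by linarith), not_lt]
    constructor
    · rintro ⟨⟨a, b⟩, c⟩; exact ⟨a, c⟩
    · rintro ⟨a, c⟩; exact ⟨⟨a, by linarith⟩, c⟩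
  have h7 : ∑ p ∈ B0 x, log p ≤ (B0 x).card * log x := by
    rw [← nsmul_eq_mul]
    refine Finset.sum_le_card_nsmul _ _ _ fun p hp => ?_
    have := (mem_Pr hx0.le).1 (mem_filter.1 hp).1
    exact log_le_log (by exact_mod_cast this.1.pos) this.2
  have h8 := log_two_gt_d9
  have h9 := log_two_lt_d9
  have h10 : √x * log x ≤ x / 100 := by nlinarith
  have h11 : log x ≤ x / 1000 := by nlinarith
  nlinarith

lemma Pr_card (t : ℝ) : (Pr t).card = Nat.primeCounting ⌊t⌋₊ := by
  rw [Nat.primeCounting, Nat.primeCounting', Nat.count_eq_card_filter_range, Pr]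

lemma Pr_bd : ∃ t0 : ℝ, 1 < t0 ∧ ∀ t ≥ t0, ((Pr t).card : ℝ) ≤ 2 * t / log t := by
  have h := Chebyshev.eventually_primeCounting_le (ε := 1/2) (by norm_num)
  obtain ⟨t0, h0⟩ := eventually_atTop.1 (h.and (eventually_gt_atTop 2))
  refine ⟨max t0 2, lt_of_lt_of_le (by norm_num) (le_max_right _ _), fun t ht => ?_⟩
  obtain ⟨h1, h2⟩ := h0 t (le_trans (le_max_left _ _) ht)
  rw [Pr_card]
  refine h1.trans ?_
  have hl : 0 < log t := log_pos (by linarith)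
  have h9 := log_two_lt_d9
  have h4 : log 4 = 2 * log 2 := by
    rw [show (4:ℝ) = 2 ^ 2 by norm_num, log_pow]; norm_num
  gcongr
  linarith

noncomputable def GG (M : ℕ) (G : ℝ) : Finset ℕ := (Icc 1 ⌊G⌋₊).filter fun g => ∀ p : ℕ, p.Prime → p ∣ g → p ∣ M

lemma mem_GG {M : ℕ} {G : ℝ} (hG : 0 ≤ G) {g : ℕ} : g ∈ GG M G ↔ 1 ≤ g ∧ (g:ℝ) ≤ G ∧ ∀ p : ℕ, p.Prime → p ∣ g → p ∣ M := by
  rw [GG, mem_filter, mem_Icc, le_floor_iff hG, and_assoc]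

lemma GG_sum (M : ℕ) (hM : 1 ≤ M) (G : ℝ) (hG : 0 ≤ G) : ∑ g ∈ GG M G, (1:ℝ) / g ≤ (M:ℝ) / M.totient := by
  rw [mphi M hM]
  refine fac_sum_one _ _ (fun p hp => prime_of_mem_primeFactors hp) fun g hg => ?_
  rw [mem_GG hG] at hg
  exact ⟨by omega, fun p hp hd => mem_primeFactors.2 ⟨hp, hg.2.2 p hp hd, by omega⟩⟩

lemma GG_log (M : ℕ) (hM : 1 ≤ M) (G : ℝ) (hG : 0 ≤ G) : ∑ g ∈ GG M G, log g ≤ 6 * G * ((M:ℝ) / M.totient) := by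
  have h1 : ∀ g ∈ GG M G, log g = ∑ x ∈ g.divisorsAntidiagonal, ArithmeticFunction.vonMangoldt x.1 := by
    intro g _
    rw [← ArithmeticFunction.vonMangoldt_sum, ← Nat.map_div_right_divisors, Finset.sum_map]
    rfl
  rw [sum_congr rfl h1, sum_sigma']
  have h2 : ∑ x ∈ (GG M G).sigma (fun g => g.divisorsAntidiagonal), ArithmeticFunction.vonMangoldt x.2.1 ≤
      ∑ x ∈ (GG M G).sigma (fun h => Ioc 0 ⌊G / h⌋₊), ArithmeticFunction.vonMangoldt x.2 := by
    have hinj : Set.InjOn (fun x : (Σ _ : ℕ, ℕ × ℕ) => (⟨x.2.2, x.2.1⟩ : Σ _ : ℕ, ℕ)) ((GG M G).sigma (fun g => g.divisorsAntidiagonal) : Finset (Σ _ : ℕ, ℕ × ℕ)) := by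
      rintro ⟨a, b, c⟩ ha ⟨a', b', c'⟩ ha' heq
      simp only [Finset.coe_sigma, Set.mem_sigma_iff, mem_coe, Nat.mem_divisorsAntidiagonal] at ha ha'
      simp only [Sigma.mk.injEq, heq_eq_eq] at heq
      obtain ⟨rfl, rfl⟩ := heq
      have : a = a' := ha.2.1.symm.trans ha'.2.1
      subst this; rfl
    rw [← sum_image (f := fun x : (Σ _ : ℕ, ℕ) => ArithmeticFunction.vonMangoldt x.2) hinj]
    refine sum_le_sum_of_subset_of_nonneg ?_ fun x _ _ => ArithmeticFunction.vonMangoldt_nonneg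
    intro x hx
    rw [mem_image] at hx
    obtain ⟨⟨g, d, h⟩, hx, rfl⟩ := hx
    rw [mem_sigma, Nat.mem_divisorsAntidiagonal, mem_GG hG] at hx
    obtain ⟨⟨hg1, hg2, hg3⟩, hd, -⟩ := hx
    simp only at hg1 hg2 hg3 hd
    have hh : 0 < h := Nat.pos_of_ne_zero fun h0 => by subst h0; simp at hd; omega
    have hd0 : 0 < d := Nat.pos_of_ne_zero fun h0 => by subst h0; simp at hd; omega
    have hhr : (0:ℝ) < h := by exact_mod_cast hh
    have hdr : (1:ℝ) ≤ d := by exact_mod_cast hd0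
    have hdh : (d:ℝ) * h ≤ G := by rw [← hd] at hg2; exact_mod_cast hg2
    simp only [mem_sigma, mem_Ioc, mem_GG hG]
    refine ⟨⟨hh, by nlinarith, fun p hp hpd => hg3 p hp (hd ▸ hpd.mul_left d)⟩, hd0, ?_⟩
    rw [le_floor_iff (by positivity), le_div_iff₀ hhr]
    exact hdh
  refine h2.trans ?_
  rw [Finset.sum_sigma]
  have h3 : ∀ h ∈ GG M G, ∑ d ∈ Ioc 0 ⌊G / (h:ℝ)⌋₊, ArithmeticFunction.vonMangoldt d ≤ 6 * G * (1 / (h:ℝ)) := by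
    intro h _
    have := Chebyshev.psi_le_const_mul_self (x := G / h) (by positivity)
    unfold Chebyshev.psi at this
    refine this.trans ?_
    have h9 := log_two_lt_d9
    have h4 : log 4 = 2 * log 2 := by
      rw [show (4:ℝ) = 2 ^ 2 by norm_num, log_pow]; norm_num
    rw [mul_assoc, mul_one_div]
    exact mlr (by linarith) (by positivity)
  refine (sum_le_sum h3).trans ?_
  rw [← mul_sum]
  exact mll (GG_sum M hM G hG) (by positivity)

lemma GG_low (M : ℕ) (hM : 1 ≤ M) (G0 G : ℝ) (hG0 : 1 < G0) (hG : 0 ≤ G) :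
    ∑ g ∈ (GG M G).filter (fun g : ℕ => G0 < (g:ℝ)), (1:ℝ) / g ≤ 6 * G / (G0 * log G0) * ((M:ℝ) / M.totient) := by
  have hl : 0 < log G0 := log_pos hG0
  have h := GG_log M hM G hG
  calc ∑ g ∈ (GG M G).filter (fun g : ℕ => G0 < (g:ℝ)), (1:ℝ) / g
      ≤ ∑ g ∈ (GG M G).filter (fun g : ℕ => G0 < (g:ℝ)), log g / (G0 * log G0) := by
        refine sum_le_sum fun g hg => ?_
        have hg := (mem_filter.1 hg).2
        have hg0 : (0:ℝ) < g := by linarith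
        rw [div_le_div_iff₀ hg0 (by positivity)]
        have : log G0 ≤ log g := log_le_log (by linarith) hg.le
        nlinarith
    _ ≤ ∑ g ∈ GG M G, log g / (G0 * log G0) := by
        refine sum_le_sum_of_subset_of_nonneg (filter_subset _ _) fun g _ _ => ?_
        have := Real.log_natCast_nonneg g
        positivity
    _ = (∑ g ∈ GG M G, log g) / (G0 * log G0) := by rw [sum_div]
    _ ≤ (6 * G * ((M:ℝ) / M.totient)) / (G0 * log G0) := by gcongr
    _ = _ := by ring

open Filter

lemma smooth_count (c : ℝ) : ∀ᶠ x : ℝ in atTop, ∀ M : ℕ, (M.primeFactors.card:ℝ) ≤ log x → 1 ≤ M → ∀ y : ℝ, 0 < y → log y = log x * log (log (log x)) / (8 * log (log x)) → ∀ S : Finset ℕ, (∀ n ∈ S, 1 ≤ n ∧ (n:ℝ) ≤ x * log x ∧ ∀ p : ℕ, p.Prime → p ∣ n → (p:ℝ) ≤ y ∨ p ∣ M) → S.card * (c * log x) ≤ x := by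
  have t1 : Tendsto log atTop atTop := tendsto_log_atTop
  have t2 := t1.comp t1
  have a1 : Tendsto (fun l : ℝ => log l / l ^ ((1:ℝ)/2)) atTop (nhds 0) :=
    (isLittleO_log_rpow_atTop (by norm_num)).tendsto_div_nhds_zero
  have a2 : Tendsto (fun l : ℝ => exp l / l ^ 2) atTop atTop := Real.tendsto_exp_div_pow_atTop 2
  have a3 : Tendsto (fun l : ℝ => exp (l / 2)) atTop atTop :=
    Real.tendsto_exp_atTop.comp (tendsto_id.atTop_div_const (by norm_num))
  have b1 := t2.eventually (a1.eventually (gt_mem_nhds (show (0:ℝ) < 1/8 by norm_num)))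
  have b2 := t2.eventually (a2.eventually_ge_atTop 16)
  have b3 := t2.eventually (a3.eventually_ge_atTop (|c| * (CM * exp 4)))
  have b4 := t2.eventually (eventually_ge_atTop (3:ℝ))
  filter_upwards [b1, b2, b3, b4, eventually_gt_atTop 1] with x b1 b2 b3 b4 hx1 M hω hM y hy0 hy S hS
  simp only [Function.comp_apply] at b1 b2 b3 b4
  have hx0 : 0 < x := by linarith
  set L := log x with hL
  set l := log L with hl
  have hL0 : 0 < L := log_pos hx1
  have hel : exp l = L := exp_log hL0
  set l3 := log l with hl3
  have hl31 : 1 ≤ l3 := by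
    rw [hl3, le_log_iff_exp_le (by linarith)]; linarith [exp_one_lt_d9]
  rw [hel, le_div_iff₀ (by positivity)] at b2
  rw [← sqrt_eq_rpow, div_lt_iff₀ (sqrt_pos.2 (by linarith))] at b1
  have hl0 : 0 < l := by linarith
  have h1 : 8 * l * log y = L * l3 := by rw [hy]; field_simp
  have h2 : 2 * l ≤ log y := by
    have : 8 * l * (2 * l) ≤ 8 * l * log y := by
      rw [h1]; nlinarith [mll hl31 hL0.le]
    exact lml this (by linarith)
  have hl3l : l3 ≤ l := by
    have := log_le_sub_one_of_pos hl0; linarith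
  have h3 : log y ≤ L := by
    have : 8 * l * log y ≤ 8 * l * L := by
      rw [h1]; nlinarith only [mll hl3l hL0.le, mul_pos hL0 hl0]
    exact lml this (by linarith)
  have hy2 : 2 ≤ y := by
    have := log_le_sub_one_of_pos hy0; linarith
  set s := 4 * l / L with hs
  have hsL : s * L = 4 * l := by rw [hs]; field_simp
  have hs0 : 0 < s := by positivity
  have hs2 : s ≤ 1/2 := by
    rw [hs, div_le_iff₀ hL0]; nlinarith
  have hsy : s * log y = l3 / 2 := by
    have : 2 * L * (s * log y) = 2 * L * (l3 / 2) := by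
      calc 2 * L * (s * log y) = 2 * (s * L) * log y := by ring
        _ = 8 * l * log y := by rw [hsL]; ring
        _ = _ := by rw [h1]; ring
    exact mul_left_cancel₀ (by positivity) this
  have hpow : ∀ p : ℕ, p.Prime → ((p:ℝ) ^ (1 - s))⁻¹ = 1 / p * exp (s * log p) := by
    intro p hp
    have hp0 : (0:ℝ) < p := by exact_mod_cast hp.pos
    rw [← rpow_neg hp0.le, show -(1 - s) = -1 + s by ring, rpow_add hp0, Real.rpow_neg_one, rpow_def_of_pos hp0 s, mul_comm s]
    simp
  have hhalf : ∀ z p : ℝ, 0 < z → z ≤ p → (p ^ (1 - s))⁻¹ ≤ (z ^ (1 - s))⁻¹ := by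
    intro z p hz hzp
    exact inv_anti₀ (rpow_pos_of_pos hz _) (Real.rpow_le_rpow hz.le hzp (by linarith))
  have hhalf' : ∀ z : ℝ, 1 ≤ z → (z ^ (1 - s))⁻¹ ≤ exp (-(log z / 2)) := by
    intro z hz
    rw [← rpow_neg (by linarith), rpow_def_of_pos (by linarith), exp_le_exp]
    nlinarith only [mll hs2 (log_nonneg hz)]
  have hquart : ∀ p : ℕ, p.Prime → 1 / 4 ≤ 1 - ((p:ℝ) ^ (1 - s))⁻¹ := by
    intro p hp
    have h := (hhalf 2 p (by norm_num) (by exact_mod_cast hp.two_le)).trans (hhalf' 2 (by norm_num))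
    have : exp (-(log 2 / 2)) ≤ 3 / 4 := by
      rw [← le_log_iff_exp_le (by norm_num)]
      have e : log (3/4) = -(log (16/9) / 2) := by
        rw [show (16/9 : ℝ) = ((3/4)^2)⁻¹ by norm_num, Real.log_inv, log_pow]; push_cast; ring
      rw [e]
      have := log_le_log (by norm_num) (show (16/9:ℝ) ≤ 2 by norm_num)
      linarith
    linarith
  have hpos : ∀ p : ℕ, p.Prime → 0 ≤ (1 - ((p:ℝ) ^ (1 - s))⁻¹)⁻¹ := fun p hp => inv_nonneg.2 (by linarith [hquart p hp])

  have p1 : ∏ p ∈ Pr y, (1 - ((p:ℝ) ^ (1 - s))⁻¹)⁻¹ ≤ CM * L * exp (l / 2) := by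
    calc ∏ p ∈ Pr y, (1 - ((p:ℝ) ^ (1 - s))⁻¹)⁻¹
        ≤ ∏ p ∈ Pr y, ((1 - 1 / (p:ℝ))⁻¹ * exp (4 * (s * exp (l3/2)) * (log p / p))) := by
          refine prod_le_prod (fun p hp => hpos p ((mem_Pr hy0.le).1 hp).1) fun p hp => ?_
          obtain ⟨hpp, hpy⟩ := (mem_Pr hy0.le).1 hp
          have hp0 : (1:ℝ) ≤ p := by exact_mod_cast hpp.one_le
          have hlp : 0 ≤ s * log p := mul_nonneg hs0.le (log_nonneg hp0)
          have hv : 1 / (p:ℝ) ≤ ((p:ℝ) ^ (1 - s))⁻¹ := by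
            rw [hpow p hpp]
            exact le_mul_of_one_le_right (by positivity) (one_le_exp hlp)
          refine (inv_ratio hv (c := 4) (by norm_num) (hquart p hpp)).trans ?_
          refine mll (exp_le_exp.2 ?_) (le_trans zero_le_one (pinv_pos hpp))
          rw [hpow p hpp]
          have e1 : exp (s * log p) - 1 ≤ s * log p * exp (s * log p) := by
            have := add_one_le_exp (-(s * log p))
            have e : exp (-(s * log p)) * exp (s * log p) = 1 := by rw [← exp_add]; simp
            nlinarith only [mlr this (exp_pos (s * log p)).le, e]
          have e2 : exp (s * log p) ≤ exp (l3/2) := by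
            rw [exp_le_exp, ← hsy]
            exact mll (log_le_log (by linarith) hpy) hs0.le
          have e3 : exp (s * log p) - 1 ≤ s * log p * exp (l3/2) := e1.trans (mll e2 hlp)
          calc 4 * (1 / (p:ℝ) * exp (s * log p) - 1 / p) = 4 * (1 / p) * (exp (s * log p) - 1) := by ring
            _ ≤ 4 * (1 / p) * (s * log p * exp (l3/2)) := mll e3 (by positivity)
            _ = _ := by ring
      _ = VV y * exp (4 * (s * exp (l3/2)) * ∑ p ∈ Pr y, log p / p) := by
          rw [prod_mul_distrib, ← exp_sum, mul_sum]; rfl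
      _ ≤ (CM * L) * exp (l / 2) := by
          refine mul_le_mul ((VV_le y hy2).trans (mll h3 CM_pos.le)) (exp_le_exp.2 ?_) (exp_pos _).le (mul_nonneg CM_pos.le hL0.le)
          have e0 : exp (l3/2) = √l := by
            rw [sqrt_eq_rpow, rpow_def_of_pos hl0]; congr 1; ring
          have hss : √l * √l = l := mul_self_sqrt hl0.le
          calc _ ≤ 4 * (s * exp (l3/2)) * (2 * log y) := mll (sum_logp y (by linarith)) (by positivity)
            _ = 8 * (s * log y) * exp (l3/2) := by ring
            _ = 4 * l3 * √l := by rw [hsy, e0]; ring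
            _ ≤ 4 * (1/8 * √l) * √l := by gcongr
            _ = l / 2 := by linear_combination hss / 2
  have p2 : ∏ p ∈ M.primeFactors.filter (fun p : ℕ => y < (p:ℝ)), (1 - ((p:ℝ) ^ (1 - s))⁻¹)⁻¹ ≤ exp 4 := by
    calc _ ≤ ∏ p ∈ M.primeFactors.filter (fun p : ℕ => y < (p:ℝ)), exp (4 * exp (-l)) := by
          refine prod_le_prod (fun p hp => hpos p (prime_of_mem_primeFactors (mem_filter.1 hp).1)) fun p hp => ?_
          obtain ⟨hp, hpy⟩ := mem_filter.1 hp
          have hpp := prime_of_mem_primeFactors hp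
          have := inv_ratio (u := ((p:ℝ) ^ (1 - s))⁻¹) (v := 0) (by positivity) (c := 4) (by norm_num) (hquart p hpp)
          rw [sub_zero, inv_one, one_mul, sub_zero] at this
          refine this.trans (exp_le_exp.2 (mll ?_ (by norm_num)))
          refine ((hhalf y p hy0 hpy.le).trans (hhalf' y (by linarith))).trans (exp_le_exp.2 ?_)
          linarith
      _ = exp ((M.primeFactors.filter (fun p : ℕ => y < (p:ℝ))).card * (4 * exp (-l))) := by
          rw [prod_const, exp_nat_mul]
      _ ≤ exp 4 := by
          rw [exp_le_exp]
          have hc : ((M.primeFactors.filter (fun p : ℕ => y < (p:ℝ))).card : ℝ) ≤ L :=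
            le_trans (by exact_mod_cast Finset.card_filter_le _ _) hω
          refine (mlr hc (by positivity)).trans ?_
          rw [Real.exp_neg, hel]
          apply le_of_eq; field_simp
  set P := Pr y ∪ M.primeFactors.filter (fun p : ℕ => y < (p:ℝ)) with hP
  have hPp : ∀ p ∈ P, p.Prime := by
    intro p hp
    rw [hP, mem_union] at hp
    rcases hp with hp | hp
    · exact ((mem_Pr hy0.le).1 hp).1
    · exact prime_of_mem_primeFactors (mem_filter.1 hp).1
  have hdis : Disjoint (Pr y) (M.primeFactors.filter (fun p : ℕ => y < (p:ℝ))) := by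
    rw [disjoint_left]
    intro p h1 h2
    exact absurd ((mem_Pr hy0.le).1 h1).2 (not_le.2 (mem_filter.1 h2).2)
  have hsum := fac_sum_le (1 - s) (by linarith) P S hPp fun n hn => by
    obtain ⟨h1, -, h3⟩ := hS n hn
    refine ⟨by omega, fun p hp hd => ?_⟩
    rw [hP, mem_union]
    by_cases hpy : (p:ℝ) ≤ y
    · exact Or.inl ((mem_Pr hy0.le).2 ⟨hp, hpy⟩)
    · refine Or.inr (mem_filter.2 ⟨mem_primeFactors.2 ⟨hp, (h3 p hp hd).resolve_left hpy, by omega⟩, not_le.1 hpy⟩)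
  rw [hP, prod_union hdis] at hsum
  have hsum2 := hsum.trans (mul_le_mul p1 p2 (prod_nonneg fun p hp => hpos p (hPp p (by rw [hP, mem_union]; exact Or.inr hp))) (mul_nonneg (mul_nonneg CM_pos.le hL0.le) (exp_pos _).le))
  have hlow : ∀ n ∈ S, ((x * L) ^ (1 - s))⁻¹ ≤ ((n:ℝ) ^ (1 - s))⁻¹ := fun n hn =>
    hhalf n _ (by exact_mod_cast (hS n hn).1) (hS n hn).2.1
  have hcard := (Finset.card_nsmul_le_sum _ _ _ hlow).trans hsum2
  rw [nsmul_eq_mul] at hcard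
  have hU : (x * L) ^ (1 - s) ≤ x * exp (-3 * l) := by
    have hxe : x = exp L := (exp_log hx0).symm
    rw [rpow_def_of_pos (by positivity), Real.log_mul hx0.ne' hL0.ne', ← hL, ← hl]
    have e : x * exp (-3 * l) = exp (L + -3 * l) := by rw [exp_add, ← hxe]
    rw [e, exp_le_exp]
    nlinarith only [hsL, mul_pos hs0 hl0]
  have hUp : 0 < (x * L) ^ (1 - s) := rpow_pos_of_pos (by positivity) _
  rw [← div_eq_mul_inv, div_le_iff₀ hUp] at hcard
  have hcard2 : (S.card:ℝ) ≤ CM * L * exp (l / 2) * exp 4 * (x * exp (-3 * l)) :=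
    hcard.trans (mll hU (by have := CM_pos; positivity))
  calc (S.card:ℝ) * (c * L) ≤ S.card * (|c| * L) := by gcongr; exact le_abs_self c
    _ ≤ CM * L * exp (l / 2) * exp 4 * (x * exp (-3 * l)) * (|c| * L) := mlr hcard2 (by positivity)
    _ = (|c| * (CM * exp 4)) * (L * L * exp (l / 2) * exp (-3 * l) * x) := by ring
    _ ≤ exp (l / 2) * (L * L * exp (l / 2) * exp (-3 * l) * x) := mlr b3 (by positivity)
    _ = exp (l / 2 + l + l + l / 2 + (-3 * l)) * x := by rw [← hel]; simp only [exp_add]; ring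
    _ = x := by rw [show l / 2 + l + l + l / 2 + (-3 * l) = 0 by ring, Real.exp_zero, one_mul]

lemma greedy (T : Finset ℕ) (w : ℕ → ℝ) (hw : ∀ n, 0 ≤ w n) (V : Finset ℕ) (hV : ∀ p ∈ V, p.Prime) (hT : ∀ n ∈ T, ∀ p ∈ V, ¬ p ∣ n) :
    ∃ a : ℕ → ℕ, (∀ p ∈ V, ¬ p ∣ a p) ∧
      ∑ n ∈ T.filter (fun n => ∀ p ∈ V, n % p ≠ a p % p), w n ≤ (∏ p ∈ V, (1 - 1 / (p:ℝ))) * ∑ n ∈ T, w n := by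
  induction V using Finset.induction_on with
  | empty => exact ⟨fun _ => 0, by simp, by simp⟩
  | insert p V hp ih =>
    obtain ⟨a, ha, hs⟩ := ih (fun q hq => hV q (Finset.mem_insert_of_mem hq)) (fun n hn q hq => hT n hn q (Finset.mem_insert_of_mem hq))
    have hpp := hV p (Finset.mem_insert_self p V)
    set R := T.filter (fun n => ∀ p ∈ V, n % p ≠ a p % p) with hR
    have hp0 : (0:ℝ) < p := by exact_mod_cast hpp.pos
    have hfib : ∑ c ∈ Finset.Ioo 0 p, ∑ n ∈ R.filter (fun n => n % p = c), w n = ∑ n ∈ R, w n := by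
      refine sum_fiberwise_of_maps_to (fun n hn => ?_) _
      rw [mem_Ioo]
      refine ⟨Nat.pos_of_ne_zero fun h => hT n (mem_filter.1 hn).1 p (Finset.mem_insert_self p V) (Nat.dvd_of_mod_eq_zero h), mod_lt _ hpp.pos⟩
    have hR0 : 0 ≤ ∑ n ∈ R, w n := sum_nonneg fun n _ => hw n
    obtain ⟨c, hc, hcs⟩ := exists_le_of_sum_le (s := Finset.Ioo 0 p) (f := fun _ => (∑ n ∈ R, w n) / p)
      (g := fun c => ∑ n ∈ R.filter (fun n => n % p = c), w n) ⟨1, mem_Ioo.2 ⟨one_pos, hpp.one_lt⟩⟩ (by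
        rw [hfib, sum_const, nsmul_eq_mul, mul_div_assoc', div_le_iff₀ hp0, mul_comm]
        refine mll ?_ hR0
        simp)
    rw [mem_Ioo] at hc
    refine ⟨Function.update a p c, ?_, ?_⟩
    · intro q hq
      rcases mem_insert.1 hq with rfl | hq'
      · rw [Function.update_self]; exact Nat.not_dvd_of_pos_of_lt hc.1 hc.2
      · rw [Function.update_of_ne (by rintro rfl; exact hp hq')]; exact ha q hq'
    · have e : T.filter (fun n => ∀ q ∈ insert p V, n % q ≠ Function.update a p c q % q) = R.filter (fun n => ¬ n % p = c) := by
        ext n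
        rw [hR, mem_filter, mem_filter, mem_filter, Finset.forall_mem_insert, Function.update_self, Nat.mod_eq_of_lt hc.2, and_assoc]
        have : (∀ q ∈ V, n % q ≠ Function.update a p c q % q) ↔ ∀ q ∈ V, n % q ≠ a q % q := by
          refine forall₂_congr fun q hq => ?_
          rw [Function.update_of_ne (by rintro rfl; exact hp hq)]
        rw [this]; tauto
      rw [e, Finset.prod_insert hp]
      have h1 := Finset.sum_filter_add_sum_filter_not R (fun n => n % p = c) w
      have h2 : (1 - 1 / (p:ℝ)) * ∑ n ∈ R, w n ≤ (1 - 1 / (p:ℝ)) * ((∏ p ∈ V, (1 - 1 / (p:ℝ))) * ∑ n ∈ T, w n) := by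
        refine mll hs ?_
        have : 1 / (p:ℝ) ≤ 1 := by rw [div_le_one hp0]; exact_mod_cast hpp.one_le
        linarith
      rw [mul_assoc]
      refine le_trans ?_ h2
      rw [sub_mul, one_mul, div_mul_eq_mul_div, one_mul]
      linarith

lemma cover_small (T : Finset ℕ) : ∀ B : Finset ℕ, T.card ≤ B.card → ∃ a : ℕ → ℕ, ∀ n ∈ T, ∃ q ∈ B, n % q = a q % q := by
  induction T using Finset.induction_on with
  | empty => exact fun B _ => ⟨fun _ => 0, by simp⟩
  | insert n T hn ih =>
    intro B hB
    rw [Finset.card_insert_of_notMem hn] at hB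
    obtain ⟨q, hq⟩ := card_pos.1 (show 0 < B.card by omega)
    obtain ⟨a, ha⟩ := ih (B.erase q) (by rw [card_erase_of_mem hq]; omega)
    refine ⟨Function.update a q n, fun m hm => ?_⟩
    rcases mem_insert.1 hm with rfl | hm
    · exact ⟨q, hq, by rw [Function.update_self]⟩
    · obtain ⟨r, hr, h⟩ := ha m hm
      exact ⟨r, Finset.mem_of_mem_erase hr, by rw [Function.update_of_ne (ne_of_mem_erase hr)]; exact h⟩

lemma cover_loop (L b : ℝ) (hL : 0 ≤ L) (hb : 0 ≤ b) (K : ℕ) (hK : 1 ≤ K) (T B : Finset ℕ)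
    (H : ∀ T' ⊆ T, ∀ B' ⊆ B, L < (T'.card : ℝ) → b ≤ (B'.card:ℝ) → ∃ q ∈ B', ∃ a : ℕ, K ≤ (T'.filter fun n => n % q = a % q).card)
    (hc : b + (T.card:ℝ) / K + L ≤ B.card) : ∃ a : ℕ → ℕ, ∀ n ∈ T, ∃ q ∈ B, n % q = a q % q := by
  have key : ∀ N : ℕ, ∀ T' ⊆ T, T'.card = N → ∀ B' ⊆ B, b + (T'.card:ℝ) / K + L ≤ B'.card → ∃ a : ℕ → ℕ, ∀ n ∈ T', ∃ q ∈ B', n % q = a q % q := by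
    intro N
    induction N using Nat.strong_induction_on with
    | _ N ih =>
      intro T' hT' hN B' hB' hc'
      have hKr : (1:ℝ) ≤ K := by exact_mod_cast hK
      have h0 : 0 ≤ (T'.card:ℝ) / K := by positivity
      by_cases hlt : (T'.card:ℝ) ≤ L
      · refine cover_small T' B' ?_
        have : (T'.card:ℝ) ≤ B'.card := by linarith
        exact_mod_cast this
      · obtain ⟨q, hq, c, hcard⟩ := H T' hT' B' hB' (not_le.1 hlt) (by linarith)
        have hsp := Finset.card_filter_add_card_filter_not (s := T') (fun n => n % q = c % q)
        have hcr : (K:ℝ) + ((T'.filter fun n => ¬ n % q = c % q).card : ℝ) ≤ T'.card := by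
          exact_mod_cast (by omega : K + (T'.filter fun n => ¬ n % q = c % q).card ≤ T'.card)
        obtain ⟨a, ha⟩ := ih (T'.filter fun n => ¬ n % q = c % q).card (by omega) _ ((filter_subset _ _).trans hT') rfl
          (B'.erase q) ((Finset.erase_subset _ _).trans hB') (by
            have e : ((B'.erase q).card : ℝ) = B'.card - 1 := by
              rw [card_erase_of_mem hq, cast_sub (card_pos.2 ⟨q, hq⟩), Nat.cast_one]
            have : ((T'.filter fun n => ¬ n % q = c % q).card : ℝ) / K + 1 ≤ (T'.card:ℝ) / K := by
              rw [div_add_one (by positivity), div_le_div_iff_of_pos_right (by positivity)]; linarith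
            rw [e]; linarith)
        refine ⟨Function.update a q c, fun n hn => ?_⟩
        by_cases hnc : n % q = c % q
        · exact ⟨q, hq, by rw [Function.update_self]; exact hnc⟩
        · obtain ⟨r, hr, h⟩ := ha n (mem_filter.2 ⟨hn, hnc⟩)
          exact ⟨r, Finset.mem_of_mem_erase hr, by rw [Function.update_of_ne (ne_of_mem_erase hr)]; exact h⟩
  exact key _ T subset_rfl rfl B subset_rfl hc

lemma slice (K : ℕ) (ρ : ℝ) (hρ : 0 < ρ) (hρ1 : ρ ≤ 1) :
    ∃ k : ℕ, 1 ≤ k ∧ ∃ P0 : ℕ, 1 ≤ P0 ∧ ∃ τ : ℝ, 0 < τ ∧ ∃ x0 : ℝ, ∀ x ≥ x0, ∀ y : ℝ, log x ≤ y → log y ≤ τ * log x →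
    ∀ M : ℕ, 1 ≤ M → (M.primeFactors.card:ℝ) ≤ log x → ∀ a : ℕ → ℕ, (∀ p ∈ VD M (log x) y, ¬ p ∣ a p) →
    ∀ g : ℕ, 1 ≤ g → (∀ p : ℕ, p.Prime → p ∣ g → p ∣ M) → ∀ U : ℝ, k * P0 * g * x ≤ U →
    ∀ F : Finset ℕ, (∀ r ∈ F, r.Prime ∧ x / 4 < (r:ℝ) ∧ (g:ℝ) * r ≤ U ∧ ∀ p ∈ VD M (log x) y, (g * r) % p ≠ a p % p) →
    2 * ρ * U ≤ g * F.card * (log y / log (log x) * log x) →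
    ∀ B : Finset ℕ, (∀ q ∈ B, q.Prime ∧ x / 4 < (q:ℝ) ∧ (q:ℝ) ≤ x) → x ≤ B.card * (8 * log x) →
    ∃ q ∈ B, ∃ c : ℕ, K ≤ (F.filter fun r => (g * r) % q = c % q).card := by
  obtain ⟨k, hk, D0, hD0, τ, hτ, x0, h⟩ := coreB K ρ hρ hρ1 e1c e1c_one
  have hD0r : (128:ℝ) ≤ D0 := by exact_mod_cast hD0
  have hD00 : (0:ℝ) ≤ D0 := by linarith
  have hpr : ∀ p ∈ Pr (D0:ℝ), p.Prime := fun p hp => ((mem_Pr hD00).1 hp).1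
  set P0 : ℕ := ∏ p ∈ Pr (D0:ℝ), p with hP0
  have hP01 : 1 ≤ P0 := prod_pos fun p hp => (hpr p hp).pos
  refine ⟨k, hk, P0, hP01, τ, hτ, max (max x0 (exp D0)) 2, ?_⟩
  intro x hx y hxy hyτ M hM hω a ha g hg hgM U hU F hF hFc B hB hBc
  have hx1 : x0 ≤ x := le_trans (le_trans (le_max_left _ _) (le_max_left _ _)) hx
  have hx2 : exp D0 ≤ x := le_trans (le_trans (le_max_right _ _) (le_max_left _ _)) hx
  have hx0 : 0 < x := lt_of_lt_of_le (exp_pos _) hx2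
  have hD : (D0:ℝ) ≤ log x := by rwa [le_log_iff_exp_le hx0]
  have hy0 : 0 ≤ y := by linarith
  have hx4 : x ^ ((1:ℝ)/40) < x / 4 := by
    have h1 : exp 128 ≤ x := le_trans (exp_le_exp.2 hD0r) hx2
    have h2 : x ^ ((1:ℝ)/40) = x * x ^ (-(39:ℝ)/40) := by
      rw [← Real.rpow_one_add' hx0.le (by norm_num)]; norm_num
    have h3 : x ^ (-(39:ℝ)/40) < 1 / 4 := by
      rw [rpow_def_of_pos hx0, one_div, ← exp_log (show (0:ℝ) < 4⁻¹ by norm_num), Real.exp_lt_exp, Real.log_inv]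
      have := log_le_sub_one_of_pos (show (0:ℝ) < 4 by norm_num)
      linarith
    rw [h2]; linarith only [mul_lt_mul_of_pos_left h3 hx0]
  have hR0 : 0 ≤ x ^ ((1:ℝ)/40) := Real.rpow_nonneg hx0.le _
  have hgr : (1:ℝ) ≤ g := by exact_mod_cast hg
  have hP0r : (1:ℝ) ≤ P0 := by exact_mod_cast hP01
  have hkr : (1:ℝ) ≤ k := by exact_mod_cast hk

  have hcop : ∀ r ∈ F, Coprime P0 (r % P0) := by
    intro r hr
    rw [Coprime, Nat.gcd_comm, ← Nat.gcd_rec]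
    refine Coprime.prod_left fun p hp => ?_
    obtain ⟨hrp, hr4, -⟩ := hF r hr
    have hpD := ((mem_Pr hD00).1 hp).2
    rw [Nat.coprime_primes (hpr p hp) hrp]
    rintro rfl
    have hq := Real.quadratic_le_exp_of_nonneg hD00
    nlinarith only [hq, hpD, hr4, hD0r, hx2]
  obtain ⟨b, hb, hbc⟩ := exists_le_of_sum_le (s := (range P0).filter P0.Coprime) (f := fun _ => (F.card:ℝ) / P0.totient)
    (g := fun b => ((F.filter fun r => r % P0 = b).card : ℝ)) (by
      rw [← card_pos]; exact totient_pos.2 hP01) (by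
      rw [sum_const, nsmul_eq_mul, ← Nat.cast_sum, ← Finset.card_eq_sum_card_fiberwise (fun r hr => by
        simp only [coe_filter, mem_range, Set.mem_setOf_eq]
        exact ⟨mod_lt _ hP01, hcop r hr⟩)]
      change (P0.totient:ℝ) * _ ≤ _
      rw [mul_div_cancel₀]
      exact_mod_cast (totient_pos.2 hP01).ne')
  rw [mem_filter, mem_range] at hb
  obtain ⟨hbP, hbco⟩ := hb
  set Fb := F.filter fun r => r % P0 = b with hFb
  have hFbr : ∀ r ∈ Fb, r = b + P0 * (r / P0) := fun r hr => by
    have h1 := (mem_filter.1 hr).2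
    have := Nat.mod_add_div r P0
    omega
  set A : Finset ℤ := Fb.image fun r => ((r / P0 : ℕ) : ℤ) with hA
  have hAc : A.card = Fb.card := by
    refine Finset.card_image_of_injOn fun r hr r' hr' he => ?_
    have he' : r / P0 = r' / P0 := by exact_mod_cast he
    rw [hFbr r hr, hFbr r' hr', he']
  set V := VD M (log x) y with hV
  set Ω : ∀ p : ℕ, Finset (ZMod p) := fun p =>
    (if p ∈ V then {0, (a p : ZMod p) * (g : ZMod p)⁻¹} else {0} : Finset (ZMod p)).image fun t => (t - (b : ZMod p)) * (P0 : ZMod p)⁻¹ with hΩ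
  have hunit : ∀ p ∈ QQ D0 (x ^ ((1:ℝ)/40)), ∀ [Fact p.Prime], (P0 : ZMod p) ≠ 0 := by
    intro p hp _
    obtain ⟨hpp, -, hpD⟩ := (mem_QQ hR0).1 hp
    rw [Ne, ZMod.natCast_eq_zero_iff, hP0, Prime.dvd_finset_prod_iff hpp.prime]
    rintro ⟨q, hq, hd⟩
    have hqq := (mem_Pr hD00).1 hq
    rw [Nat.prime_dvd_prime_iff_eq hpp hqq.1] at hd
    rw [hd] at hpD; linarith [hqq.2]
  have hgp : ∀ p ∈ V, ∀ [Fact p.Prime], (g : ZMod p) ≠ 0 := by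
    intro p hp _
    obtain ⟨hpp, -, -, hpM⟩ := (mem_VD hy0).1 hp
    rw [Ne, ZMod.natCast_eq_zero_iff]
    exact fun hd => hpM (hgM p hpp hd)
  have hΩc : ∀ p ∈ QQ D0 (x ^ ((1:ℝ)/40)), (Ω p).card = if p ∈ V then 2 else 1 := by
    intro p hp
    haveI : Fact p.Prime := ⟨((mem_QQ hR0).1 hp).1⟩
    rw [hΩ, Finset.card_image_of_injective _ (fun s t hst => by
      have := mul_right_cancel₀ (inv_ne_zero (hunit p hp)) hst
      exact sub_left_injective this)]
    split_ifs with hpV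
    · refine Finset.card_pair (Ne.symm (mul_ne_zero ?_ (inv_ne_zero (hgp p hpV))))
      rw [Ne, ZMod.natCast_eq_zero_iff]; exact ha p hpV
    · exact card_singleton _
  have hUg : (k:ℝ) * x ≤ U / (g * P0) := by
    rw [le_div_iff₀ (by positivity)]
    refine le_trans (le_of_eq ?_) hU; ring
  have hUg0 : 0 ≤ U / (g * P0) := le_trans (by positivity) hUg
  set N : ℕ := ⌊U / (g * P0)⌋₊ + 1 with hN
  have hNgt : U / (g * P0) < N := by rw [hN]; push_cast; exact Nat.lt_floor_add_one _
  have hNle : (N:ℝ) ≤ 2 * (U / (g * P0)) := by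
    rw [hN]; push_cast
    have h1 := floor_le hUg0
    have h2 : 1 ≤ x := by linarith [le_max_right (max x0 (exp D0)) 2]
    have h3 := one_le_mul_of_one_le_of_one_le hkr h2
    linarith
  have hVQ : V ⊆ QQ D0 y := fun p hp => by
    obtain ⟨h1, h2, h3, -⟩ := (mem_VD hy0).1 hp
    exact (mem_QQ hy0).2 ⟨h1, h2, by linarith⟩
  have hl0 : 0 < log (log x) := log_pos (by linarith)
  have hly : 0 ≤ log y := log_nonneg (by linarith)
  obtain ⟨q, hq, n, hn⟩ := h x hx1 y (by linarith) hyτ V hVQ (log (log x)) hl0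
    (VD_E1 M hM _ y (by linarith) hy0 hω) (VD_E2 M _ y (by linarith) hxy) Ω hΩc A (B.image fun q : ℕ => (q:ℤ)) N
    (hUg.trans hNgt.le) (by
      intro r hr
      obtain ⟨s, hs, rfl⟩ := mem_image.1 hr
      refine ⟨Int.natCast_nonneg _, ?_⟩
      norm_cast
      rw [hN, lt_succ_iff, le_floor_iff hUg0]
      refine Nat.cast_div_le.trans ?_
      rw [div_le_div_iff₀ (by positivity) (by positivity)]
      have := (hF s (mem_filter.1 hs).1).2.2.1
      linarith only [mlr this (zero_le_one.trans hP0r)]) (by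
      intro r hr p hp hmem
      obtain ⟨s, hs, rfl⟩ := mem_image.1 hr
      obtain ⟨hsp, hs4, -, hsa⟩ := hF s (mem_filter.1 hs).1
      obtain ⟨hpp, hpR, -⟩ := (mem_QQ hR0).1 hp
      haveI : Fact p.Prime := ⟨hpp⟩
      obtain ⟨t, ht, hte⟩ := mem_image.1 hmem
      have hst : (s : ZMod p) = t := by
        rw [Int.cast_natCast] at hte
        rw [hFbr s hs, Nat.cast_add, Nat.cast_mul, ← hte]
        have := hunit p hp
        field_simp; ring
      have hs0 : (s : ZMod p) ≠ 0 := by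
        rw [Ne, ZMod.natCast_eq_zero_iff, Nat.prime_dvd_prime_iff_eq hpp hsp]
        rintro rfl; linarith
      split_ifs at ht with hpV
      · rw [mem_insert, Finset.mem_singleton] at ht
        rcases ht with ht | ht
        · exact hs0 (hst.trans ht)
        · refine hsa p hpV ?_
          have := hgp p hpV
          refine (ZMod.natCast_eq_natCast_iff' _ _ p).1 ?_
          push_cast
          rw [hst, ht]; field_simp
      · exact hs0 (hst.trans (Finset.mem_singleton.1 ht))) (by
      have hφ : (0:ℝ) < P0.totient := by exact_mod_cast totient_pos.2 hP01
      have hlD : 0 < log D0 := log_pos (by linarith)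
      have h1 : log D0 ≤ (P0:ℝ) / P0.totient := by
        rw [mphi P0 hP01, hP0, Nat.primeFactors_prod hpr]
        exact log_le_VV D0 (by linarith)
      rw [le_div_iff₀ hφ] at h1
      rw [div_le_iff₀ hφ] at hbc
      rw [hAc]
      set W := log y / log (log x) * log x with hW
      have hW0 : 0 ≤ W := by rw [hW]; exact mul_nonneg (div_nonneg hly hl0.le) (by linarith)
      have e : log y / (log (log x) * log D0) * log x = W / log D0 := by
        rw [hW]; field_simp
      rw [e, mul_div_assoc', le_div_iff₀ hlD]
      have h2 : (N:ℝ) * (g * P0) ≤ 2 * U := by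
        have := mlr hNle (show 0 ≤ (g:ℝ) * P0 by positivity)
        rwa [mul_assoc, div_mul_cancel₀ _ (by positivity)] at this
      have h3 : ρ * N * P0 ≤ F.card * W := by
        have : (g:ℝ) * (ρ * N * P0) ≤ g * (F.card * W) := by
          linarith only [mll h2 hρ.le, hFc]
        exact lml this (by linarith)
      have h4 : P0.totient * (ρ * N * log D0) ≤ P0.totient * (Fb.card * W) := by
        calc _ = ρ * N * (log D0 * P0.totient) := by ring
          _ ≤ ρ * N * P0 := mll h1 (by positivity)
          _ ≤ F.card * W := h3
          _ ≤ (Fb.card * P0.totient) * W := mlr hbc hW0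
          _ = _ := by ring
      exact lml h4 hφ) (by
      intro q hq
      obtain ⟨q', hq', rfl⟩ := mem_image.1 hq
      exact ⟨q', rfl, hB q' hq'⟩) (by
      rwa [Finset.card_image_of_injective _ Nat.cast_injective])
  obtain ⟨q, hqB, rfl⟩ := mem_image.1 hq
  have hq0 : (0:ℤ) < q := by exact_mod_cast (hB q hqB).1.pos
  refine ⟨q, hqB, (((g:ℤ) * (b + P0 * n)) % q).toNat, hn.trans ?_⟩
  have hrep : ∀ j : Fin k, n + ((j:ℕ) + 1 : ℤ) * q ∈ A → ∃ r ∈ Fb, ((b:ℤ) + P0 * (n + ((j:ℕ) + 1 : ℤ) * q)) = r := by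
    intro j hj
    obtain ⟨r, hr, he⟩ := mem_image.1 hj
    refine ⟨r, hr, ?_⟩
    rw [← he]; exact_mod_cast (hFbr r hr).symm
  refine card_le_card_of_injOn (fun j : Fin k => ((b:ℤ) + P0 * (n + ((j:ℕ) + 1 : ℤ) * q)).toNat) ?_ ?_
  · intro j hj
    obtain ⟨r, hr, he⟩ := hrep j (mem_filter.1 hj).2
    simp only [he, Int.toNat_natCast]
    rw [mem_coe, mem_filter]
    refine ⟨(mem_filter.1 hr).1, ?_⟩
    zify
    rw [Int.toNat_of_nonneg (Int.emod_nonneg _ hq0.ne'), Int.emod_emod_of_dvd _ dvd_rfl, ← he]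
    refine Int.ModEq.symm (Int.modEq_iff_dvd.2 ⟨g * P0 * ((j:ℕ) + 1), ?_⟩)
    ring
  · intro i hi j hj hij
    obtain ⟨r, hr, he⟩ := hrep i (mem_filter.1 hi).2
    obtain ⟨s, hs, hf⟩ := hrep j (mem_filter.1 hj).2
    simp only [he, hf, Int.toNat_natCast] at hij
    rw [hij, ← hf] at he
    have hP0z : (P0:ℤ) ≠ 0 := by exact_mod_cast (by omega : P0 ≠ 0)
    have h1 := mul_left_cancel₀ hP0z (add_left_cancel he)
    have h2 := mul_right_cancel₀ hq0.ne' (add_left_cancel h1)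
    have h3 : ((i:ℕ):ℤ) = (j:ℕ) := by linarith
    exact Fin.ext (by exact_mod_cast h3)

lemma reduce (T Tl : Finset ℕ) (hl : Tl ⊆ T) (Ta Tb : ℝ) (ha0 : 0 < Ta) (hb0 : 0 < Tb) (ha : (T.card:ℝ) ≤ Ta) (hb : (Tl.card:ℝ) ≤ Tb) (V : Finset ℕ) (hV : ∀ p ∈ V, p.Prime) (hT : ∀ n ∈ T, ∀ p ∈ V, ¬ p ∣ n) :
    ∃ a : ℕ → ℕ, (∀ p ∈ V, ¬ p ∣ a p) ∧
      ((T.filter (fun n => ∀ p ∈ V, n % p ≠ a p % p)).card : ℝ) ≤ 2 * (∏ p ∈ V, (1 - 1 / (p:ℝ))) * Ta ∧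
      ((T.filter (fun n => ∀ p ∈ V, n % p ≠ a p % p) ∩ Tl).card : ℝ) ≤ 2 * (∏ p ∈ V, (1 - 1 / (p:ℝ))) * Tb := by
  obtain ⟨a, h1, h2⟩ := greedy T (fun n => 1 / Ta + if n ∈ Tl then 1 / Tb else 0)
    (fun n => by split_ifs <;> positivity) V hV hT
  refine ⟨a, h1, ?_⟩
  set R := T.filter (fun n => ∀ p ∈ V, n % p ≠ a p % p) with hR
  have hp0 : 0 ≤ ∏ p ∈ V, (1 - 1 / (p:ℝ)) := prod_nonneg fun p hp => by
    have : (1:ℝ) ≤ p := by exact_mod_cast (hV p hp).one_le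
    rw [sub_nonneg, div_le_one (by linarith)]; exact this
  rw [sum_add_distrib, sum_add_distrib, ← sum_filter, ← sum_filter, Finset.filter_mem_eq_inter, Finset.filter_mem_eq_inter,
    Finset.inter_eq_right.2 hl] at h2
  simp only [sum_const, nsmul_eq_mul, mul_one_div] at h2
  have h3 : (T.card:ℝ) / Ta + Tl.card / Tb ≤ 2 := by
    have := (div_le_one ha0).2 ha
    have := (div_le_one hb0).2 hb
    linarith
  have h4 := h2.trans (mll h3 hp0)
  have h5 : 0 ≤ (R.card:ℝ) / Ta := by positivity
  have h6 : 0 ≤ ((R ∩ Tl).card:ℝ) / Tb := by positivity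
  constructor
  · rw [← div_le_iff₀ ha0]; linarith
  · rw [← div_le_iff₀ hb0]; linarith

noncomputable def TT (Gs : Finset ℕ) (U x : ℝ) : Finset ℕ :=
  ((Gs ×ˢ Pr U).filter fun z : ℕ × ℕ => x / 4 < (z.2:ℝ) ∧ (z.1:ℝ) * z.2 ≤ U).image fun z => z.1 * z.2

lemma mem_TT {Gs : Finset ℕ} {U x : ℝ} (hU : 0 ≤ U) (hG : ∀ g ∈ Gs, 1 ≤ g) {n : ℕ} :
    n ∈ TT Gs U x ↔ ∃ g ∈ Gs, ∃ r : ℕ, r.Prime ∧ x / 4 < (r:ℝ) ∧ (g:ℝ) * r ≤ U ∧ n = g * r := by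
  rw [TT, mem_image]
  constructor
  · rintro ⟨⟨g, r⟩, h, rfl⟩
    rw [mem_filter, mem_product, mem_Pr hU] at h
    exact ⟨g, h.1.1, r, h.1.2.1, h.2.1, h.2.2, rfl⟩
  · rintro ⟨g, hg, r, hr, h1, h2, rfl⟩
    refine ⟨(g, r), ?_, rfl⟩
    rw [mem_filter, mem_product, mem_Pr hU]
    have : (1:ℝ) ≤ g := by exact_mod_cast hG g hg
    refine ⟨⟨hg, hr, ?_⟩, h1, h2⟩
    exact (le_mul_of_one_le_left (cast_nonneg r) this).trans h2

lemma TT_card (t0 : ℝ) (ht1 : 1 < t0) (ht : ∀ t ≥ t0, ((Pr t).card : ℝ) ≤ 2 * t / log t) (x U : ℝ) (hx : 16 ≤ x) (hxt : t0 ≤ x / 4) (hU : 0 ≤ U) (Gs : Finset ℕ) (hG : ∀ g ∈ Gs, 1 ≤ g ∧ (g:ℝ) ≤ 4 * U / x) :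
    ((TT Gs U x).card : ℝ) ≤ 4 * U / log x * ∑ g ∈ Gs, (1:ℝ) / g := by
  have hlx : 0 < log x := log_pos (by linarith)
  have hsub : TT Gs U x ⊆ Gs.biUnion fun g => (Pr (U / g)).image fun r => g * r := by
    intro n hn
    obtain ⟨g, hg, r, hr, -, h2, rfl⟩ := (mem_TT hU (fun g hg => (hG g hg).1)).1 hn
    have hg0 : (0:ℝ) < g := by exact_mod_cast (hG g hg).1
    rw [Finset.mem_biUnion]
    refine ⟨g, hg, mem_image.2 ⟨r, (mem_Pr (by positivity)).2 ⟨hr, ?_⟩, rfl⟩⟩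
    rw [le_div_iff₀ hg0, mul_comm]; exact h2
  have h1 : ((TT Gs U x).card : ℝ) ≤ ∑ g ∈ Gs, ((Pr (U / g)).card : ℝ) := by
    have := (card_le_card hsub).trans (Finset.card_biUnion_le.trans (sum_le_sum fun g _ => Finset.card_image_le))
    exact_mod_cast this
  refine h1.trans ?_
  rw [mul_sum]
  refine sum_le_sum fun g hg => ?_
  have hg0 : (0:ℝ) < g := by exact_mod_cast (hG g hg).1
  have hUg : x / 4 ≤ U / g := by
    have := (hG g hg).2
    rw [le_div_iff₀ (by linarith)] at this
    rw [le_div_iff₀ hg0]; linarith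
  refine (ht _ (hxt.trans hUg)).trans ?_
  have hlog : log x / 2 ≤ log (U / g) := by
    refine le_trans ?_ (log_le_log (by linarith) hUg)
    have : log x ≤ log ((x/4)^2) := log_le_log (by linarith) (by nlinarith)
    rw [log_pow] at this; push_cast at this; linarith
  calc 2 * (U / g) / log (U / g) ≤ 2 * (U / g) / (log x / 2) := div_le_div_of_nonneg_left (by positivity) (by linarith) hlog
    _ = 4 * U / log x * (1 / g) := by field_simp; ring

lemma pick (M : ℕ) (hM : 1 ≤ M) (G0 : ℝ) (hG0 : 1 ≤ G0) (E : ℝ) (hE : 0 ≤ E) (T : Finset ℕ) (hT : E ≤ T.card) (P : ℕ → Prop) (h : ∀ n ∈ T, ∃ g ∈ GG M G0, ∃ r : ℕ, P r ∧ n = g * r) :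
    ∃ g ∈ GG M G0, ∃ F : Finset ℕ, (∀ r ∈ F, P r ∧ g * r ∈ T) ∧ E * (M.totient / M) ≤ g * F.card := by
  have hG00 : 0 ≤ G0 := by linarith
  set Fg : ℕ → Finset ℕ := fun g => (T.filter fun n => ∃ r, P r ∧ n = g * r).image fun n => n / g with hFg
  have hφ : (0:ℝ) < M.totient := by exact_mod_cast totient_pos.2 hM
  have hM0 : (0:ℝ) < M := by exact_mod_cast hM
  have hsub : T ⊆ (GG M G0).biUnion fun g => (Fg g).image fun r => g * r := by
    intro n hn
    obtain ⟨g, hg, r, hr, rfl⟩ := h n hn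
    have hg0 : 0 < g := ((mem_GG hG00).1 hg).1
    rw [Finset.mem_biUnion]
    exact ⟨g, hg, mem_image.2 ⟨r, mem_image.2 ⟨g * r, mem_filter.2 ⟨hn, r, hr, rfl⟩, Nat.mul_div_cancel_left r hg0⟩, rfl⟩⟩
  have h1 : (T.card : ℝ) ≤ ∑ g ∈ GG M G0, ((Fg g).card : ℝ) := by
    have := (card_le_card hsub).trans (Finset.card_biUnion_le.trans (sum_le_sum fun g _ => Finset.card_image_le))
    exact_mod_cast this
  obtain ⟨g, hg, hge⟩ := exists_le_of_sum_le (s := GG M G0) (f := fun g : ℕ => E * (M.totient / M) * (1 / (g:ℝ))) (g := fun g => ((Fg g).card : ℝ))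
    ⟨1, (mem_GG hG00).2 ⟨le_rfl, by simpa using hG0, fun p hp hd => by
      rw [Nat.dvd_one] at hd; exact absurd hd hp.one_lt.ne'⟩⟩ (by
    rw [← mul_sum]
    refine le_trans ?_ (hT.trans h1)
    calc _ ≤ E * (M.totient / M) * (M / M.totient) := mll (GG_sum M hM G0 hG00) (by positivity)
      _ = E := by field_simp)
  have hg0 := ((mem_GG hG00).1 hg).1
  have hg0r : (0:ℝ) < g := by exact_mod_cast hg0
  refine ⟨g, hg, Fg g, ?_, ?_⟩
  · intro r hr
    obtain ⟨n, hn, rfl⟩ := mem_image.1 hr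
    obtain ⟨hn, r, hr', rfl⟩ := mem_filter.1 hn
    rw [Nat.mul_div_cancel_left r hg0]
    exact ⟨hr', hn⟩
  · rw [mul_one_div, div_le_iff₀ hg0r] at hge
    rw [mul_comm (g:ℝ)]; exact hge

open Filter

noncomputable def SS (M : ℕ) (y U : ℝ) : Finset ℕ :=
  (Icc 1 ⌊U⌋₊).filter fun n => ∀ p : ℕ, p.Prime → p ∣ n → (p:ℝ) ≤ y ∨ p ∣ M

noncomputable def RR (M : ℕ) (D y U x : ℝ) (a : ℕ → ℕ) : Finset ℕ :=
  (TT (GG M (4 * U / x)) U x).filter fun n => ∀ p ∈ VD M D y, n % p ≠ a p % p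

lemma final_cover (M : ℕ) (x y D U : ℝ) (hx : 0 < x) (hU : 0 ≤ U) (hy0 : 0 ≤ y) (hyx : y ≤ x / 4) (hDx : D ≤ x / 4) (hUD : 4 * U / x ≤ D) (aV aB : ℕ → ℕ) (hBM : ∀ q ∈ B0 x, ¬ q ∣ M) (hB : ∀ n ∈ SS M y U ∪ RR M D y U x aV, ∃ q ∈ B0 x, n % q = aB q % q) :
    ∃ a : ℕ → ℕ, ∀ n : ℕ, 1 ≤ n → (n : ℝ) ≤ U → ∃ p : ℕ, p.Prime ∧ (p : ℝ) ≤ x ∧ ¬ p ∣ M ∧ n % p = a p % p := by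
  have hG : 0 ≤ 4 * U / x := by positivity
  have hnB : ∀ p : ℕ, (p:ℝ) ≤ x / 4 → p ∉ B0 x := fun p hp hmem => absurd hp (not_le.2 (mem_filter.1 hmem).2)
  refine ⟨fun p => if p ∈ B0 x then aB p else if p ∈ VD M D y then aV p else 0, fun n hn1 hnU => ?_⟩
  beta_reduce
  by_cases hnSR : n ∈ SS M y U ∪ RR M D y U x aV
  · obtain ⟨q, hq, hqe⟩ := hB n hnSR
    have hqp := (mem_Pr hx.le).1 (mem_filter.1 hq).1
    exact ⟨q, hqp.1, hqp.2, hBM q hq, by rw [if_pos hq]; exact hqe⟩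
  rw [mem_union, not_or] at hnSR
  obtain ⟨hnS, hnR⟩ := hnSR
  have hz : ∀ p : ℕ, p.Prime → p ∣ n → ¬ p ∣ M → (p:ℝ) ≤ x / 4 → p ∉ VD M D y →
      ∃ p : ℕ, p.Prime ∧ (p : ℝ) ≤ x ∧ ¬ p ∣ M ∧ n % p = (if p ∈ B0 x then aB p else if p ∈ VD M D y then aV p else 0) % p := by
    intro p hp hpn hpM hpx hpV
    refine ⟨p, hp, by linarith, hpM, ?_⟩
    rw [if_neg (hnB p hpx), if_neg hpV, Nat.zero_mod]
    exact Nat.mod_eq_zero_of_dvd hpn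
  have h1 : ∃ p : ℕ, p.Prime ∧ p ∣ n ∧ y < (p:ℝ) ∧ ¬ p ∣ M := by
    by_contra hc
    push Not at hc
    refine hnS (mem_filter.2 ⟨mem_Icc.2 ⟨hn1, (le_floor_iff hU).2 hnU⟩, fun p hp hd => ?_⟩)
    by_cases hpy : (p:ℝ) ≤ y
    · exact Or.inl hpy
    · exact Or.inr (hc p hp hd (not_le.1 hpy))
  obtain ⟨r, hr, hrn, hry, hrM⟩ := h1
  by_cases hrx : (r:ℝ) ≤ x / 4
  · exact hz r hr hrn hrM hrx fun hV => absurd ((mem_VD hy0).1 hV).2.1 (not_le.2 hry)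
  obtain ⟨g, rfl⟩ := hrn
  have hg1 : 1 ≤ g := Nat.pos_of_ne_zero fun h => by subst h; omega
  have hgr : (g:ℝ) * r ≤ U := by rw [mul_comm]; exact_mod_cast hnU
  have hgG : (g:ℝ) ≤ 4 * U / x := by
    rw [le_div_iff₀ hx]
    have := mll (not_le.1 hrx).le (cast_nonneg (α := ℝ) g)
    linarith
  by_cases hgM : ∀ p : ℕ, p.Prime → p ∣ g → p ∣ M
  · have hT : r * g ∈ TT (GG M (4 * U / x)) U x :=
      (mem_TT hU (fun g hg => ((mem_GG hG).1 hg).1)).2 ⟨g, (mem_GG hG).2 ⟨hg1, hgG, hgM⟩, r, hr, not_le.1 hrx, hgr, mul_comm _ _⟩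
    have h2 : ¬ ∀ p ∈ VD M D y, (r * g) % p ≠ aV p % p := fun h => hnR (mem_filter.2 ⟨hT, h⟩)
    push Not at h2
    obtain ⟨p, hpV, hpe⟩ := h2
    obtain ⟨hp, hpy, -, hpM⟩ := (mem_VD hy0).1 hpV
    exact ⟨p, hp, by linarith, hpM, by rw [if_neg (hnB p (by linarith)), if_pos hpV]; exact hpe⟩
  · push Not at hgM
    obtain ⟨p, hp, hpg, hpM⟩ := hgM
    have hpD : (p:ℝ) ≤ D := le_trans (by exact_mod_cast le_of_dvd hg1 hpg) (hgG.trans hUD)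
    exact hz p hp (hpg.mul_left r) hpM (by linarith) fun hV => absurd ((mem_VD hy0).1 hV).2.2.1 (not_lt.2 hpD)

lemma asym (C τ A : ℝ) (hτ : 0 < τ) : ∀ᶠ x : ℝ in atTop, 16 ≤ x ∧ 3 ≤ log (log x) ∧ ∀ y : ℝ, 0 < y → log y = log x * log (log (log x)) / (8 * log (log x)) → log x ≤ y ∧ log y ≤ τ * log x ∧ y ≤ x / 4 ∧ 4 * C * log y ≤ log x * log (log x) ∧ A * log (log x) ^ 2 ≤ log y := by
  have t1 : Tendsto log atTop atTop := tendsto_log_atTop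
  have t2 := t1.comp t1
  have a1 : Tendsto (fun l : ℝ => log l / l) atTop (nhds 0) := by
    simpa using (isLittleO_log_rpow_atTop (r := 1) (by norm_num)).tendsto_div_nhds_zero
  have a2 : Tendsto (fun l : ℝ => exp l / l ^ 3) atTop atTop := Real.tendsto_exp_div_pow_atTop 3
  have b1 := t2.eventually (a1.eventually (gt_mem_nhds (show (0:ℝ) < 8 * τ by positivity)))
  have b2 := t2.eventually (a2.eventually_ge_atTop (8 * max A 1))
  have b4 := t2.eventually (eventually_ge_atTop (max 3 C))
  filter_upwards [b1, b2, b4, eventually_ge_atTop 16] with x b1 b2 b4 hx1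
  simp only [Function.comp_apply] at b1 b2 b4
  have b3 := (le_max_left _ _).trans b4
  have b5 := (le_max_right _ _).trans b4
  refine ⟨hx1, b3, fun y hy0 hy => ?_⟩
  have hL0 : 0 < log x := log_pos (by linarith)
  have hlog4 : log x / 2 ≤ log (x / 4) := by
    have : log x ≤ log ((x/4)^2) := log_le_log (by linarith) (by nlinarith)
    rw [log_pow] at this; push_cast at this; linarith
  generalize hL : log x = L at *
  rw [exp_log hL0] at b2
  have hel : exp (log L) = L := exp_log hL0
  generalize log L = l at *
  have hl0 : 0 < l := by linarith
  have hl31 : 1 ≤ log l := by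
    rw [le_log_iff_exp_le (by linarith)]; linarith [exp_one_lt_d9]
  have hl3l : log l ≤ l := Real.log_le_self hl0.le
  generalize log l = l3 at *
  rw [div_lt_iff₀ hl0] at b1
  rw [le_div_iff₀ (by positivity)] at b2
  have h1 : 8 * l * log y = L * l3 := by rw [hy]; field_simp
  have h8 : 0 < 8 * l := by linarith
  have h5 : max A 1 * l ^ 2 ≤ log y := by
    refine lml ?_ h8
    rw [h1]
    have := mll hl31 hL0.le
    linarith
  have hll : l ≤ l ^ 2 := by nlinarith
  have h6 : A * l ^ 2 ≤ max A 1 * l ^ 2 := mlr (le_max_left _ _) (by positivity)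
  have h7 : 1 * l ^ 2 ≤ max A 1 * l ^ 2 := mlr (le_max_right _ _) (by positivity)
  refine ⟨?_, ?_, ?_, ?_, h6.trans h5⟩
  · rw [← hel, ← le_log_iff_exp_le hy0]; linarith
  · refine lml ?_ h8
    rw [h1]
    have := mll b1.le hL0.le
    linarith
  · have h9 : 8 * l * log y ≤ 8 * l * (L / 8) := by
      rw [h1]
      have := mll hl3l hL0.le
      linarith
    have h10 := lml h9 h8
    rw [← Real.log_le_log_iff hy0 (by linarith)]; linarith
  · refine lml ?_ h8
    have e : 8 * l * (4 * C * log y) = 4 * C * (L * l3) := by rw [← h1]; ring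
    rw [e]
    have h11 : C * (L * l3) ≤ l * (L * l) := mul_le_mul b5 (mll hl3l hL0.le) (by positivity) hl0.le
    nlinarith [mul_pos (mul_pos hL0 hl0) hl0]

open Filter

lemma SS_sub {M : ℕ} {y U : ℝ} (hU : 0 ≤ U) : ∀ n ∈ SS M y U, 1 ≤ n ∧ (n:ℝ) ≤ U ∧ ∀ p : ℕ, p.Prime → p ∣ n → (p:ℝ) ≤ y ∨ p ∣ M := by
  intro n hn
  rw [SS, mem_filter, mem_Icc, le_floor_iff hU] at hn
  exact ⟨hn.1.1, hn.1.2, hn.2⟩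

set_option maxHeartbeats 1000000 in
theorem mainU (C : ℝ) (hC : 0 < C) : ∀ᶠ x : ℝ in atTop, ∀ M : ℕ, 1 ≤ M → (M:ℝ) ≤ x ^ ((1:ℝ)/5) → ∀ y : ℝ, 0 < y → log y = log x * log (log (log x)) / (8 * log (log x)) → ∀ U : ℝ, U = C * ((M.totient:ℝ) / M) * x * log y / log (log x) → ∃ a : ℕ → ℕ, ∀ n : ℕ, 1 ≤ n → (n : ℝ) ≤ U → ∃ p : ℕ, p.Prime ∧ (p : ℝ) ≤ x ∧ ¬ p ∣ M ∧ n % p = a p % p := by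
  have he1 : 0 < e1c := lt_of_lt_of_le one_pos e1c_one
  set Cr : ℝ := 8 * C * e1c with hCr
  have hCr0 : 0 < Cr := by positivity
  set K : ℕ := ⌈32 * Cr + 1⌉₊ with hK
  have hK1 : 32 * Cr + 1 ≤ K := Nat.le_ceil _
  set ρ : ℝ := min 1 (1 / (128 * C)) with hρ
  have hρ0 : 0 < ρ := by rw [hρ]; positivity
  have hρ1 : ρ * (128 * C) ≤ 1 := by
    rw [← le_div_iff₀ (by positivity)]; exact min_le_right _ _
  obtain ⟨k, hk, P0, hP0, τ, hτ, x0, hslice⟩ := slice K ρ hρ0 (min_le_left _ _)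
  have hkr : (1:ℝ) ≤ k := by exact_mod_cast hk
  have hP0r : (1:ℝ) ≤ P0 := by exact_mod_cast hP0
  have hkP : 0 < (k:ℝ) * P0 := by positivity
  set Cb : ℝ := 128 * (24 * (k * P0)) * Cr with hCb
  have hCb0 : 0 < Cb := by positivity
  obtain ⟨t0, ht1, ht⟩ := Pr_bd
  filter_upwards [asym C τ (exp Cb * e1c * (k * P0) / C) hτ, B0_card, smooth_count 128, eventually_ge_atTop x0, eventually_ge_atTop (4 * t0)]
    with x hasym hB0 hsm hx0 hxt M hM hMx y hy0 hy U hU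
  obtain ⟨hx16, hl3, hasym⟩ := hasym
  obtain ⟨hLy, hYτ, hyx, hYC, hYA⟩ := hasym y hy0 hy
  have hxp : 0 < x := by linarith
  have hω := omega_le M hM x (by linarith) hMx
  have hsm' := hsm M hω hM y hy0 hy
  have hsl := hslice x hx0 y hLy hYτ M hM hω
  clear hsm hslice hasym hy
  have hlogL : log (log x) ≤ log x := by
    refine Real.log_le_self (log_nonneg (by linarith))
  have hL3 : 3 ≤ log x := by linarith
  have hE3 := VD_E3 M hM (log x) y (by linarith) (by linarith) hω
  have hmle := mphi_le M hM (log x) (by linarith) hω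
  have hDx : log x ≤ x / 4 := by linarith
  have hφ : (0:ℝ) < M.totient := by exact_mod_cast totient_pos.2 hM
  have hM0 : (0:ℝ) < M := by exact_mod_cast hM
  have hφ1 : (M.totient:ℝ) / M ≤ 1 := by
    rw [div_le_one hM0]; exact_mod_cast Nat.totient_le M
  have hBM : ∀ q ∈ B0 x, ¬ q ∣ M := by
    intro q hq hd
    have h1 := (mem_filter.1 hq).2
    have h2 : (q:ℝ) ≤ M := by exact_mod_cast le_of_dvd hM hd
    have h3 : x ^ ((1:ℝ)/5) ≤ x ^ ((1:ℝ)/2) := Real.rpow_le_rpow_of_exponent_le (by linarith) (by norm_num)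
    rw [← sqrt_eq_rpow] at h3
    have h4 : √x ≤ x / 4 := by
      rw [sqrt_le_left (by linarith)]; nlinarith only [hx16]
    linarith
  set L := log x with hL
  set l := log L with hl
  have hl0 : 0 < l := by linarith
  have hL0 : 0 < L := by linarith
  set Y := log y with hY
  have hY0 : 0 < Y := log_pos (by linarith)
  set f := (M.totient:ℝ) / M with hf
  have hf0 : 0 < f := by positivity
  have hfinv : (M:ℝ) / M.totient = f⁻¹ := by rw [hf, inv_div]
  rw [hfinv] at hmle
  have hfl : 1 ≤ f * (e1c * l) := by
    rw [inv_le_iff_one_le_mul₀ hf0] at hmle; linarith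
  have hU0 : 0 < U := by rw [hU]; positivity
  have hUl : U * l = C * f * x * Y := by rw [hU]; field_simp
  have hG1L : 4 * U / x ≤ L := by
    rw [div_le_iff₀ hxp]
    refine le_of_mul_le_mul_right ?_ hl0
    calc 4 * U * l = f * ((4 * C * Y) * x) := by linear_combination 4 * hUl
      _ ≤ 1 * ((L * l) * x) := mul_le_mul hφ1 (mlr hYC hxp.le) (by positivity) one_pos.le
      _ = L * x * l := by ring
  have hUxL : U ≤ x * L := by
    rw [div_le_iff₀ hxp] at hG1L; linarith
  set G0 := U / (k * P0 * x) with hG0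
  have hG0U : k * P0 * G0 * x = U := by rw [hG0]; field_simp
  have hG00 : 0 < G0 := by positivity
  have hG0b : exp Cb ≤ G0 := by
    have h1 : exp Cb * e1c * (k * P0) * l ^ 2 ≤ C * Y := by
      rw [div_mul_eq_mul_div, div_le_iff₀ hC] at hYA; linarith
    have h2 : exp Cb * (k * P0 * x * l) ≤ U * l := by
      calc exp Cb * (k * P0 * x * l) ≤ exp Cb * (k * P0 * x * l) * (f * (e1c * l)) := le_mul_of_one_le_right (by positivity) hfl
        _ = f * x * (exp Cb * e1c * (k * P0) * l ^ 2) := by ring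
        _ ≤ f * x * (C * Y) := mll h1 (by positivity)
        _ = U * l := by rw [hUl]; ring
    rw [hG0, le_div_iff₀ (by positivity)]
    refine le_of_mul_le_mul_right ?_ hl0
    linarith only [h2]
  have hG01 : 1 < G0 := lt_of_lt_of_le (Real.one_lt_exp_iff.2 hCb0) hG0b
  have hlG0 : Cb ≤ log G0 := by rwa [le_log_iff_exp_le hG00]
  set G1 := 4 * U / x with hG1
  have hG1G0 : G1 = 4 * (k * P0) * G0 := by
    rw [hG1, ← hG0U]; field_simp
  have hG10 : 0 ≤ G1 := by positivity
  set Tl := TT ((GG M G1).filter (fun g : ℕ => G0 < (g:ℝ))) U x with hTl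
  have hGG1 : ∀ g ∈ GG M G1, 1 ≤ g ∧ (g:ℝ) ≤ G1 := fun g hg => ⟨((mem_GG hG10).1 hg).1, ((mem_GG hG10).1 hg).2.1⟩
  have hGG2 : ∀ g ∈ (GG M G1).filter (fun g : ℕ => G0 < (g:ℝ)), 1 ≤ g ∧ (g:ℝ) ≤ G1 := fun g hg => hGG1 g (mem_filter.1 hg).1
  have hcard1 : ((TT (GG M G1) U x).card : ℝ) ≤ 4 * U / L * f⁻¹ := by
    refine (TT_card t0 ht1 ht x U hx16 (by linarith) hU0.le _ hGG1).trans ?_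
    rw [← hfinv]
    exact mll (GG_sum M hM G1 hG10) (by positivity)
  have hcard2 : (Tl.card : ℝ) ≤ 4 * U / L * f⁻¹ * (24 * (k * P0) / Cb) := by
    refine (TT_card t0 ht1 ht x U hx16 (by linarith) hU0.le _ hGG2).trans ?_
    rw [mul_assoc]
    refine mll ?_ (by positivity)
    refine (GG_low M hM G0 G1 hG01 hG10).trans ?_
    rw [hfinv, mul_comm]
    refine mll ?_ (by positivity)
    calc 6 * G1 / (G0 * log G0) = 24 * (k * P0) / log G0 := by rw [hG1G0]; field_simp; ring
      _ ≤ 24 * (k * P0) / Cb := div_le_div_of_nonneg_left (by positivity) hCb0 hlG0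
  have hTTsub : Tl ⊆ TT (GG M G1) U x := by
    intro n hn
    obtain ⟨g, hg, h⟩ := (mem_TT hU0.le fun g hg => (hGG2 g hg).1).1 hn
    exact (mem_TT hU0.le fun g hg => (hGG1 g hg).1).2 ⟨g, (mem_filter.1 hg).1, h⟩
  obtain ⟨a, haV, hR1, hR2⟩ := reduce (TT (GG M G1) U x) Tl hTTsub _ _ (by positivity) (by positivity) hcard1 hcard2 (VD M L y)
    (fun p hp => ((mem_VD hy0.le).1 hp).1) (by
      intro n hn p hp hd
      obtain ⟨g, hg, r, hr, hr4, -, rfl⟩ := (mem_TT hU0.le fun g hg => (hGG1 g hg).1).1 hn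
      obtain ⟨hpp, hpy, -, hpM⟩ := (mem_VD hy0.le).1 hp
      rcases hpp.dvd_mul.1 hd with h | h
      · exact hpM (((mem_GG hG10).1 hg).2.2 p hpp h)
      · rw [Nat.prime_dvd_prime_iff_eq hpp hr] at h
        rw [h] at hpy; linarith)
  change ((RR M L y U x a).card : ℝ) ≤ _ at hR1
  change (((RR M L y U x a) ∩ Tl).card : ℝ) ≤ _ at hR2
  set X := x / L with hX
  have hX0 : 0 < X := by positivity
  have hUX : 2 * (e1c * l / Y) * (4 * U / L * f⁻¹) = Cr * X := by
    rw [hU, hCr, hX]; field_simp; ring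
  have hR1' : ((RR M L y U x a).card : ℝ) ≤ Cr * X := by
    refine hR1.trans ?_
    rw [← hUX]
    exact mlr (mll hE3 (by norm_num)) (by positivity)
  have hR2' : (((RR M L y U x a) ∩ Tl).card : ℝ) ≤ X / 128 := by
    refine hR2.trans ?_
    have e : X / 128 = 2 * (e1c * l / Y) * (4 * U / L * f⁻¹ * (24 * (k * P0) / Cb)) := by
      rw [← mul_assoc, hUX, hCb]; field_simp
    rw [e]
    exact mlr (mll hE3 (by norm_num)) (by positivity)
  have hS : ((SS M y U).card : ℝ) ≤ X / 128 := by
    have := hsm' (SS M y U) fun n hn => by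
      obtain ⟨h1, h2, h3⟩ := SS_sub hU0.le n hn
      exact ⟨h1, h2.trans hUxL, h3⟩
    rw [hX, div_div, le_div_iff₀ (by positivity)]; linarith
  have hBX : X / 4 ≤ (B0 x).card := by
    rw [hX, div_div, div_le_iff₀ (by positivity)]; linarith
  have hBmem : ∀ q ∈ B0 x, q.Prime ∧ x / 4 < (q:ℝ) ∧ (q:ℝ) ≤ x := fun q hq => by
    have h1 := mem_filter.1 hq
    have h2 := (mem_Pr hxp.le).1 h1.1
    exact ⟨h2.1, h1.2, h2.2⟩
  clear hB0 hsm' hcard1 hcard2 hR1 hR2 hE3 ht hYA hYC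
  obtain ⟨aB, haB⟩ := cover_loop (X / 32) (X / 8) (by positivity) (by positivity) K (by
      have : (1:ℝ) ≤ K := by linarith
      exact_mod_cast this) (SS M y U ∪ RR M L y U x a) (B0 x) (by
    intro T' hT' B' hB' hTc hBc
    set T'' := (T' \ SS M y U) \ Tl with hT''
    have hTR : ∀ n ∈ T'', n ∈ T' ∧ n ∈ RR M L y U x a ∧ n ∉ Tl := by
      intro n hn
      rw [hT'', Finset.mem_sdiff, Finset.mem_sdiff] at hn
      exact ⟨hn.1.1, (mem_union.1 (hT' hn.1.1)).resolve_left hn.1.2, hn.2⟩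
    have hTcard : X / 64 ≤ T''.card := by
      have hsub : T' ⊆ (T'' ∪ SS M y U) ∪ (RR M L y U x a ∩ Tl) := by
        intro n hn
        rw [mem_union, mem_union, mem_inter, hT'', Finset.mem_sdiff, Finset.mem_sdiff]
        have h := mem_union.1 (hT' hn)
        by_cases h1 : n ∈ SS M y U
        · exact Or.inl (Or.inr h1)
        · by_cases h2 : n ∈ Tl
          · exact Or.inr ⟨h.resolve_left h1, h2⟩
          · exact Or.inl (Or.inl ⟨⟨hn, h1⟩, h2⟩)
      have h1 : (T'.card:ℝ) ≤ T''.card + (SS M y U).card + (RR M L y U x a ∩ Tl).card := by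
        exact_mod_cast (card_le_card hsub).trans ((card_union_le _ _).trans (Nat.add_le_add_right (card_union_le _ _) _))
      linarith only [h1, hTc, hS, hR2']
    obtain ⟨g, hg, F, hF, hFc⟩ := pick M hM G0 hG01.le (X / 64) (by positivity) T'' hTcard (fun r => r.Prime ∧ x / 4 < (r:ℝ)) (by
      intro n hn
      obtain ⟨-, hnR, hnl⟩ := hTR n hn
      obtain ⟨g, hg, r, hr, hr4, hgr, rfl⟩ := (mem_TT hU0.le fun g hg => (hGG1 g hg).1).1 (mem_filter.1 hnR).1
      have hgG := (mem_GG hG10).1 hg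
      refine ⟨g, (mem_GG hG00.le).2 ⟨hgG.1, ?_, hgG.2.2⟩, r, ⟨hr, hr4⟩, rfl⟩
      by_contra hc
      exact hnl ((mem_TT hU0.le fun g hg => (hGG2 g hg).1).2 ⟨g, mem_filter.2 ⟨hg, not_le.1 hc⟩, r, hr, hr4, hgr, rfl⟩))
    obtain ⟨hg1, hgG0, hgM⟩ := (mem_GG hG00.le).1 hg
    have hFR : ∀ r ∈ F, g * r ∈ RR M L y U x a := fun r hr => (hTR _ (hF r hr).2).2.1
    obtain ⟨q, hq, c, hqc⟩ := hsl a haV g hg1 hgM U (by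
        rw [← hG0U]
        exact mlr (mll hgG0 hkP.le) hxp.le) F (by
      intro r hr
      refine ⟨(hF r hr).1.1, (hF r hr).1.2, ?_, (mem_filter.1 (hFR r hr)).2⟩
      obtain ⟨g', hg', r', -, -, h, he⟩ := (mem_TT hU0.le fun g hg => (hGG1 g hg).1).1 (mem_filter.1 (hFR r hr)).1
      have : ((g * r : ℕ):ℝ) ≤ U := by rw [he]; push_cast; exact h
      exact_mod_cast this) (by
      calc 2 * ρ * U = (ρ * (128 * C)) * (f * x * Y / (64 * l)) := by rw [hU]; field_simp; ring
        _ ≤ 1 * (f * x * Y / (64 * l)) := mlr hρ1 (by positivity)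
        _ = X / 64 * f * (Y / l * L) := by rw [hX]; field_simp
        _ ≤ g * F.card * (Y / l * L) := mlr hFc (by positivity)) B' (fun q hq => hBmem q (hB' hq)) (by
      rw [hX, div_div, div_le_iff₀ (by positivity)] at hBc; linarith only [hBc])
    refine ⟨q, hq, c, hqc.trans ?_⟩
    refine card_le_card_of_injOn (fun r => g * r) ?_ fun r _ s _ h => Nat.eq_of_mul_eq_mul_left hg1 h
    intro r hr
    rw [mem_coe, mem_filter] at hr
    exact mem_coe.2 (mem_filter.2 ⟨(hTR _ (hF r hr.1).2).1, hr.2⟩)) (by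
    have hKp : (0:ℝ) < K := by linarith
    have h1 : (((SS M y U ∪ RR M L y U x a).card : ℕ) : ℝ) / K ≤ X / 32 := by
      rw [div_le_iff₀ hKp]
      have h2 : ((SS M y U ∪ RR M L y U x a).card : ℝ) ≤ (SS M y U).card + (RR M L y U x a).card := by
        exact_mod_cast card_union_le _ _
      have h3 := mll hK1 (show 0 ≤ X / 32 by positivity)
      linarith only [h2, h3, hR1', hS, hX0]
    linarith only [h1, hBX, hX0])
  exact final_cover M x y L U hxp hU0.le hy0.le hyx hDx hG1L a aB hBM haB

end

/-- For every `C_U > 0` and every `ε ∈ (0,1)` there exist `κ > 0` and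
`x₀` such that for all `x ≥ x₀` and all moduli `M` with `M ≤ κ·x^{1/5}` and
`ω(M) ≤ exp(log₂M·log₄M/log₃M)`, the primes `p ≤ x` with `p ∤ M` can sieve out the
interval `[1, U]` where `U = C_U·(φ(M)/M)·x·log y/log₂x`. -/
theorem stmt1 :
    ∀ CU : ℝ, 0 < CU → ∀ ε : ℝ, 0 < ε → ε < 1 →
    ∃ κ : ℝ, 0 < κ ∧ ∃ x₀ : ℝ, ∀ x : ℝ, x ≥ x₀ →
    ∀ M : ℕ, 1 ≤ M → (M : ℝ) ≤ κ * x ^ ((1 : ℝ) / 5) →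
    (M.primeFactors.card : ℝ) ≤
      Real.exp (Real.log^[2] (M : ℝ) * Real.log^[4] (M : ℝ) / Real.log^[3] (M : ℝ)) →
    ∃ a : ℕ → ℕ, ∀ n : ℕ, 1 ≤ n → (n : ℝ) ≤ UU CU M ε x →
      ∃ p : ℕ, p.Prime ∧ (p : ℝ) ≤ x ∧ ¬ p ∣ M ∧ n % p = a p % p := by
  intro CU hCU ε hε hε1
  have hε2 : 0 < 1 - ε := by linarith
  obtain ⟨x₀, h⟩ := Filter.eventually_atTop.1 (mainU (8 * CU * (1 - ε)) (by positivity))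
  refine ⟨1, one_pos, x₀, fun x hx M hM hMx _ => ?_⟩
  rw [one_mul] at hMx
  refine h x hx M hM hMx (Real.exp (Real.log x * Real.log (Real.log (Real.log x)) / (8 * Real.log (Real.log x)))) (Real.exp_pos _) (Real.log_exp _) _ ?_
  rw [UU, yy, Real.log_exp, Real.log_exp]
  simp only [Function.iterate_succ, Function.iterate_zero, Function.comp_apply, id]
  ring
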